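/- arXiv:1801.01561 — 4 statements merged into one kernel-verified Lean document; each statement's English description precedes it below -/
import Mathlib

section
/- Let n₁ + n₂ + n₃ = p + q = n be natural numbers, and inside the unitary group U(n) of complex n×n matrices consider the subgroups K = {block-diagonal matrices diag(k₁, k₂, k₃) : k₁ ∈ U(n₁), k₂ ∈ U(n₂), k₃ ∈ U(n₃)}, H = {block-diagonal matrices diag(h₁, h₂) : h₁ ∈ U(p), h₂ ∈ U(q)}, and B = O(n), the group of real orthogonal n×n matrices regarded as a subgroup of U(n). Then every element of U(n) can be written as a product k·b·h with k ∈ K, b ∈ B, h ∈ H if and only if min(p, q) ≤ 2 or min(n₁, n₂, n₃) ≤ 1. -/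
/-- Block index (among three consecutive blocks of sizes `n₁, n₂, n₃`) of a row/column
index `i`. -/
def blockIndex3 (n₁ n₂ : ℕ) (i : ℕ) : Fin 3 :=
  if i < n₁ then 0 else if i < n₁ + n₂ then 1 else 2

open Matrix

lemma kbh_real_form {m J : Type*} [Fintype m] [DecidableEq m] [Fintype J]
    (B : Matrix m J ℂ) (hB : ∀ i j, ((Bᴴ * B) i j).im = 0) :
    ∃ k ∈ Matrix.unitaryGroup m ℂ, ∀ i j, ((k * B) i j).im = 0 := by
  classical
  let b : J → EuclideanSpace ℂ m := fun j => WithLp.toLp 2 (fun i => B i j)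
  have hb : ∀ i j, inner ℂ (b i) (b j) = (Bᴴ * B) i j := by
    intro i j
    simp [b, PiLp.inner_apply, Matrix.mul_apply, mul_comm]
  let W : Submodule ℝ (EuclideanSpace ℂ m) := Submodule.span ℝ (Set.range b)
  have hW : ∀ x ∈ W, ∀ y ∈ W, (inner ℂ x y).im = 0 := by
    intro x hx y hy
    induction hx, hy using Submodule.span_induction₂ with
    | mem_mem x y hx hy =>
      obtain ⟨i, rfl⟩ := hx
      obtain ⟨j, rfl⟩ := hy
      rw [hb]; exact hB i j
    | zero_left y hy => simp
    | zero_right x hx => simp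
    | add_left x y z hx hy hz h1 h2 => simp [h1, h2]
    | add_right x y z hx hy hz h1 h2 => simp [h1, h2]
    | smul_left r x y hx hy h => 
      rw [← Complex.coe_smul, inner_smul_left]; simp [h]
    | smul_right r x y hx hy h => 
      rw [← Complex.coe_smul, inner_smul_right]; simp [h]
  have : FiniteDimensional ℝ W := FiniteDimensional.span_of_finite ℝ (Set.finite_range b)
  let e := stdOrthonormalBasis ℝ W
  have he : Orthonormal ℂ (fun i => (e i : EuclideanSpace ℂ m)) := by
    rw [orthonormal_iff_ite]
    intro i j
    have h := orthonormal_iff_ite.1 e.orthonormal i j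
    have h2 : (inner ℂ (e i : EuclideanSpace ℂ m) (e j)).re = if i = j then 1 else 0 := by
      rw [← h]; simp [Submodule.coe_inner, PiLp.inner_apply, Complex.inner]
    have h3 := hW _ (e i).2 _ (e j).2
    apply Complex.ext
    · rw [h2]; split_ifs <;> simp
    · rw [h3]; split_ifs <;> simp
  obtain ⟨u, f, hu, hf⟩ := he.toSubtypeRange.exists_orthonormalBasis_extension
  have hcard : Fintype.card u = Fintype.card m := by
    rw [← Module.finrank_eq_card_basis f.toBasis]; simp
  let f' := f.reindex (Fintype.equivOfCardEq hcard)
  have hfW : ∀ i, ∀ x ∈ W, (inner ℂ (f i) x).im = 0 := by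
    intro i x hx
    have hx' : (⟨x, hx⟩ : W) = ∑ l, e.repr ⟨x, hx⟩ l • e l := (e.sum_repr _).symm
    have hx'' : x = ∑ l, e.repr ⟨x, hx⟩ l • (e l : EuclideanSpace ℂ m) := by
      have := congrArg (Subtype.val) hx'
      simpa using this
    rw [hx'', inner_sum, Complex.im_sum]
    apply Finset.sum_eq_zero
    intro l _
    rw [← Complex.coe_smul, inner_smul_right]
    have hl : (e l : EuclideanSpace ℂ m) ∈ u := hu ⟨l, rfl⟩
    have hl2 : (e l : EuclideanSpace ℂ m) = f ⟨_, hl⟩ := by rw [hf]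
    rw [hl2, orthonormal_iff_ite.1 f.orthonormal]
    split_ifs <;> simp
  refine ⟨Matrix.of fun i l => star (f' i l), ?_, ?_⟩
  · rw [Matrix.mem_unitaryGroup_iff]
    ext i j
    have := orthonormal_iff_ite.1 f'.orthonormal i j
    simp only [PiLp.inner_apply] at this
    simp only [Matrix.mul_apply, Matrix.star_apply, Matrix.of_apply, star_star, Matrix.one_apply]
    rw [← this]
    exact Finset.sum_congr rfl fun l _ => by simp [mul_comm]
  · intro i j
    have h := hfW ((Fintype.equivOfCardEq hcard).symm i) (b j) (Submodule.subset_span ⟨j, rfl⟩)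
    rw [PiLp.inner_apply] at h
    rw [Matrix.mul_apply, ← h]
    congr 1
    exact Finset.sum_congr rfl fun l _ => by simp [mul_comm, f', b]

lemma kbh_phase (z : ℂ) : ∃ d : ℂ, star d * d = 1 ∧ (z * d).im = 0 := by
  by_cases hz : z = 0
  · exact ⟨1, by simp, by simp [hz]⟩
  · have hn : (‖z‖ : ℂ) ≠ 0 := by simpa using hz
    have h : z * star z = (‖z‖ : ℂ) ^ 2 := Complex.mul_conj' z
    refine ⟨star z / ‖z‖, ?_, ?_⟩
    · rw [star_div₀, star_star, show star (‖z‖ : ℂ) = ‖z‖ from Complex.conj_ofReal _]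
      field_simp
      exact h
    · rw [← mul_div_assoc, h, sq, mul_div_assoc, div_self hn]; simp

lemma kbh_phases {J : Type*} [Fintype J] (Q : Matrix J J ℂ) (hQ : Q.IsHermitian)
    (h : Fintype.card J ≤ 2 ∨ ∃ v : J → ℂ, ∀ i j, Q i j = star (v i) * v j) :
    ∃ d : J → ℂ, (∀ i, star (d i) * d i = 1) ∧ ∀ i j, (star (d i) * Q i j * d j).im = 0 := by
  classical
  have key : ∀ z w : ℂ, z.im = 0 → w.im = 0 → (z * w).im = 0 := by
    intro z w hz hw; simp [hz, hw]
  rcases h with h | ⟨v, hv⟩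
  · rcases isEmpty_or_nonempty J with hJ | ⟨⟨j0⟩⟩
    · exact ⟨fun _ => 1, fun i => (hJ.false i).elim, fun i => (hJ.false i).elim⟩
    choose d hd1 hd2 using fun j => kbh_phase (Q j0 j)
    have hdiag : ∀ i, (Q i i).im = 0 := by
      intro i
      have := hQ.apply i i
      exact Complex.conj_eq_iff_im.1 this
    refine ⟨fun j => if j = j0 then 1 else d j, ?_, ?_⟩
    · intro i
      dsimp only
      split_ifs
      · simp
      · exact hd1 i
    · intro i j
      by_cases hi : i = j0
      · by_cases hj : j = j0
        · simp [hi, hj, hdiag]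
        · subst hi; simpa [hj] using hd2 j
      · by_cases hj : j = j0
        · subst hj
          have h3 := hd2 i
          rw [← hQ.apply] at h3
          have h4 : (star (star (Q i j) * d i)).im = 0 := by
            have h5 : ∀ w : ℂ, w.im = 0 → (star w).im = 0 := by intro w hw; simp [hw]
            exact h5 _ h3
          rw [star_mul, star_star] at h4
          simpa [hi] using h4
        · have hij : i = j := by
            by_contra hne
            have : ({j0, i, j} : Finset J).card = 3 := by
              rw [Finset.card_eq_three]
              exact ⟨j0, i, j, Ne.symm hi, Ne.symm hj, hne, rfl⟩
            have := Finset.card_le_univ ({j0, i, j} : Finset J)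
            omega
          subst hij
          simp only [hi, if_false]
          rw [mul_right_comm, hd1, one_mul, hdiag]
  · choose d hd1 hd2 using fun j => kbh_phase (v j)
    refine ⟨d, hd1, ?_⟩
    intro i j
    have : star (d i) * Q i j * d j = star (v i * d i) * (v j * d j) := by
      rw [hv, star_mul]; ring
    rw [this]
    refine key _ _ ?_ (hd2 j)
    rw [Complex.star_def, Complex.conj_im, hd2, neg_zero]

lemma kbh_diag {J : Type*} [Fintype J] [DecidableEq J] (Q : Matrix J J ℂ) (hQ : Q.IsHermitian) :
    ∃ u ∈ Matrix.unitaryGroup J ℂ, ∃ d : J → ℝ, uᴴ * Q * u = diagonal (fun i => (d i : ℂ)) := by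
  refine ⟨hQ.eigenvectorUnitary, hQ.eigenvectorUnitary.2, hQ.eigenvalues, ?_⟩
  have := hQ.conjStarAlgAut_star_eigenvectorUnitary
  rw [Unitary.conjStarAlgAut_star_apply] at this
  exact this

/-- Projection on the coordinates in block `a`. -/
def kbhProj {ι : Type*} [DecidableEq ι] (r : ι → Fin 3) (a : Fin 3) : Matrix ι ι ℂ :=
  diagonal fun i => if r i = a then 1 else 0

lemma kbh_columns {ι J : Type*} [Fintype ι] [DecidableEq ι] [Fintype J] [DecidableEq J]
    (r : ι → Fin 3) (A : Matrix ι J ℂ) (hA : Aᴴ * A = 1)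
    (h : Fintype.card J ≤ 2 ∨ ∃ a, ∀ i j, r i = a → r j = a → i = j) :
    ∃ u ∈ Matrix.unitaryGroup J ℂ,
      ∀ a i j, (((A * u)ᴴ * kbhProj r a * (A * u)) i j).im = 0 := by
  have hE : ∀ a, (kbhProj r a)ᴴ = kbhProj r a := by
    intro a
    unfold kbhProj
    rw [diagonal_conjTranspose]
    congr 1
    ext i
    simp only [Pi.star_apply]
    split_ifs <;> simp
  obtain ⟨a0, h0⟩ : ∃ a0 : Fin 3, Fintype.card J ≤ 2 ∨ ∀ i j, r i = a0 → r j = a0 → i = j := by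
    rcases h with h | ⟨a, h⟩
    · exact ⟨0, Or.inl h⟩
    · exact ⟨a, Or.inr h⟩
  have hsum : kbhProj r a0 + kbhProj r (a0 + 1) + kbhProj r (a0 + 2) = 1 := by
    unfold kbhProj
    rw [diagonal_add, diagonal_add, ← diagonal_one]
    congr 1
    ext i
    generalize r i = x
    fin_cases a0 <;> fin_cases x <;> simp
  have hQ : ∀ a, (Aᴴ * kbhProj r a * A).IsHermitian := by
    intro a
    unfold Matrix.IsHermitian
    simp only [conjTranspose_mul, conjTranspose_conjTranspose, hE, Matrix.mul_assoc]
  obtain ⟨u, hu, e, he⟩ := kbh_diag _ (hQ (a0 + 1))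
  have hu1 : uᴴ * u = 1 := Matrix.mem_unitaryGroup_iff'.1 hu
  have hQ' : (uᴴ * (Aᴴ * kbhProj r a0 * A) * u).IsHermitian :=
    Matrix.isHermitian_conjTranspose_mul_mul u (hQ a0)
  obtain ⟨d, hd1, hd2⟩ := kbh_phases _ hQ' (by
    rcases h0 with h0 | h0
    · exact Or.inl h0
    right
    have hre : uᴴ * (Aᴴ * kbhProj r a0 * A) * u = (A * u)ᴴ * (kbhProj r a0 * (A * u)) := by
      simp only [conjTranspose_mul, Matrix.mul_assoc]
    by_cases hex : ∃ i0, r i0 = a0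
    · obtain ⟨i0, hi0⟩ := hex
      refine ⟨fun j => (A * u) i0 j, fun i j => ?_⟩
      rw [hre, Matrix.mul_apply, Finset.sum_eq_single i0]
      · simp [kbhProj, diagonal_mul, hi0, conjTranspose_apply]
      · intro b _ hb
        have : r b ≠ a0 := fun hb' => hb (h0 _ _ hb' hi0)
        simp [kbhProj, diagonal_mul, this]
      · simp
    · push Not at hex
      refine ⟨fun _ => 0, fun i j => ?_⟩
      rw [hre, Matrix.mul_apply]
      simp [kbhProj, hex])
  have hD : (diagonal d)ᴴ * diagonal d = (1 : Matrix J J ℂ) := by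
    rw [diagonal_conjTranspose, diagonal_mul_diagonal, ← diagonal_one]
    congr 1
    ext i
    exact hd1 i
  have hU : (u * diagonal d)ᴴ * (u * diagonal d) = 1 := by
    rw [conjTranspose_mul, Matrix.mul_assoc, ← Matrix.mul_assoc uᴴ, hu1, Matrix.one_mul, hD]
  refine ⟨u * diagonal d, Matrix.mem_unitaryGroup_iff'.2 hU, ?_⟩
  have hre : ∀ a i j, ((A * (u * diagonal d))ᴴ * kbhProj r a * (A * (u * diagonal d))) i j
      = star (d i) * (uᴴ * (Aᴴ * kbhProj r a * A) * u) i j * d j := by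
    intro a i j
    have : (A * (u * diagonal d))ᴴ * kbhProj r a * (A * (u * diagonal d))
      = diagonal (star d) * (uᴴ * (Aᴴ * kbhProj r a * A) * u) * diagonal d := by
      simp only [conjTranspose_mul, Matrix.mul_assoc, diagonal_conjTranspose]
    rw [this, mul_diagonal, diagonal_mul]; rfl
  have p0 : ∀ i j, (((A * (u * diagonal d))ᴴ * kbhProj r a0 * (A * (u * diagonal d))) i j).im = 0 := by
    intro i j; rw [hre]; exact hd2 i j
  have p1 : ∀ i j, (((A * (u * diagonal d))ᴴ * kbhProj r (a0 + 1) *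
      (A * (u * diagonal d))) i j).im = 0 := by
    intro i j
    rw [hre, he]
    by_cases hij : i = j
    · subst hij
      rw [mul_right_comm, hd1]; simp
    · simp [diagonal_apply_ne _ hij]
  have p2 : ∀ i j, (((A * (u * diagonal d))ᴴ * kbhProj r (a0 + 2) *
      (A * (u * diagonal d))) i j).im = 0 := by
    intro i j
    have : kbhProj r (a0 + 2) = 1 - kbhProj r a0 - kbhProj r (a0 + 1) := by
      rw [← hsum]; abel
    rw [this, Matrix.mul_sub, Matrix.mul_sub, Matrix.sub_mul, Matrix.sub_mul, Matrix.mul_one]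
    have h1 : (A * (u * diagonal d))ᴴ * (A * (u * diagonal d)) = 1 := by
      rw [conjTranspose_mul, Matrix.mul_assoc, ← Matrix.mul_assoc Aᴴ, hA, Matrix.one_mul, hU]
    rw [h1, Matrix.sub_apply, Matrix.sub_apply, Complex.sub_im, Complex.sub_im, p0, p1,
      Matrix.one_apply]
    split_ifs <;> simp
  intro a
  have ha : a = a0 ∨ a = a0 + 1 ∨ a = a0 + 2 := by
    clear * - 
    revert a a0; decide
  rcases ha with rfl | rfl | rfl
  · exact p0
  · exact p1
  · exact p2

lemma kbh_block_real {ι J : Type*} [Fintype ι] [DecidableEq ι] [Fintype J]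
    (r : ι → Fin 3) (C : Matrix ι J ℂ) (hC : ∀ a i j, ((Cᴴ * kbhProj r a * C) i j).im = 0) :
    ∃ k ∈ Matrix.unitaryGroup ι ℂ, (∀ i j, r i ≠ r j → k i j = 0) ∧
      ∀ i j, ((k * C) i j).im = 0 := by
  have hb : ∀ a : Fin 3, ∃ k ∈ Matrix.unitaryGroup {i // r i = a} ℂ,
      ∀ i j, ((k * C.submatrix (Subtype.val : {i // r i = a} → ι) id) i j).im = 0 := by
    intro a
    apply kbh_real_form
    intro i j
    rw [← hC a i j]
    congr 1
    rw [Matrix.mul_assoc, Matrix.mul_apply, Matrix.mul_apply]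
    simp only [kbhProj, diagonal_mul, conjTranspose_apply, submatrix_apply, id, ite_mul, one_mul,
      zero_mul, mul_ite, mul_zero]
    rw [← Finset.sum_filter]
    exact (Finset.sum_subtype (Finset.univ.filter fun x => r x = a) (by simp)
      (fun x => star (C x i) * C x j)).symm
  choose k hk1 hk2 using hb
  let σ := Equiv.sigmaFiberEquiv r
  refine ⟨(blockDiagonal' k).submatrix σ.symm σ.symm, ?_, ?_, ?_⟩
  · rw [Matrix.mem_unitaryGroup_iff, star_eq_conjTranspose, conjTranspose_submatrix,
      submatrix_mul_equiv, blockDiagonal'_conjTranspose, ← blockDiagonal'_mul]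
    have : (fun a => k a * (k a)ᴴ) = 1 := by
      ext1 a
      exact Matrix.mem_unitaryGroup_iff.1 (hk1 a)
    rw [this, blockDiagonal'_one, submatrix_one_equiv]
  · intro i j hij
    exact blockDiagonal'_apply_ne k _ _ hij
  · intro i j
    have h := hk2 (r i) ⟨i, rfl⟩ j
    rw [← h]
    congr 1
    rw [Matrix.mul_apply, Matrix.mul_apply, ← σ.sum_comp, Fintype.sum_sigma,
      Finset.sum_eq_single (r i)]
    · apply Finset.sum_congr rfl
      intro x _
      simp only [submatrix_apply, Equiv.symm_apply_apply]
      congr 1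
      exact blockDiagonal'_apply_eq _ _ _ _
    · intro b _ hb
      apply Finset.sum_eq_zero
      intro x _
      simp only [submatrix_apply, Equiv.symm_apply_apply]
      have : blockDiagonal' k (σ.symm i) ⟨b, x⟩ = 0 := blockDiagonal'_apply_ne _ _ _ hb.symm
      rw [this, zero_mul]
    · simp

lemma kbh_decomp {ι : Type*} [Fintype ι] [DecidableEq ι] (r : ι → Fin 3) (c : ι → Prop)
    [DecidablePred c]
    (h : Fintype.card {i // c i} ≤ 2 ∨ ∃ a, ∀ i j, r i = a → r j = a → i = j)
    (g : Matrix.unitaryGroup ι ℂ) :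
    ∃ k b h : Matrix.unitaryGroup ι ℂ,
      (∀ i j, r i ≠ r j → (k : Matrix ι ι ℂ) i j = 0) ∧
      (∀ i j, ((b : Matrix ι ι ℂ) i j).im = 0) ∧
      (∀ i j, ¬ (c i ↔ c j) → (h : Matrix ι ι ℂ) i j = 0) ∧ g = k * b * h := by
  let A : Matrix ι {i // c i} ℂ := (g : Matrix ι ι ℂ).submatrix id Subtype.val
  have hg : (g : Matrix ι ι ℂ)ᴴ * (g : Matrix ι ι ℂ) = 1 := Matrix.mem_unitaryGroup_iff'.1 g.2
  have hgA : (g : Matrix ι ι ℂ)ᴴ * A = ((1 : Matrix ι ι ℂ).submatrix id Subtype.val : Matrix ι {i // c i} ℂ) := by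
    rw [← hg]; ext i j; simp [A, Matrix.mul_apply]
  have hA : Aᴴ * A = 1 := by
    have : Aᴴ * A = ((g : Matrix ι ι ℂ)ᴴ * (g : Matrix ι ι ℂ)).submatrix Subtype.val Subtype.val := by
      ext i j; simp [A, Matrix.mul_apply]
    rw [this, hg, submatrix_one _ Subtype.val_injective]
  obtain ⟨u, hu, hu2⟩ := kbh_columns r A hA h
  obtain ⟨k, hk, hk2, hk3⟩ := kbh_block_real r (A * u) hu2
  have huu : uᴴ * u = 1 := Matrix.mem_unitaryGroup_iff'.1 hu
  have huu' : u * uᴴ = 1 := Matrix.mem_unitaryGroup_iff.1 hu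
  have hkk : kᴴ * k = 1 := Matrix.mem_unitaryGroup_iff'.1 hk
  have hR : (k * (A * u))ᴴ * (k * (A * u)) = 1 := by
    rw [conjTranspose_mul, Matrix.mul_assoc, ← Matrix.mul_assoc kᴴ, hkk, Matrix.one_mul,
      conjTranspose_mul, Matrix.mul_assoc, ← Matrix.mul_assoc Aᴴ, hA, Matrix.one_mul, huu]
  generalize hRdef : k * (A * u) = R at hk3 hR
  have hRre : ∀ i j, ((R i j).re : ℂ) = R i j := by
    intro i j; apply Complex.ext <;> simp [hk3]
  let v : ι → EuclideanSpace ℝ ι := fun j =>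
    if hj : c j then WithLp.toLp 2 (fun i => (R i ⟨j, hj⟩).re) else 0
  have hv : Orthonormal ℝ (({j | c j} : Set ι).domRestrict v) := by
    rw [orthonormal_iff_ite]
    rintro ⟨i, hi⟩ ⟨j, hj⟩
    have hi' : c i := hi
    have hj' : c j := hj
    have := congrFun (congrFun hR ⟨i, hi⟩) ⟨j, hj⟩
    rw [Matrix.mul_apply, Matrix.one_apply] at this
    have h2 := congrArg Complex.re this
    simp only [Set.domRestrict_apply, v, dif_pos hi', dif_pos hj', PiLp.inner_apply]
    rw [Complex.re_sum] at h2
    have h3 : (if (⟨i, hi⟩ : {i // c i}) = ⟨j, hj⟩ then (1 : ℂ) else 0).re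
        = if (⟨i, hi⟩ : ({j | c j} : Set ι)) = ⟨j, hj⟩ then (1 : ℝ) else 0 := by
      by_cases hij : i = j <;> simp [hij]
    rw [h3] at h2
    rw [← h2]
    apply Finset.sum_congr rfl
    intro l _
    simp [hk3, mul_comm]
  obtain ⟨b, hb⟩ := hv.exists_orthonormalBasis_extension_of_card_eq (by simp)
  let bm : Matrix ι ι ℂ := Matrix.of fun i j => ((b j i : ℝ) : ℂ)
  have hbm : bmᴴ * bm = 1 := by
    ext i j
    have := orthonormal_iff_ite.1 b.orthonormal i j
    rw [PiLp.inner_apply] at this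
    have h2 := congrArg (fun x : ℝ => (x : ℂ)) this
    rw [Matrix.one_apply]
    simp only [Matrix.mul_apply, bm, conjTranspose_apply, Matrix.of_apply]
    by_cases hij : i = j
    · simp only [hij, if_true] at h2 ⊢
      push_cast at h2
      rw [← h2]
      exact Finset.sum_congr rfl fun l _ => by simp [sq]
    · simp only [hij, if_false] at h2 ⊢
      push_cast at h2
      rw [← h2]
      exact Finset.sum_congr rfl fun l _ => by simp [mul_comm]
  have hbR : ∀ i (j : {j // c j}), bm i j = R i j := by
    intro i j
    have h1 : b j = v j := hb _ j.2
    simp only [bm, Matrix.of_apply, h1, v, dif_pos j.2]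
    exact hRre _ _
  let B : Matrix.unitaryGroup ι ℂ := ⟨bm, Matrix.mem_unitaryGroup_iff'.2 hbm⟩
  let K : Matrix.unitaryGroup ι ℂ := ⟨k, hk⟩
  refine ⟨K⁻¹, B, B⁻¹ * K * g, ?_, ?_, ?_, by group⟩
  · intro i j hij
    change kᴴ i j = 0
    rw [conjTranspose_apply, hk2 _ _ hij.symm, star_zero]
  · intro i j
    exact Complex.ofReal_im _
  · intro i j hij
    change (bmᴴ * k * (g : Matrix ι ι ℂ)) i j = 0
    by_cases hj : c j
    · have hi : ¬ c i := fun hi => hij (by simp [hi, hj])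
      have h1 : (bmᴴ * k * (g : Matrix ι ι ℂ)) i j = (bmᴴ * R * uᴴ) i ⟨j, hj⟩ := by
        rw [← hRdef]
        have : bmᴴ * (k * (A * u)) * uᴴ = bmᴴ * k * A := by
          simp only [Matrix.mul_assoc, huu', Matrix.mul_one]
        rw [this]; rfl
      have h2 : ∀ l : {j // c j}, (bmᴴ * R) i l = 0 := by
        intro l
        have h3 : (bmᴴ * R) i l = (bmᴴ * bm) i l := by
          simp only [Matrix.mul_apply, hbR]
        rw [h3, hbm, Matrix.one_apply_ne]
        rintro rfl; exact hi l.2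
      rw [h1, Matrix.mul_apply]
      simp [h2]
    · have hi : c i := by by_contra hi; exact hij (by simp [hi, hj])
      have h1 : star ((bmᴴ * k * (g : Matrix ι ι ℂ)) i j)
          = ((g : Matrix ι ι ℂ)ᴴ * kᴴ * R) j ⟨i, hi⟩ := by
        rw [← conjTranspose_apply, conjTranspose_mul, conjTranspose_mul, conjTranspose_conjTranspose,
          ← Matrix.mul_assoc, Matrix.mul_apply, Matrix.mul_apply]
        exact Finset.sum_congr rfl fun l _ => by rw [← hbR]
      have h2 : (g : Matrix ι ι ℂ)ᴴ * kᴴ * R = ((1 : Matrix ι ι ℂ).submatrix id Subtype.val : Matrix ι {i // c i} ℂ) * u := by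
        rw [← hRdef, ← hgA, Matrix.mul_assoc, ← Matrix.mul_assoc kᴴ, hkk, Matrix.one_mul,
          Matrix.mul_assoc]
      rw [← star_eq_zero, h1, h2, Matrix.mul_apply]
      apply Finset.sum_eq_zero
      intro l _
      rw [submatrix_apply, id, Matrix.one_apply_ne, zero_mul]
      rintro rfl; exact hj l.2

/-- Projection on the coordinates satisfying `c`. -/
def kbhF {ι : Type*} [DecidableEq ι] (c : ι → Prop) [DecidablePred c] : Matrix ι ι ℂ :=
  diagonal fun i => if c i then 1 else 0

/-- The compressed projection. -/
def kbhM {ι : Type*} [Fintype ι] {R : Type*} [Semiring R] [Star R] (F g E : Matrix ι ι R) :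
    Matrix ι ι R :=
  F * gᴴ * E * g * F

/-- The trace of the cube of the commutator. -/
def kbhT {ι : Type*} [Fintype ι] {R : Type*} [Ring R] (M N : Matrix ι ι R) : R :=
  trace ((M * N - N * M) * (M * N - N * M) * (M * N - N * M))

lemma kbh_T_symm {ι : Type*} [Fintype ι] (M N : Matrix ι ι ℂ) (hM : Mᵀ = M) (hN : Nᵀ = N) :
    kbhT M N = 0 := by
  unfold kbhT
  have hX : (M * N - N * M)ᵀ = -(M * N - N * M) := by
    rw [transpose_sub, transpose_mul, transpose_mul, hM, hN]; abel
  generalize M * N - N * M = X at hX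
  have h := trace_transpose (X * X * X)
  rw [transpose_mul, transpose_mul, hX] at h
  simp only [Matrix.neg_mul, Matrix.mul_neg, neg_neg, trace_neg, ← Matrix.mul_assoc] at h
  have h2 : (2 : ℂ) * trace (X * X * X) = 0 := by linear_combination -h
  simpa using h2

lemma kbh_T_conj {ι : Type*} [Fintype ι] [DecidableEq ι] (M N h : Matrix ι ι ℂ) (hh : h * hᴴ = 1) :
    kbhT (hᴴ * M * h) (hᴴ * N * h) = kbhT M N := by
  have hm : ∀ P Q : Matrix ι ι ℂ, (hᴴ * P * h) * (hᴴ * Q * h) = hᴴ * (P * Q) * h := by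
    intro P Q
    calc (hᴴ * P * h) * (hᴴ * Q * h) = hᴴ * P * (h * hᴴ) * Q * h := by
          simp only [Matrix.mul_assoc]
      _ = _ := by rw [hh]; simp only [Matrix.mul_assoc, Matrix.one_mul]
  unfold kbhT
  have hX : (hᴴ * M * h) * (hᴴ * N * h) - (hᴴ * N * h) * (hᴴ * M * h) 
      = hᴴ * (M * N - N * M) * h := by
    rw [hm, hm, Matrix.mul_sub, Matrix.sub_mul]
  rw [hX, hm, hm, trace_mul_cycle, hh, Matrix.one_mul]

lemma kbh_obstruction {ι : Type*} [Fintype ι] [DecidableEq ι] (r : ι → Fin 3) (c : ι → Prop)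
    [DecidablePred c] (g k b h : Matrix ι ι ℂ) (hk : kᴴ * k = 1) (hh : h * hᴴ = 1)
    (hk2 : ∀ i j, r i ≠ r j → k i j = 0) (hb : ∀ i j, (b i j).im = 0)
    (hh2 : ∀ i j, ¬ (c i ↔ c j) → h i j = 0) (hg : g = k * b * h) :
    kbhT (kbhM (kbhF c) g (kbhProj r 0)) (kbhM (kbhF c) g (kbhProj r 1)) = 0 := by
  have hE : ∀ a, kbhProj r a * k = k * kbhProj r a := by
    intro a
    ext i j
    simp only [kbhProj, diagonal_mul, mul_diagonal]
    by_cases hij : r i = r j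
    · rw [hij]; ring
    · rw [hk2 i j hij]; simp
  have hF : h * kbhF c = kbhF c * h := by
    ext i j
    simp only [kbhF, diagonal_mul, mul_diagonal]
    by_cases hij : c i ↔ c j
    · simp only [hij]; ring
    · rw [hh2 i j hij]; simp
  have hFs : (kbhF c)ᴴ = kbhF c := by
    unfold kbhF
    rw [diagonal_conjTranspose]
    congr 1
    ext i
    simp only [Pi.star_apply]
    split_ifs <;> simp
  have hF' : kbhF c * hᴴ = hᴴ * kbhF c := by
    have := congrArg conjTranspose hF
    rwa [conjTranspose_mul, conjTranspose_mul, hFs] at this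
  have hM : ∀ a, kbhM (kbhF c) g (kbhProj r a) = hᴴ * kbhM (kbhF c) b (kbhProj r a) * h := by
    intro a
    unfold kbhM
    rw [hg]
    simp only [conjTranspose_mul]
    calc kbhF c * (hᴴ * (bᴴ * kᴴ)) * kbhProj r a * (k * b * h) * kbhF c
        = (kbhF c * hᴴ) * bᴴ * kᴴ * (kbhProj r a * k) * b * (h * kbhF c) := by
          simp only [Matrix.mul_assoc]
      _ = hᴴ * kbhF c * bᴴ * (kᴴ * k) * kbhProj r a * b * kbhF c * h := by
          rw [hF', hE, hF]; simp only [Matrix.mul_assoc]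
      _ = _ := by rw [hk, Matrix.mul_one]; simp only [Matrix.mul_assoc]
  have hbt : bᴴ = bᵀ := by
    ext i j
    exact Complex.conj_eq_iff_im.2 (hb j i)
  have hS : ∀ a, (kbhM (kbhF c) b (kbhProj r a))ᵀ = kbhM (kbhF c) b (kbhProj r a) := by
    intro a
    unfold kbhM
    rw [hbt]
    simp only [transpose_mul, transpose_transpose, kbhF, kbhProj, diagonal_transpose,
      Matrix.mul_assoc]
  rw [hM, hM, kbh_T_conj _ _ _ hh]
  exact kbh_T_symm _ _ (hS 0) (hS 1)

/-- Three times a Gaussian rational unitary matrix built from a conference matrix. -/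
def kbhG : Matrix (Fin 6) (Fin 6) GaussianInt :=
  let a : GaussianInt := ⟨2, 0⟩
  let b : GaussianInt := ⟨0, 1⟩
  let d : GaussianInt := ⟨0, -1⟩
  !![a, b, b, b, b, b; b, a, b, d, d, b; b, b, a, b, d, d;
     b, d, b, a, b, d; b, d, d, b, a, b; b, b, d, d, b, a]

/-- Row blocks of the base example. -/
def kbhr : Fin 6 → Fin 3 := ![0, 0, 1, 1, 2, 2]

/-- Integer version of the projection. -/
def kbhE (a : Fin 3) : Matrix (Fin 6) (Fin 6) GaussianInt :=
  diagonal fun i => if kbhr i = a then 1 else 0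

/-- Integer version of the projection. -/
def kbhFi : Matrix (Fin 6) (Fin 6) GaussianInt :=
  diagonal fun i => if i < 3 then 1 else 0

lemma kbhG_unitary : kbhG * kbhGᴴ = diagonal fun _ => 9 := by
  decide +kernel

/-- Intermediate value in the explicit computation. -/
def kbhA : Matrix (Fin 6) (Fin 6) GaussianInt :=
  !![⟨2, 0⟩, ⟨0, 1⟩, ⟨0, 1⟩, ⟨0, 0⟩, ⟨0, 0⟩, ⟨0, 0⟩;
     ⟨0, 1⟩, ⟨2, 0⟩, ⟨0, 1⟩, ⟨0, 0⟩, ⟨0, 0⟩, ⟨0, 0⟩;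
     ⟨0, 1⟩, ⟨0, 1⟩, ⟨2, 0⟩, ⟨0, 0⟩, ⟨0, 0⟩, ⟨0, 0⟩;
     ⟨0, 1⟩, ⟨0, -1⟩, ⟨0, 1⟩, ⟨0, 0⟩, ⟨0, 0⟩, ⟨0, 0⟩;
     ⟨0, 1⟩, ⟨0, -1⟩, ⟨0, -1⟩, ⟨0, 0⟩, ⟨0, 0⟩, ⟨0, 0⟩;
     ⟨0, 1⟩, ⟨0, 1⟩, ⟨0, -1⟩, ⟨0, 0⟩, ⟨0, 0⟩, ⟨0, 0⟩]

/-- Intermediate value in the explicit computation. -/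
def kbhM0 : Matrix (Fin 6) (Fin 6) GaussianInt :=
  !![⟨5, 0⟩, ⟨0, 0⟩, ⟨1, 2⟩, ⟨0, 0⟩, ⟨0, 0⟩, ⟨0, 0⟩;
     ⟨0, 0⟩, ⟨5, 0⟩, ⟨1, 2⟩, ⟨0, 0⟩, ⟨0, 0⟩, ⟨0, 0⟩;
     ⟨1, -2⟩, ⟨1, -2⟩, ⟨2, 0⟩, ⟨0, 0⟩, ⟨0, 0⟩, ⟨0, 0⟩;
     ⟨0, 0⟩, ⟨0, 0⟩, ⟨0, 0⟩, ⟨0, 0⟩, ⟨0, 0⟩, ⟨0, 0⟩;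
     ⟨0, 0⟩, ⟨0, 0⟩, ⟨0, 0⟩, ⟨0, 0⟩, ⟨0, 0⟩, ⟨0, 0⟩;
     ⟨0, 0⟩, ⟨0, 0⟩, ⟨0, 0⟩, ⟨0, 0⟩, ⟨0, 0⟩, ⟨0, 0⟩]

/-- Intermediate value in the explicit computation. -/
def kbhM1 : Matrix (Fin 6) (Fin 6) GaussianInt :=
  !![⟨2, 0⟩, ⟨0, 0⟩, ⟨1, -2⟩, ⟨0, 0⟩, ⟨0, 0⟩, ⟨0, 0⟩;
     ⟨0, 0⟩, ⟨2, 0⟩, ⟨-1, -2⟩, ⟨0, 0⟩, ⟨0, 0⟩, ⟨0, 0⟩;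
     ⟨1, 2⟩, ⟨-1, 2⟩, ⟨5, 0⟩, ⟨0, 0⟩, ⟨0, 0⟩, ⟨0, 0⟩;
     ⟨0, 0⟩, ⟨0, 0⟩, ⟨0, 0⟩, ⟨0, 0⟩, ⟨0, 0⟩, ⟨0, 0⟩;
     ⟨0, 0⟩, ⟨0, 0⟩, ⟨0, 0⟩, ⟨0, 0⟩, ⟨0, 0⟩, ⟨0, 0⟩;
     ⟨0, 0⟩, ⟨0, 0⟩, ⟨0, 0⟩, ⟨0, 0⟩, ⟨0, 0⟩, ⟨0, 0⟩]

/-- Intermediate value in the explicit computation. -/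
def kbhX : Matrix (Fin 6) (Fin 6) GaussianInt :=
  !![⟨0, 8⟩, ⟨-2, 4⟩, ⟨6, 0⟩, ⟨0, 0⟩, ⟨0, 0⟩, ⟨0, 0⟩;
     ⟨2, 4⟩, ⟨0, 0⟩, ⟨0, 0⟩, ⟨0, 0⟩, ⟨0, 0⟩, ⟨0, 0⟩;
     ⟨-6, 0⟩, ⟨0, 0⟩, ⟨0, -8⟩, ⟨0, 0⟩, ⟨0, 0⟩, ⟨0, 0⟩;
     ⟨0, 0⟩, ⟨0, 0⟩, ⟨0, 0⟩, ⟨0, 0⟩, ⟨0, 0⟩, ⟨0, 0⟩;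
     ⟨0, 0⟩, ⟨0, 0⟩, ⟨0, 0⟩, ⟨0, 0⟩, ⟨0, 0⟩, ⟨0, 0⟩;
     ⟨0, 0⟩, ⟨0, 0⟩, ⟨0, 0⟩, ⟨0, 0⟩, ⟨0, 0⟩, ⟨0, 0⟩]

/-- Intermediate value in the explicit computation. -/
def kbhX2 : Matrix (Fin 6) (Fin 6) GaussianInt :=
  !![⟨-120, 0⟩, ⟨-32, -16⟩, ⟨0, 0⟩, ⟨0, 0⟩, ⟨0, 0⟩, ⟨0, 0⟩;
     ⟨-32, 16⟩, ⟨-20, 0⟩, ⟨12, 24⟩, ⟨0, 0⟩, ⟨0, 0⟩, ⟨0, 0⟩;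
     ⟨0, 0⟩, ⟨12, -24⟩, ⟨-100, 0⟩, ⟨0, 0⟩, ⟨0, 0⟩, ⟨0, 0⟩;
     ⟨0, 0⟩, ⟨0, 0⟩, ⟨0, 0⟩, ⟨0, 0⟩, ⟨0, 0⟩, ⟨0, 0⟩;
     ⟨0, 0⟩, ⟨0, 0⟩, ⟨0, 0⟩, ⟨0, 0⟩, ⟨0, 0⟩, ⟨0, 0⟩;
     ⟨0, 0⟩, ⟨0, 0⟩, ⟨0, 0⟩, ⟨0, 0⟩, ⟨0, 0⟩, ⟨0, 0⟩]

lemma kbhA_eq : kbhG * kbhFi = kbhA := by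
  decide +kernel

lemma kbhA_conj : kbhFi * kbhGᴴ = kbhAᴴ := by
  decide +kernel

lemma kbhM0_eq : kbhM kbhFi kbhG (kbhE 0) = kbhM0 := by
  have h : kbhAᴴ * (kbhE 0 * kbhA) = kbhM0 := by decide +kernel
  rw [← h, kbhM, kbhA_conj, Matrix.mul_assoc, kbhA_eq, Matrix.mul_assoc]

lemma kbhM1_eq : kbhM kbhFi kbhG (kbhE 1) = kbhM1 := by
  have h : kbhAᴴ * (kbhE 1 * kbhA) = kbhM1 := by decide +kernel
  rw [← h, kbhM, kbhA_conj, Matrix.mul_assoc, kbhA_eq, Matrix.mul_assoc]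

lemma kbhX_eq : kbhM0 * kbhM1 - kbhM1 * kbhM0 = kbhX := by
  decide +kernel

lemma kbhX2_eq : kbhX * kbhX = kbhX2 := by
  decide +kernel

lemma kbhX3_trace : trace (kbhX2 * kbhX) = ⟨0, -480⟩ := by
  decide +kernel

lemma kbhG_T : kbhT (kbhM kbhFi kbhG (kbhE 0)) (kbhM kbhFi kbhG (kbhE 1)) = ⟨0, -480⟩ := by
  rw [kbhM0_eq, kbhM1_eq, kbhT, kbhX_eq, kbhX2_eq, kbhX3_trace]

/-- The base unitary matrix. -/
noncomputable def kbhg : Matrix (Fin 6) (Fin 6) ℂ := (3⁻¹ : ℂ) • kbhG.map GaussianInt.toComplex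

lemma kbh_map_conj (A : Matrix (Fin 6) (Fin 6) GaussianInt) :
    (A.map GaussianInt.toComplex)ᴴ = Aᴴ.map GaussianInt.toComplex := by
  ext i j
  simp [conjTranspose_apply, GaussianInt.toComplex_star]

lemma kbhg_unitary : kbhg * kbhgᴴ = 1 := by
  unfold kbhg
  rw [conjTranspose_smul, kbh_map_conj, Matrix.smul_mul, Matrix.mul_smul, ← Matrix.map_mul,
    kbhG_unitary, smul_smul, ← diagonal_one, Matrix.diagonal_map (by simp), ← diagonal_smul]
  congr 1
  ext i
  have h9 : GaussianInt.toComplex 9 = 9 := map_ofNat _ 9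
  simp [h9]
  norm_num

lemma kbh_T_smul {ι : Type*} [Fintype ι] (M N : Matrix ι ι ℂ) (s : ℂ) :
    kbhT (s • M) (s • N) = s ^ 6 * kbhT M N := by
  unfold kbhT
  simp only [Matrix.smul_mul, Matrix.mul_smul, ← smul_sub, trace_smul, smul_eq_mul]
  ring

lemma kbhg_T : kbhT (kbhM (kbhF fun i : Fin 6 => i < 3) kbhg (kbhProj kbhr 0))
    (kbhM (kbhF fun i : Fin 6 => i < 3) kbhg (kbhProj kbhr 1)) ≠ 0 := by
  have hE : ∀ a, kbhProj kbhr a = (kbhE a).map GaussianInt.toComplex := by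
    intro a
    unfold kbhProj kbhE
    rw [Matrix.diagonal_map (by simp)]
    congr 1
    ext i
    split_ifs <;> simp
  have hF : kbhF (fun i : Fin 6 => i < 3) = kbhFi.map GaussianInt.toComplex := by
    unfold kbhF kbhFi
    rw [Matrix.diagonal_map (by simp)]
    congr 1
    ext i
    dsimp only
    split_ifs <;> simp
  have hM : ∀ a, kbhM (kbhF fun i : Fin 6 => i < 3) kbhg (kbhProj kbhr a)
      = (9⁻¹ : ℂ) • (kbhM kbhFi kbhG (kbhE a)).map GaussianInt.toComplex := by
    intro a
    unfold kbhM kbhg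
    rw [hE, hF, conjTranspose_smul, kbh_map_conj]
    simp only [Matrix.map_mul, Matrix.mul_smul, Matrix.smul_mul, smul_smul]
    congr 1
    simp
    norm_num
  rw [hM, hM, kbh_T_smul]
  have hT : ∀ M N : Matrix (Fin 6) (Fin 6) GaussianInt,
      kbhT (M.map GaussianInt.toComplex) (N.map GaussianInt.toComplex)
        = GaussianInt.toComplex (kbhT M N) := by
    intro M N
    unfold kbhT
    rw [AddMonoidHom.map_trace]
    simp [Matrix.map_mul, Matrix.map_sub]
  rw [hT, kbhG_T]
  simp [GaussianInt.toComplex_def]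

lemma kbh_T_blocks {Y : Type*} [Fintype Y] [DecidableEq Y] 
    (M N : Matrix (Fin 6) (Fin 6) ℂ) (x y : Y → ℂ) :
    kbhT (fromBlocks M 0 0 (diagonal x)) (fromBlocks N 0 0 (diagonal y)) = kbhT M N := by
  unfold kbhT
  simp only [fromBlocks_multiply, Matrix.mul_zero, Matrix.zero_mul, add_zero, zero_add,
    diagonal_mul_diagonal, sub_eq_add_neg, fromBlocks_neg, fromBlocks_add, neg_zero]
  have : (diagonal (fun i => x i * y i) + -diagonal fun i => y i * x i : Matrix Y Y ℂ) = 0 := by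
    rw [← sub_eq_add_neg, sub_eq_zero]
    congr 1; ext i; ring
  rw [this]; simp [trace]

lemma kbh_M_blocks {Y : Type*} [Fintype Y] [DecidableEq Y] (r : Fin 6 ⊕ Y → Fin 3)
    (c : Fin 6 ⊕ Y → Prop) [DecidablePred c] (hr : ∀ i, r (Sum.inl i) = kbhr i)
    (hc : ∀ i, c (Sum.inl i) ↔ i < 3) (a : Fin 3) : ∃ x : Y → ℂ, 
    kbhM (kbhF c) (fromBlocks kbhg 0 0 1) (kbhProj r a) =
      fromBlocks (kbhM (kbhF fun i : Fin 6 => i < 3) kbhg (kbhProj kbhr a)) 0 0 (diagonal x) := by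
  have hE : kbhProj r a = fromBlocks (kbhProj kbhr a) 0 0
      (diagonal fun y => if r (Sum.inr y) = a then 1 else 0) := by
    unfold kbhProj
    rw [fromBlocks_diagonal]
    congr 1
    ext i
    cases i <;> simp [hr]
  have hF : kbhF c = fromBlocks (kbhF fun i : Fin 6 => i < 3) 0 0
      (diagonal fun y => if c (Sum.inr y) then 1 else 0) := by
    unfold kbhF
    rw [fromBlocks_diagonal]
    congr 1
    ext i
    cases i <;> simp [hc]
  unfold kbhM
  rw [hE, hF, fromBlocks_conjTranspose]
  simp only [fromBlocks_multiply, Matrix.mul_zero, Matrix.zero_mul, add_zero, zero_add,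
    diagonal_mul_diagonal, conjTranspose_zero, conjTranspose_one, Matrix.mul_one]
  exact ⟨_, rfl⟩

lemma kbh_counter {ι : Type*} [Fintype ι] [DecidableEq ι] (r : ι → Fin 3)
    (c : ι → Prop) [DecidablePred c] (ρ σ : Fin 6 → ι) (hρ : Function.Injective ρ)
    (hσ : Function.Injective σ) (hr : ∀ i, r (ρ i) = kbhr i) (hc : ∀ i, c (σ i) ↔ i < 3) :
    ∃ g : Matrix.unitaryGroup ι ℂ,
      kbhT (kbhM (kbhF c) (g : Matrix ι ι ℂ) (kbhProj r 0))
        (kbhM (kbhF c) (g : Matrix ι ι ℂ) (kbhProj r 1)) ≠ 0 := by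
  classical
  obtain ⟨π, hπ⟩ := Equiv.Perm.exists_extending_pair ρ σ hρ hσ
  let e : Fin 6 ⊕ {x // x ∉ Set.range ρ} ≃ ι :=
    ((Equiv.ofInjective ρ hρ).sumCongr (Equiv.refl _)).trans (Equiv.sumCompl (· ∈ Set.range ρ))
  have he : ∀ i, e (Sum.inl i) = ρ i := fun i => rfl
  let e' := e.trans π
  have he' : ∀ i, e' (Sum.inl i) = σ i := fun i => by simp [e', he, hπ]
  let G : Matrix (Fin 6 ⊕ {x // x ∉ Set.range ρ}) (Fin 6 ⊕ {x // x ∉ Set.range ρ}) ℂ :=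
    fromBlocks kbhg 0 0 1
  have hG : G * Gᴴ = 1 := by
    simp only [G, fromBlocks_conjTranspose, fromBlocks_multiply, kbhg_unitary]
    simp
  have hE : ∀ a, kbhProj r a = (kbhProj (r ∘ e) a).submatrix e.symm e.symm := by
    intro a
    ext i j
    simp [kbhProj, diagonal_apply]
  have hF : kbhF c = (kbhF (c ∘ e')).submatrix e'.symm e'.symm := by
    ext i j
    simp [kbhF, diagonal_apply]
  have hM : ∀ a, kbhM (kbhF c) (G.submatrix e.symm e'.symm) (kbhProj r a)
      = (kbhM (kbhF (c ∘ e')) G (kbhProj (r ∘ e) a)).submatrix e'.symm e'.symm := by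
    intro a
    unfold kbhM
    rw [hE, hF, conjTranspose_submatrix]
    simp only [submatrix_mul_equiv]
  refine ⟨⟨G.submatrix e.symm e'.symm, ?_⟩, ?_⟩
  · rw [Matrix.mem_unitaryGroup_iff, star_eq_conjTranspose, conjTranspose_submatrix,
      submatrix_mul_equiv, hG, submatrix_one_equiv]
  · change kbhT (kbhM (kbhF c) (G.submatrix e.symm e'.symm) (kbhProj r 0))
        (kbhM (kbhF c) (G.submatrix e.symm e'.symm) (kbhProj r 1)) ≠ 0
    have hT : ∀ M N : Matrix (Fin 6 ⊕ {x // x ∉ Set.range ρ}) (Fin 6 ⊕ {x // x ∉ Set.range ρ}) ℂ,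
        kbhT (M.submatrix e'.symm e'.symm) (N.submatrix e'.symm e'.symm) = kbhT M N := by
      intro M N
      unfold kbhT
      have hs : ∀ P Q : Matrix (Fin 6 ⊕ {x // x ∉ Set.range ρ}) (Fin 6 ⊕ {x // x ∉ Set.range ρ}) ℂ,
          P.submatrix e'.symm e'.symm - Q.submatrix e'.symm e'.symm
            = (P - Q).submatrix e'.symm e'.symm := fun P Q => rfl
      simp only [submatrix_mul_equiv, hs]
      generalize (M * N - N * M) * (M * N - N * M) * (M * N - N * M) = P
      exact e'.symm.sum_comp (fun i => P i i)
    rw [hM, hM, hT]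
    obtain ⟨x, hx⟩ := kbh_M_blocks (r ∘ e) (c ∘ e') (fun i => by simp [he, hr])
      (fun i => by simp [he', hc]) 0
    obtain ⟨y, hy⟩ := kbh_M_blocks (r ∘ e) (c ∘ e') (fun i => by simp [he, hr])
      (fun i => by simp [he', hc]) 1
    rw [hx, hy, kbh_T_blocks]
    exact kbhg_T

/-- **(Kobayashi)** For `n₁ + n₂ + n₃ = p + q = n`, with
`K = U(n₁) × U(n₂) × U(n₃)` and `H = U(p) × U(q)` block-diagonally embedded in `U(n)`
and `B = O(n)` the real orthogonal matrices in `U(n)`, one has `U(n) = K B H` if and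
only if `min p q ≤ 2` or `min n₁ n₂ n₃ ≤ 1`. -/
theorem unitary_eq_KBH_iff
    (n n₁ n₂ n₃ p q : ℕ) (h1 : n₁ + n₂ + n₃ = n) (h2 : p + q = n) :
    (∀ g : Matrix.unitaryGroup (Fin n) ℂ,
      ∃ k b h : Matrix.unitaryGroup (Fin n) ℂ,
        (∀ i j : Fin n, blockIndex3 n₁ n₂ (i : ℕ) ≠ blockIndex3 n₁ n₂ (j : ℕ) →
          (k : Matrix (Fin n) (Fin n) ℂ) i j = 0) ∧
        (∀ i j : Fin n, ((b : Matrix (Fin n) (Fin n) ℂ) i j).im = 0) ∧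
        (∀ i j : Fin n, ¬(((i : ℕ) < p) ↔ ((j : ℕ) < p)) →
          (h : Matrix (Fin n) (Fin n) ℂ) i j = 0) ∧
        g = k * b * h) ↔
    (min p q ≤ 2 ∨ min n₁ (min n₂ n₃) ≤ 1) := by
  constructor
  · intro hall
    by_contra hcon
    push Not at hcon
    obtain ⟨hpq, hn⟩ := hcon
    have hp : 3 ≤ p := by omega
    have hq : 3 ≤ q := by omega
    have hn1 : 2 ≤ n₁ := by omega
    have hn2 : 2 ≤ n₂ := by omega
    have hn3 : 2 ≤ n₃ := by omega
    let ρ : Fin 6 → Fin n := ![⟨0, by omega⟩, ⟨1, by omega⟩, ⟨n₁, by omega⟩, ⟨n₁ + 1, by omega⟩,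
      ⟨n₁ + n₂, by omega⟩, ⟨n₁ + n₂ + 1, by omega⟩]
    let σ : Fin 6 → Fin n := ![⟨0, by omega⟩, ⟨1, by omega⟩, ⟨2, by omega⟩, ⟨p, by omega⟩,
      ⟨p + 1, by omega⟩, ⟨p + 2, by omega⟩]
    obtain ⟨g, hg⟩ := kbh_counter (fun i : Fin n => blockIndex3 n₁ n₂ (i : ℕ))
      (fun i : Fin n => (i : ℕ) < p) ρ σ
      (by
        intro i j hij
        have hij' := congrArg Fin.val hij
        fin_cases i <;> fin_cases j <;> simp [ρ] at hij' ⊢ <;> omega)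
      (by
        intro i j hij
        have hij' := congrArg Fin.val hij
        fin_cases i <;> fin_cases j <;> simp [σ] at hij' ⊢ <;> omega)
      (by
        intro i
        have l1 : 1 < n₁ := by omega
        fin_cases i <;> simp [ρ, kbhr, blockIndex3, l1] <;> (try split_ifs) <;>
          first | rfl | omega)
      (by
        intro i
        fin_cases i <;> simp [σ] <;> omega)
    obtain ⟨k, b, h, hk, hb, hh, hgk⟩ := hall g
    exact hg (kbh_obstruction _ _ _ k b h (Matrix.mem_unitaryGroup_iff'.1 k.2)
      (Matrix.mem_unitaryGroup_iff.1 h.2) hk hb hh (by rw [hgk]; rfl))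
  · intro hcon g
    have hcardp : Fintype.card {i : Fin n // (i : ℕ) < p} = p := by
      rw [Fintype.card_subtype, Fin.card_filter_val_lt]; omega
    have hcardq : Fintype.card {i : Fin n // ¬ (i : ℕ) < p} = q := by
      rw [Fintype.card_subtype_compl, hcardp, Fintype.card_fin]; omega
    by_cases hq : q ≤ 2
    · obtain ⟨k, b, h, hk, hb, hh, hg⟩ := kbh_decomp (fun i : Fin n => blockIndex3 n₁ n₂ (i : ℕ))
        (fun i : Fin n => ¬ (i : ℕ) < p) (Or.inl (by rw [hcardq]; exact hq)) g
      exact ⟨k, b, h, hk, hb, fun i j hij => hh i j (by tauto), hg⟩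
    · apply kbh_decomp (fun i : Fin n => blockIndex3 n₁ n₂ (i : ℕ)) (fun i : Fin n => (i : ℕ) < p)
      by_cases hp : p ≤ 2
      · left; rw [hcardp]; exact hp
      right
      have hn : n₁ ≤ 1 ∨ n₂ ≤ 1 ∨ n₃ ≤ 1 := by omega
      have b0 : ∀ i : ℕ, blockIndex3 n₁ n₂ i = 0 → i < n₁ := by
        intro i; unfold blockIndex3; split_ifs <;> simp_all
      have b1 : ∀ i : ℕ, blockIndex3 n₁ n₂ i = 1 → n₁ ≤ i ∧ i < n₁ + n₂ := by
        intro i; unfold blockIndex3; split_ifs <;> simp_all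
      have b2 : ∀ i : ℕ, blockIndex3 n₁ n₂ i = 2 → n₁ + n₂ ≤ i := by
        intro i; unfold blockIndex3; split_ifs <;> simp_all
      rcases hn with hn | hn | hn
      · refine ⟨0, fun i j hi hj => Fin.ext ?_⟩
        have := b0 _ hi; have := b0 _ hj; omega
      · refine ⟨1, fun i j hi hj => Fin.ext ?_⟩
        have := b1 _ hi; have := b1 _ hj; omega
      · refine ⟨2, fun i j hi hj => Fin.ext ?_⟩
        have := b2 _ hi; have := b2 _ hj; omega
end

section
/- Let I be a countably infinite index set with partitions I = I₁ ∪ I₂ ∪ I₃ and I = J₁ ∪ J₂ into pairwise disjoint subsets, let H = ℓ²(I, ℂ) with standard orthonormal basis (e_i)_{i∈I}, and for J ⊆ I let H_J denote the closed span of {e_j : j ∈ J}. Let G = U₂(H) be the group of unitary operators u on H such that u − 1 is Hilbert–Schmidt, endowed with the metric d(u, v) = ‖u − v‖₂ given by the Hilbert–Schmidt norm. Let K = {u ∈ G : u(H_{I_k}) ⊆ H_{I_k} for k = 1, 2, 3}, let H' = {u ∈ G : u(H_{J_l}) ⊆ H_{J_l} for l = 1, 2}, and let B = {u ∈ G : σ(u)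 = u}, where σ(u) = J u J for the conjugation J on H defined by J(∑ α_i e_i) = ∑ conj(α_i) e_i. Then the set K B H' = {k b h : k ∈ K, b ∈ B, h ∈ H'} is dense in G if and only if min(|J₁|, |J₂|) ≤ 2 or min(|I₁|, |I₂|, |I₃|) ≤ 1, where |·| denotes cardinality. -/
noncomputable section

/-- The Hilbert space `ℓ²(I, ℂ)`. -/
abbrev L2C (I : Type*) := lp (fun _ : I => ℂ) 2

/-- The standard orthonormal basis vector `e i` of `ℓ²(I, ℂ)`. -/
def stdBasis {I : Type*} [DecidableEq I] (i : I) : L2C I := lp.single 2 i (1 : ℂ)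

/-- The closed span `H_J` of the basis vectors `e j`, `j ∈ J`. -/
def closedBlock {I : Type*} [DecidableEq I] (J : Set I) : Submodule ℂ (L2C I) :=
  (Submodule.span ℂ (stdBasis '' J)).topologicalClosure

/-- A bounded operator on `ℓ²(I, ℂ)` is Hilbert–Schmidt if `∑ᵢ ‖T eᵢ‖² < ∞`. -/
def IsHilbertSchmidtOp {I : Type*} [DecidableEq I] (T : L2C I →L[ℂ] L2C I) : Prop :=
  Summable fun i : I => ‖T (stdBasis i)‖ ^ 2

/-- The Hilbert–Schmidt norm `‖T‖₂ = (∑ᵢ ‖T eᵢ‖²)^{1/2}`. -/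
def hsNorm {I : Type*} [DecidableEq I] (T : L2C I →L[ℂ] L2C I) : ℝ :=
  Real.sqrt (∑' i : I, ‖T (stdBasis i)‖ ^ 2)

/-- Membership in `U₂(H)`: unitary Hilbert–Schmidt perturbations of the identity. -/
def memU2 {I : Type*} [DecidableEq I] (u : L2C I →L[ℂ] L2C I) : Prop :=
  u ∈ unitary (L2C I →L[ℂ] L2C I) ∧ IsHilbertSchmidtOp (u - 1)

namespace KBH
open scoped ComplexConjugate
set_option linter.unusedSectionVars false

set_option linter.unusedSectionVars false

variable {I : Type*} [DecidableEq I]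


theorem ee_apply (i j : I) : (stdBasis i : L2C I) j = if j = i then 1 else 0 := by
  unfold stdBasis
  rw [lp.single_apply]
  by_cases h : j = i
  · subst h; simp
  · simp [h]

theorem inner_ee (i : I) (x : L2C I) : inner ℂ (stdBasis i) x = x i := by
  unfold stdBasis
  rw [lp.inner_single_left]; simp

theorem hasSum_ee (x : L2C I) : HasSum (fun i => x i • (stdBasis i : L2C I)) x := by
  have := lp.hasSum_single (E := fun _ : I => ℂ) (p := 2) (by norm_num) x
  convert this using 2 with i
  unfold stdBasis
  ext j
  simp [lp.single_apply, Pi.single_apply]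

theorem clm_ext {S T : L2C I →L[ℂ] L2C I} (h : ∀ i, S (stdBasis i) = T (stdBasis i)) : S = T := by
  ext1 x
  have h1 := (hasSum_ee x).mapL S
  have h2 := (hasSum_ee x).mapL T
  simp only [map_smul, h] at h1 h2
  exact h1.unique h2

theorem norm_sq_hasSum (x : L2C I) : HasSum (fun i => ‖x i‖ ^ 2) (‖x‖ ^ 2) := by
  have := lp.hasSum_norm (E := fun _ : I => ℂ) (p := 2) (by norm_num) x
  simpa using this

theorem coord_continuous (i : I) : Continuous fun x : L2C I => x i := by
  have : (fun x : L2C I => x i) = fun x => inner ℂ (stdBasis i : L2C I) x := by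
    ext x; rw [inner_ee]
  rw [this]; fun_prop

theorem mem_closedBlock {S : Set I} {x : L2C I} :
    x ∈ closedBlock S ↔ ∀ i, i ∉ S → x i = 0 := by
  constructor
  · intro hx i hi
    have hc : IsClosed {y : L2C I | y i = 0} := isClosed_eq (coord_continuous i) continuous_const
    have hsub : (Submodule.span ℂ (stdBasis '' S) : Set (L2C I)) ⊆ {y : L2C I | y i = 0} := by
      intro y hy
      induction hy using Submodule.span_induction with
      | mem y hy =>
        obtain ⟨j, hj, rfl⟩ := hy
        have : i ≠ j := fun h => hi (h ▸ hj)
        simp [ee_apply, this]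
      | zero => simp
      | add a b _ _ ha hb => 
        simp only [Set.mem_ofPred_eq] at *
        simp [ha, hb]
      | smul c a _ ha => 
        simp only [Set.mem_ofPred_eq] at *
        simp [ha]
    exact closure_minimal hsub hc hx
  · intro h
    refine mem_closure_of_tendsto (hasSum_ee x) (Filter.Eventually.of_forall fun s => ?_)
    refine Submodule.sum_mem _ fun i _ => ?_
    by_cases hi : i ∈ S
    · exact Submodule.smul_mem _ _ (Submodule.subset_span ⟨i, hi, rfl⟩)
    · rw [h i hi]; simp

theorem star_coord (x : L2C I) (i : I) : (star x) i = conj (x i) := rfl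

theorem star_ee (i : I) : star (stdBasis i : L2C I) = stdBasis i := by
  ext j
  rw [star_coord, ee_apply]; split_ifs <;> simp

theorem coord_apply_eq (T : L2C I →L[ℂ] L2C I) (x : L2C I) (i : I) :
    T x i = inner ℂ (stdBasis i) (T x) := (inner_ee _ _).symm

/-- finite matrix operator -/
def emb {n : Type*} [Fintype n] (f : n → I) (M : Matrix n n ℂ) : L2C I →L[ℂ] L2C I :=
  ∑ a, ∑ b, M a b • InnerProductSpace.rankOne ℂ (stdBasis (f a)) (stdBasis (f b))

theorem emb_apply {n : Type*} [Fintype n] (f : n → I) (M : Matrix n n ℂ) (x : L2C I) :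
    emb f M x = ∑ a, (∑ b, M a b * x (f b)) • stdBasis (f a) := by
  simp [emb, Finset.sum_smul, inner_ee, mul_smul]

theorem ee_orth {n : Type*} [DecidableEq n] {f : n → I} (hf : Function.Injective f) (a b : n) :
    (stdBasis (f a) : L2C I) (f b) = if b = a then 1 else 0 := by
  rw [ee_apply]; simp [hf.eq_iff]

variable {n : Type*} [Fintype n] [DecidableEq n] {f : n → I}

theorem emb_coord (hf : Function.Injective f) (M : Matrix n n ℂ) (x : L2C I) (a : n) :
    emb f M x (f a) = ∑ b, M a b * x (f b) := by
  rw [emb_apply, ← inner_ee, inner_sum]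
  simp [inner_smul_right, inner_ee, ee_orth hf]

theorem emb_coord_out (M : Matrix n n ℂ) (x : L2C I) (i : I) (hi : i ∉ Set.range f) :
    emb f M x i = 0 := by
  rw [emb_apply, ← inner_ee, inner_sum]
  refine Finset.sum_eq_zero fun a _ => ?_
  have : i ≠ f a := fun h => hi ⟨a, h.symm⟩
  simp [inner_smul_right, inner_ee, ee_apply, this]

theorem emb_mul (hf : Function.Injective f) (M N : Matrix n n ℂ) :
    emb f M * emb f N = emb f (M * N) := by
  ext x i
  by_cases hi : i ∈ Set.range f
  · obtain ⟨a, rfl⟩ := hi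
    rw [mul_apply_eq_comp, emb_coord hf, emb_coord hf]
    simp_rw [emb_coord hf, Matrix.mul_apply, Finset.sum_mul, Finset.mul_sum]
    rw [Finset.sum_comm]
    simp_rw [mul_assoc]
  · rw [mul_apply_eq_comp, emb_coord_out _ _ _ hi, emb_coord_out _ _ _ hi]

theorem emb_add (M N : Matrix n n ℂ) : emb f (M + N) = emb f M + emb f N := by
  simp [emb, add_smul, Finset.sum_add_distrib]

theorem emb_sub (M N : Matrix n n ℂ) : emb f (M - N) = emb f M - emb f N := by
  simp [emb, sub_smul, Finset.sum_sub_distrib]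

theorem emb_star (M : Matrix n n ℂ) : star (emb f M) = emb f M.conjTranspose := by
  unfold emb
  rw [star_sum]
  simp_rw [star_sum, star_smul, ContinuousLinearMap.star_eq_adjoint,
    InnerProductSpace.adjoint_rankOne]
  rw [Finset.sum_comm]
  rfl

/-- extension by the identity -/
def ext (f : n → I) (M : Matrix n n ℂ) : L2C I →L[ℂ] L2C I := 1 + emb f (M - 1)

theorem ext_mul (hf : Function.Injective f) (M N : Matrix n n ℂ) :
    ext f M * ext f N = ext f (M * N) := by
  unfold ext
  have : M * N - 1 = (M - 1) + (N - 1) + (M - 1) * (N - 1) := by noncomm_ring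
  rw [this, emb_add, emb_add, ← emb_mul hf]
  noncomm_ring

theorem ext_star (M : Matrix n n ℂ) : star (ext f M) = ext f M.conjTranspose := by
  simp [ext, emb_star]

theorem ext_one : ext f (1 : Matrix n n ℂ) = 1 := by
  simp [ext, emb]

theorem ext_coord (hf : Function.Injective f) (M : Matrix n n ℂ) (x : L2C I) (a : n) :
    ext f M x (f a) = ∑ b, M a b * x (f b) := by
  have h1 : ext f M x = x + emb f (M - 1) x := rfl
  rw [h1, lp.coeFn_add, Pi.add_apply, emb_coord hf]
  simp [sub_mul, Finset.sum_sub_distrib, Matrix.one_apply]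

theorem ext_coord_out (M : Matrix n n ℂ) (x : L2C I) (i : I) (hi : i ∉ Set.range f) :
    ext f M x i = x i := by
  have h1 : ext f M x = x + emb f (M - 1) x := rfl
  rw [h1, lp.coeFn_add, Pi.add_apply, emb_coord_out _ _ _ hi, add_zero]

theorem ext_memU2 (hf : Function.Injective f) (M : Matrix n n ℂ)
    (hM : M ∈ Matrix.unitaryGroup n ℂ) : memU2 (ext f M) := by
  refine ⟨?_, ?_⟩
  · rw [Unitary.mem_iff]
    rw [ext_star, ext_mul hf, ext_mul hf]
    have h1 := Matrix.mem_unitaryGroup_iff.1 hM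
    have h2 := Matrix.mem_unitaryGroup_iff'.1 hM
    rw [Matrix.star_eq_conjTranspose] at h1 h2
    rw [h1, h2, ext_one]; simp
  · unfold IsHilbertSchmidtOp
    refine summable_of_hasFiniteSupport ((Set.finite_range f).subset ?_)
    intro i hi
    by_contra h
    apply hi
    have : (ext f M - 1) (stdBasis i) = 0 := by
      simp only [ext, add_sub_cancel_left]
      rw [emb_apply]
      refine Finset.sum_eq_zero fun a _ => ?_
      rw [Finset.sum_eq_zero, zero_smul]
      intro b _
      have : f b ≠ i := fun hb => h ⟨b, hb⟩
      simp [ee_apply, this]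
    simp [this]

theorem memU2_mul {u v : L2C I →L[ℂ] L2C I} (hu : memU2 u) (hv : memU2 v) : memU2 (u * v) := by
  refine ⟨mul_mem hu.1 hv.1, ?_⟩
  have h1 := hu.2
  have h2 := hv.2
  unfold IsHilbertSchmidtOp at *
  have h3 : Summable fun i : I => 2 * (‖u‖ ^ 2 * ‖(v - 1) (stdBasis i)‖ ^ 2) + 2 * ‖(u - 1) (stdBasis i)‖ ^ 2 :=
    ((h2.mul_left _).mul_left _).add (h1.mul_left _)
  refine h3.of_nonneg_of_le (fun i => by positivity) fun i => ?_
  have e : (u * v - 1) (stdBasis i) = u ((v - 1) (stdBasis i)) + (u - 1) (stdBasis i) := by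
    simp
  rw [e]
  have a1 := norm_add_le (u ((v - 1) (stdBasis i))) ((u - 1) (stdBasis i))
  have a2 := u.le_opNorm ((v - 1) (stdBasis i))
  set p := ‖u ((v - 1) (stdBasis i))‖
  set q := ‖(u - 1) (stdBasis i)‖
  set r := ‖u‖ * ‖(v - 1) (stdBasis i)‖
  have hp : 0 ≤ p := norm_nonneg _
  have hq : 0 ≤ q := norm_nonneg _
  have hr : p ^ 2 ≤ r ^ 2 := by gcongr
  have : ‖u ((v - 1) (stdBasis i)) + (u - 1) (stdBasis i)‖ ^ 2 ≤ (p + q) ^ 2 := by gcongr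
  rw [← mul_pow]
  nlinarith [sq_nonneg (p - q)]

end KBH

namespace KBH
open scoped ComplexConjugate
set_option linter.unusedSectionVars false

open Matrix in
/-- phases making a rank one or small Hermitian matrix real -/
theorem exists_phase {p : Type*} [Fintype p] [DecidableEq p] (M : Matrix p p ℂ)
    (hM : M.IsHermitian)
    (h : Fintype.card p ≤ 2 ∨ ∃ g : p → ℂ, ∀ i j, M i j = g i * conj (g j)) :
    ∃ z : p → ℂ, (∀ i, conj (z i) * z i = 1) ∧ ∀ i j, (conj (z i) * M i j * z j).im = 0 := by
  have key : ∀ w : ℂ, ∃ z : ℂ, conj z * z = 1 ∧ (w * z).im = 0 := by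
    intro w
    by_cases hw : w = 0
    · exact ⟨1, by simp, by simp [hw]⟩
    · have hn : (‖w‖ : ℂ) ≠ 0 := by simpa using hw
      refine ⟨conj w / ‖w‖, ?_, ?_⟩
      · have := Complex.mul_conj' w
        simp only [map_div₀, Complex.conj_conj, Complex.conj_ofReal]
        field_simp
        rw [this]
      · rw [← mul_div_assoc, Complex.mul_conj', ← Complex.ofReal_pow, ← Complex.ofReal_div]
        exact Complex.ofReal_im _
  have hdiag : ∀ i, conj (M i i) = M i i := fun i => hM.apply i i
  rcases h with h | ⟨g, hg⟩
  · by_cases hne : Nonempty p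
    · obtain ⟨a⟩ := hne
      choose z hz1 hz2 using fun i => key (M a i)
      refine ⟨fun i => if i = a then 1 else z i, fun i => ?_, fun i j => ?_⟩
      · dsimp only
        split_ifs
        · simp
        · exact hz1 i
      · dsimp only
        have hd : ∀ i, (M i i).im = 0 := fun i => Complex.conj_eq_iff_im.1 (hdiag i)
        by_cases hi : i = a
        · by_cases hj : j = a
          · subst hi; subst hj; simp [hd]
          · subst hi; simp [hj, hz2]
        · by_cases hj : j = a
          · subst hj
            have := hz2 i
            have e : conj (z i) * M i j = conj (M j i * z i) := by
              rw [map_mul, ← hM.apply i j]; simp [mul_comm]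
            simp [hi, ↓reduceIte, e]
            have h3 := congrArg Complex.im e
            simp at h3
            simp [Complex.mul_im] at this
            linarith
          · have : i = j := by
              by_contra hij
              have : ({a, i, j} : Finset p).card = 3 := by
                rw [Finset.card_eq_three]
                exact ⟨a, i, j, fun h => hi h.symm, fun h => hj h.symm, hij, rfl⟩
              have := Finset.card_le_univ ({a, i, j} : Finset p)
              omega
            subst this
            simp only [hi, ↓reduceIte]
            have : conj (z i) * M i i * z i = M i i := by
              linear_combination (M i i) * hz1 i
            rw [this, hd]
    · exact ⟨fun _ => 1, by simp, fun i => (hne ⟨i⟩).elim⟩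
  · choose z hz1 hz2 using fun i => key (conj (g i))
    refine ⟨z, hz1, fun i j => ?_⟩
    rw [hg]
    have e : conj (z i) * (g i * conj (g j)) * z j = conj (conj (g i) * z i) * (conj (g j) * z j) := by
      simp; ring
    rw [e, Complex.mul_im, hz2 j, Complex.conj_im, hz2 i]; simp

open Matrix in
theorem exists_real_conj {p : Type*} [Fintype p] [DecidableEq p] (A B : Matrix p p ℂ)
    (hA : A.IsHermitian) (hB : B.IsHermitian)
    (h : Fintype.card p ≤ 2 ∨ ∃ g : p → ℂ, ∀ i j, A i j = g i * conj (g j)) :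
    ∃ Y ∈ Matrix.unitaryGroup p ℂ, (∀ i j, ((Yᴴ * A * Y) i j).im = 0) ∧
      ∀ i j, ((Yᴴ * B * Y) i j).im = 0 := by
  obtain ⟨V, hV⟩ : ∃ V, V = (hB.eigenvectorUnitary : Matrix p p ℂ) := ⟨_, rfl⟩
  have hVm : V ∈ Matrix.unitaryGroup p ℂ := hV ▸ hB.eigenvectorUnitary.2
  have hVB : Vᴴ * B * V = diagonal (RCLike.ofReal ∘ hB.eigenvalues) := by
    have h1 := hB.conjStarAlgAut_star_eigenvectorUnitary
    rw [Unitary.conjStarAlgAut_apply] at h1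
    simpa [hV, Matrix.star_eq_conjTranspose] using h1
  obtain ⟨z, hz1, hz2⟩ := exists_phase (Vᴴ * A * V) (by
      unfold Matrix.IsHermitian
      simp [Matrix.conjTranspose_mul, hA.eq, Matrix.mul_assoc]) (by
      rcases h with h | ⟨g, hg⟩
      · exact Or.inl h
      · refine Or.inr ⟨Vᴴ *ᵥ g, fun i j => ?_⟩
        have : A = vecMulVec g (star g) := by
          ext i j; simp [hg, vecMulVec_apply]
        rw [this, Matrix.mul_vecMulVec, Matrix.vecMulVec_mul, vecMulVec_apply]
        congr 1
        have : star (Vᴴ *ᵥ g) = star g ᵥ* V := by rw [star_mulVec]; simp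
        rw [← this]; rfl)
  refine ⟨V * diagonal z, ?_, ?_, ?_⟩
  · refine mul_mem hVm ?_
    rw [Matrix.mem_unitaryGroup_iff', Matrix.star_eq_conjTranspose, diagonal_conjTranspose,
      diagonal_mul_diagonal]
    rw [← diagonal_one]
    congr 1; ext i; simpa using hz1 i
  · intro i j
    have e : (V * diagonal z)ᴴ * A * (V * diagonal z) = diagonal (star z) * (Vᴴ * A * V) * diagonal z := by
      rw [conjTranspose_mul, diagonal_conjTranspose]; simp only [Matrix.mul_assoc]
    rw [e, mul_diagonal, diagonal_mul]
    exact hz2 i j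
  · intro i j
    have e : (V * diagonal z)ᴴ * B * (V * diagonal z) = diagonal (star z) * (Vᴴ * B * V) * diagonal z := by
      rw [conjTranspose_mul, diagonal_conjTranspose]; simp only [Matrix.mul_assoc]
    rw [e, hVB, mul_diagonal, diagonal_mul, diagonal_apply]
    by_cases hij : i = j
    · subst hij
      have : conj (z i) * (hB.eigenvalues i : ℂ) * z i = (hB.eigenvalues i : ℂ) := by
        linear_combination (hB.eigenvalues i : ℂ) * hz1 i
      simp only [↓reduceIte, Pi.star_apply, Function.comp]
      exact (congrArg Complex.im this).trans (Complex.ofReal_im _)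
    · simp [hij]

/-- vectors with a real Gram matrix have real coordinates in some orthonormal basis -/
theorem exists_real_basis {E : Type*} [NormedAddCommGroup E] [InnerProductSpace ℂ E]
    [FiniteDimensional ℂ E] {S : Type*} [Fintype S] [DecidableEq S]
    (hS : Module.finrank ℂ E = Fintype.card S)
    {p : Type*} (x : p → E) (hx : ∀ a b, (inner ℂ (x a) (x b)).im = 0) :
    ∃ b : OrthonormalBasis S ℂ E, ∀ s a, (inner ℂ (b s) (x a)).im = 0 := by
  let _ : InnerProductSpace ℝ E := InnerProductSpace.complexToReal
  have : FiniteDimensional ℝ E := FiniteDimensional.complexToReal E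
  let R : Submodule ℝ E := Submodule.span ℝ (Set.range x)
  have hR : ∀ y ∈ R, ∀ w ∈ R, (inner ℂ y w).im = 0 := by
    intro y hy w hw
    induction hy using Submodule.span_induction with
    | zero => simp
    | add a b _ _ ha hb => simp [ha, hb]
    | smul c a _ ha => 
      rw [← Complex.coe_smul, inner_smul_left]; simp [ha]
    | mem y hy =>
      obtain ⟨a, rfl⟩ := hy
      induction hw using Submodule.span_induction with
      | zero => simp
      | add a b _ _ ha hb => simp [ha, hb]
      | smul c a _ ha => 
        rw [← Complex.coe_smul, inner_smul_right]; simp [ha]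
      | mem w hw => obtain ⟨b, rfl⟩ := hw; exact hx a b
  let φ := stdOrthonormalBasis ℝ R
  let v : Fin (Module.finrank ℝ R) → E := fun i => (φ i : E)
  have hv : Orthonormal ℂ v := by
    rw [orthonormal_iff_ite]
    intro i j
    have h1 := orthonormal_iff_ite.1 φ.orthonormal i j
    have h2 : (inner ℂ (v i) (v j)).re = if i = j then 1 else 0 := by
      rw [← h1]; rfl
    have h3 := hR (v i) (φ i).2 (v j) (φ j).2
    apply Complex.ext
    · rw [h2]; split_ifs <;> simp
    · rw [h3]; split_ifs <;> simp
  have hcard : Module.finrank ℝ R ≤ Fintype.card S := by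
    have := hv.linearIndependent.fintype_card_le_finrank
    rw [hS] at this; simpa using this
  obtain ⟨e⟩ : Nonempty (Fin (Module.finrank ℝ R) ↪ S) :=
    Function.Embedding.nonempty_of_card_le (by simpa using hcard)
  let w : S → E := Function.extend e v 0
  have hw : ∀ i, w (e i) = v i := fun i => e.injective.extend_apply _ _ _
  obtain ⟨b, hb⟩ := Orthonormal.exists_orthonormalBasis_extension_of_card_eq hS (v := w)
    (s := Set.range e) (by
      rw [orthonormal_iff_ite]
      rintro ⟨_, i, rfl⟩ ⟨_, j, rfl⟩
      simp only [Set.domRestrict_apply, hw]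
      rw [orthonormal_iff_ite.1 hv i j]
      by_cases hij : i = j
      · subst hij; simp
      · rw [if_neg hij, if_neg]
        intro h
        exact hij (e.injective (congrArg Subtype.val h)))
  refine ⟨b, fun s a => ?_⟩
  have hxa : x a ∈ R := Submodule.subset_span ⟨a, rfl⟩
  have h1 := φ.sum_repr ⟨x a, hxa⟩
  have h2 : ∑ i, (φ.repr ⟨x a, hxa⟩ i : ℂ) • v i = x a := by
    have := congrArg (Subtype.val) h1
    simpa [v] using this
  rw [← h2, inner_sum, Complex.im_sum]
  refine Finset.sum_eq_zero fun i _ => ?_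
  rw [inner_smul_right, ← hw i, ← hb (e i) ⟨i, rfl⟩, orthonormal_iff_ite.1 b.orthonormal]
  split_ifs <;> simp

end KBH

namespace KBH
open scoped ComplexConjugate
set_option linter.unusedSectionVars false

theorem sum_dite_sub {F : Type*} [Fintype F] (P : F → Prop) [DecidablePred P]
    (g : {i // P i} → ℂ) :
    ∑ i, (if h : P i then g ⟨i, h⟩ else 0) = ∑ i : {i // P i}, g i := by
  classical
  have h2 := Finset.sum_subtype (p := P) (F := inferInstance) (Finset.univ.filter P) (by simp)
    (fun i => if h : P i then g ⟨i, h⟩ else 0)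
  rw [Finset.sum_filter] at h2
  calc _ = ∑ a, (if P a then (if h : P a then g ⟨a, h⟩ else 0) else 0) := by
        refine Finset.sum_congr rfl fun i _ => ?_
        by_cases h : P i <;> simp [h]
    _ = _ := by
        rw [h2]
        refine Finset.sum_congr rfl fun i _ => ?_
        rw [dif_pos i.2]

open Matrix in
theorem exists_block {F : Type*} [Fintype F] [DecidableEq F] (c : F → Fin 3)
    {p : Type*} (X : Matrix F p ℂ)
    (hX : ∀ t a b, (∑ i : {i // c i = t}, conj (X i a) * X i b).im = 0) :
    ∃ k ∈ Matrix.unitaryGroup F ℂ, (∀ i j, c i ≠ c j → k i j = 0) ∧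
      ∀ j a, ((kᴴ * X) j a).im = 0 := by
  have h := fun t => exists_real_basis (E := EuclideanSpace ℂ {i // c i = t})
    (S := {i // c i = t}) (by simp) (fun a : p => WithLp.toLp 2 fun i => X i a) (by
      intro a b
      rw [PiLp.inner_apply]
      simpa [mul_comm] using hX t a b)
  choose b hb using h
  let k : Matrix F F ℂ := fun i j => if h : c i = c j then b (c j) ⟨j, rfl⟩ ⟨i, h⟩ else 0
  have hk : ∀ t (i j : F) (hi : c i = t) (hj : c j = t), k i j = b t ⟨j, hj⟩ ⟨i, hi⟩ := by
    rintro t i j hi rfl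
    simp [k, hi]
  have hk0 : ∀ i j, c i ≠ c j → k i j = 0 := fun i j hij => by simp [k, hij]
  have hsum : ∀ j (g : F → ℂ), ∑ i, conj (k i j) * g i =
      ∑ i : {i // c i = c j}, conj (k i j) * g i := by
    intro j g
    rw [← sum_dite_sub (fun i => c i = c j) (fun i => conj (k i j) * g i)]
    refine Finset.sum_congr rfl fun i _ => ?_
    split_ifs with h
    · rfl
    · simp [hk0 i j h]
  refine ⟨k, ?_, hk0, ?_⟩
  · rw [Matrix.mem_unitaryGroup_iff', Matrix.star_eq_conjTranspose]
    ext j j'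
    rw [Matrix.mul_apply]
    simp only [Matrix.conjTranspose_apply, RCLike.star_def]
    rw [hsum]
    by_cases hjj : c j' = c j
    · have h1 := orthonormal_iff_ite.1 (b (c j)).orthonormal ⟨j, rfl⟩ ⟨j', hjj⟩
      rw [PiLp.inner_apply] at h1
      simp only [RCLike.inner_apply, Subtype.mk.injEq] at h1
      rw [Matrix.one_apply, ← h1]
      refine Finset.sum_congr rfl fun i _ => ?_
      rw [hk (c j) i j i.2 rfl, hk (c j) i j' i.2 hjj, mul_comm]
    · rw [Matrix.one_apply_ne (by rintro rfl; exact hjj rfl)]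
      refine Finset.sum_eq_zero fun i _ => ?_
      rw [hk0 i j' (fun h => hjj (by rw [← h]; exact i.2)), mul_zero]
  · intro j a
    rw [Matrix.mul_apply]
    simp only [Matrix.conjTranspose_apply, RCLike.star_def]
    rw [hsum j fun i => X i a]
    have := hb (c j) ⟨j, rfl⟩ a
    rw [PiLp.inner_apply] at this
    simp only [RCLike.inner_apply] at this
    rw [← this]
    congr 1
    refine Finset.sum_congr rfl fun i _ => ?_
    rw [hk (c j) i j i.2 rfl, mul_comm]

open Matrix in
theorem exists_real_ext {F : Type*} [Fintype F] [DecidableEq F] (J : F → Prop)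
    (R : Matrix F {j // J j} ℂ) (hR : ∀ i a, (R i a).im = 0)
    (hRR : Rᴴ * R = 1) :
    ∃ b ∈ Matrix.unitaryGroup F ℂ, (∀ i j, (b i j).im = 0) ∧ ∀ i (a : {j // J j}), b i a = R i a := by
  classical
  let v : F → EuclideanSpace ℝ F := fun j =>
    if h : J j then WithLp.toLp 2 fun i => (R i ⟨j, h⟩).re else 0
  obtain ⟨B, hB⟩ := Orthonormal.exists_orthonormalBasis_extension_of_card_eq (𝕜 := ℝ)
    (E := EuclideanSpace ℝ F) (ι := F) (by simp) (v := v) (s := {j | J j}) (by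
      rw [orthonormal_iff_ite]
      rintro ⟨i, hi⟩ ⟨j, hj⟩
      have hi' : J i := hi
      have hj' : J j := hj
      simp only [Set.domRestrict_apply, v, hi', hj', dif_pos]
      rw [PiLp.inner_apply]
      have h1 := congrFun (congrFun hRR ⟨i, hi⟩) ⟨j, hj⟩
      rw [Matrix.mul_apply] at h1
      have h2 := congrArg Complex.re h1
      simp only [Matrix.conjTranspose_apply, RCLike.star_def, Complex.re_sum, Complex.mul_re,
        Complex.conj_re, Complex.conj_im, hR, mul_zero, sub_zero] at h2
      simp only [RCLike.inner_apply, conj_trivial]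
      rw [Finset.sum_congr rfl fun k _ => mul_comm _ _, h2, Matrix.one_apply]
      by_cases hij : i = j
      · subst hij; simp
      · simp [hij])
  refine ⟨Matrix.of fun i j => (B j i : ℂ), ?_, ?_, ?_⟩
  · rw [Matrix.mem_unitaryGroup_iff', Matrix.star_eq_conjTranspose]
    ext j j'
    rw [Matrix.mul_apply]
    have h1 := orthonormal_iff_ite.1 B.orthonormal j j'
    rw [PiLp.inner_apply] at h1
    simp only [RCLike.inner_apply, conj_trivial] at h1
    simp only [Matrix.of_apply, Matrix.conjTranspose_apply, RCLike.star_def, Complex.conj_ofReal]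
    rw [Matrix.one_apply]
    have h2 := congrArg (fun x : ℝ => (x : ℂ)) h1
    push_cast at h2
    rw [apply_ite (fun x : ℝ => (x : ℂ)), Complex.ofReal_one, Complex.ofReal_zero] at h2
    rw [← h2]
    exact Finset.sum_congr rfl fun k _ => mul_comm _ _
  · intro i j; simp
  · rintro i ⟨j, hj⟩
    have h1 := hB j hj
    simp only [v, hj, dif_pos] at h1
    have : (B j i) = (R i ⟨j, hj⟩).re := by rw [h1]
    apply Complex.ext
    · simp [this]
    · simp [hR]

open Matrix in
theorem block_lower {F : Type*} [Fintype F] [DecidableEq F] (J : F → Prop) [DecidablePred J]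
    (h : Matrix F F ℂ) (hh : h ∈ Matrix.unitaryGroup F ℂ)
    (h0 : ∀ i j, ¬ J i → J j → h i j = 0) (i j : F) (hi : J i) (hj : ¬ J j) : h i j = 0 := by
  have h1 := Matrix.mem_unitaryGroup_iff.1 hh
  have h2 := Matrix.mem_unitaryGroup_iff'.1 hh
  rw [Matrix.star_eq_conjTranspose] at h1 h2
  let A : Matrix {j // J j} {j // J j} ℂ := h.submatrix Subtype.val Subtype.val
  have hA : Aᴴ * A = 1 := by
    ext a b
    have := congrFun (congrFun h2 a) b
    rw [Matrix.mul_apply] at this ⊢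
    rw [Matrix.one_apply] at this ⊢
    simp only [Subtype.ext_iff]
    rw [← this]
    rw [← sum_dite_sub J (fun i => Aᴴ a i * A i b)]
    refine Finset.sum_congr rfl fun i _ => ?_
    split_ifs with hJ
    · rfl
    · simp [h0 i b hJ b.2]
  have hA' : A * Aᴴ = 1 := mul_eq_one_comm.1 hA
  have r1 := congrFun (congrFun hA' ⟨i, hi⟩) ⟨i, hi⟩
  have r2 := congrFun (congrFun h1 i) i
  rw [Matrix.mul_apply, Matrix.one_apply_eq] at r1 r2
  rw [← sum_dite_sub J (fun j => A ⟨i, hi⟩ j * Aᴴ j ⟨i, hi⟩)] at r1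
  have r3 : ∑ j, (if J j then 0 else ‖h i j‖ ^ 2 : ℝ) = 0 := by
    have : ((∑ j, (if J j then 0 else ‖h i j‖ ^ 2 : ℝ) : ℝ) : ℂ) = 0 := by
      have r4 : (1 : ℂ) - 1 = 0 := sub_self _
      nth_rewrite 1 [← r2] at r4
      rw [← r1, ← Finset.sum_sub_distrib] at r4
      rw [← r4, Complex.ofReal_sum]
      refine Finset.sum_congr rfl fun j _ => ?_
      by_cases hJ : J j
      · simp [hJ, A]
      · simp [hJ, Complex.mul_conj']
    exact_mod_cast this
  have r5 := (Finset.sum_eq_zero_iff_of_nonneg (fun j _ => by split_ifs <;> positivity)).1 r3 j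
    (Finset.mem_univ j)
  simpa [hj] using r5

open Matrix in
theorem fd_half {F : Type*} [Fintype F] [DecidableEq F] (c : F → Fin 3) (J : F → Prop)
    [DecidablePred J] (U : Matrix F F ℂ) (hU : U ∈ Matrix.unitaryGroup F ℂ)
    (h : Fintype.card {j // J j} ≤ 2 ∨ ∃ t, ∀ i j, c i = t → c j = t → i = j) :
    ∃ k ∈ Matrix.unitaryGroup F ℂ, ∃ b ∈ Matrix.unitaryGroup F ℂ, ∃ h ∈ Matrix.unitaryGroup F ℂ,
      U = k * b * h ∧ (∀ i j, c i ≠ c j → k i j = 0) ∧ (∀ i j, (b i j).im = 0) ∧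
      (∀ i j, ¬ (J i ↔ J j) → h i j = 0) := by
  have hUU := Matrix.mem_unitaryGroup_iff'.1 hU
  rw [Matrix.star_eq_conjTranspose] at hUU
  let X : Matrix F {j // J j} ℂ := U.submatrix id Subtype.val
  have hXX : Xᴴ * X = 1 := by
    ext a b
    have := congrFun (congrFun hUU a) b
    rw [Matrix.one_apply] at this ⊢
    simp only [Subtype.ext_iff]
    rw [← this]; rfl
  let D : Fin 3 → Matrix F F ℂ := fun t => diagonal fun i => if c i = t then 1 else 0
  let G : Fin 3 → Matrix {j // J j} {j // J j} ℂ := fun t => Xᴴ * D t * X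
  have hGs : ∀ t, G t + G (t + 1) + G (t + 2) = 1 := by
    intro t
    simp only [G]
    rw [← Matrix.add_mul, ← Matrix.add_mul, ← Matrix.mul_add, ← Matrix.mul_add]
    have : D t + D (t + 1) + D (t + 2) = 1 := by
      simp only [D, diagonal_add]
      rw [← diagonal_one]
      congr 1; ext i
      generalize c i = s
      revert s t
      intro s t
      fin_cases s <;> fin_cases t <;> simp
    rw [this, Matrix.mul_one, hXX]
  have hGH : ∀ t, (G t).IsHermitian := by
    intro t
    simp only [G]
    apply Matrix.isHermitian_conjTranspose_mul_mul
    rw [Matrix.isHermitian_diagonal_iff]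
    intro i
    split_ifs <;> simp
  have hGe : ∀ (Z : Matrix F {j // J j} ℂ) t a b, (Zᴴ * D t * Z) a b =
      ∑ i : {i // c i = t}, conj (Z i a) * Z i b := by
    intro Z t a b
    rw [← sum_dite_sub (fun i => c i = t) (fun i => conj (Z i a) * Z i b), Matrix.mul_apply]
    refine Finset.sum_congr rfl fun i _ => ?_
    simp only [D, Matrix.mul_diagonal]
    split_ifs <;> simp
  obtain ⟨t, ht⟩ : ∃ t, Fintype.card {j // J j} ≤ 2 ∨
      ∃ g : {j // J j} → ℂ, ∀ a b, G t a b = g a * conj (g b) := by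
    rcases h with h | ⟨t, ht⟩
    · exact ⟨0, Or.inl h⟩
    · refine ⟨t, Or.inr ?_⟩
      by_cases hne : ∃ i, c i = t
      · obtain ⟨i, hi⟩ := hne
        refine ⟨fun a => conj (X i a), fun a b => ?_⟩
        simp only [G]
        rw [hGe, Fintype.sum_eq_single ⟨i, hi⟩]
        · simp
        · rintro ⟨j, hj⟩ hji
          exact absurd (Subtype.ext (ht j i hj hi)) hji
      · refine ⟨0, fun a b => ?_⟩
        simp only [G]
        rw [hGe]
        have : IsEmpty {i // c i = t} := ⟨fun i => hne ⟨i.1, i.2⟩⟩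
        simp
  obtain ⟨Y, hY, hY0, hY1⟩ := exists_real_conj (G t) (G (t + 1)) (hGH t) (hGH _) ht
  have hYY := Matrix.mem_unitaryGroup_iff'.1 hY
  have hYY' := Matrix.mem_unitaryGroup_iff.1 hY
  rw [Matrix.star_eq_conjTranspose] at hYY hYY'
  have hY2 : ∀ i j, ((Yᴴ * G (t + 2) * Y) i j).im = 0 := by
    have e : Yᴴ * G (t + 2) * Y = 1 - Yᴴ * G t * Y - Yᴴ * G (t + 1) * Y := by
      have := congrArg (fun M => Yᴴ * M * Y) (hGs t)
      simp only [Matrix.mul_add, Matrix.add_mul, Matrix.mul_one, hYY] at this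
      rw [← this]; abel
    intro i j
    rw [e]
    simp only [Matrix.sub_apply, Complex.sub_im, hY0, hY1, Matrix.one_apply]
    split_ifs <;> simp
  have hY3 : ∀ s i j, ((Yᴴ * G s * Y) i j).im = 0 := by
    intro s
    have h3 : ∀ s t : Fin 3, s = t ∨ s = t + 1 ∨ s = t + 2 := by decide
    have := h3 s t
    rcases this with rfl | rfl | rfl
    · exact hY0
    · exact hY1
    · exact hY2
  obtain ⟨k, hk, hk0, hkR⟩ := exists_block c (X * Y) (by
    intro s a b
    rw [← hGe]
    have : (X * Y)ᴴ * D s * (X * Y) = Yᴴ * G s * Y := by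
      simp only [G, conjTranspose_mul, Matrix.mul_assoc]
    rw [this]; exact hY3 s a b)
  have hkk := Matrix.mem_unitaryGroup_iff.1 hk
  rw [Matrix.star_eq_conjTranspose] at hkk
  obtain ⟨b, hb, hb0, hbR⟩ := exists_real_ext J (kᴴ * (X * Y)) hkR (by
    have : (kᴴ * (X * Y))ᴴ * (kᴴ * (X * Y)) = Yᴴ * (Xᴴ * ((k * kᴴ) * X)) * Y := by
      simp only [conjTranspose_mul, conjTranspose_conjTranspose, Matrix.mul_assoc]
    rw [this, hkk, Matrix.one_mul, hXX, Matrix.mul_one, hYY])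
  have hbb := Matrix.mem_unitaryGroup_iff.1 hb
  have hbb' := Matrix.mem_unitaryGroup_iff'.1 hb
  rw [Matrix.star_eq_conjTranspose] at hbb hbb'
  have hhm : bᴴ * kᴴ * U ∈ Matrix.unitaryGroup F ℂ :=
    mul_mem (mul_mem (Unitary.star_mem hb) (Unitary.star_mem hk)) hU
  have hlow : ∀ i j, ¬ J i → J j → (bᴴ * kᴴ * U) i j = 0 := by
    intro i j hi hj
    have e1 : (bᴴ * kᴴ * U) i j = (bᴴ * (kᴴ * (X * Y)) * Yᴴ) i ⟨j, hj⟩ := by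
      have : bᴴ * (kᴴ * (X * Y)) * Yᴴ = bᴴ * kᴴ * X * (Y * Yᴴ) := by
        simp only [Matrix.mul_assoc]
      rw [this, hYY', Matrix.mul_one]; rfl
    rw [e1, Matrix.mul_apply]
    refine Finset.sum_eq_zero fun a _ => ?_
    have e2 : (bᴴ * (kᴴ * (X * Y))) i a = (bᴴ * b) i a := by
      rw [Matrix.mul_apply, Matrix.mul_apply]
      simp only [hbR]
    rw [e2, hbb', Matrix.one_apply_ne (fun h => hi (by rw [h]; exact a.2)), zero_mul]
  refine ⟨k, hk, b, hb, bᴴ * kᴴ * U, hhm, ?_, hk0, hb0, ?_⟩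
  · have : k * b * (bᴴ * kᴴ * U) = k * ((b * bᴴ) * kᴴ) * U := by simp only [Matrix.mul_assoc]
    rw [this, hbb, Matrix.one_mul, hkk, Matrix.one_mul]
  · intro i j hij
    by_cases hi : J i
    · exact block_lower J _ hhm hlow i j hi (fun hj => hij ⟨fun _ => hj, fun _ => hi⟩)
    · by_cases hj : J j
      · exact hlow i j hi hj
      · exact absurd ⟨fun h => absurd h hi, fun h => absurd h hj⟩ hij

end KBH

namespace KBH
open scoped ComplexConjugate
set_option linter.unusedSectionVars false

open Matrix in
theorem fro_trace {n : Type*} [Fintype n] (M : Matrix n n ℂ) :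
    ((∑ i, ∑ j, ‖M i j‖ ^ 2 : ℝ) : ℂ) = (Mᴴ * M).trace := by
  rw [Finset.sum_comm]
  simp only [Matrix.trace, Matrix.diag, Matrix.mul_apply, Matrix.conjTranspose_apply]
  push_cast
  refine Finset.sum_congr rfl fun i _ => Finset.sum_congr rfl fun j _ => ?_
  rw [← Complex.conj_mul']; rfl

open Matrix in
theorem fro_mul {n : Type*} [Fintype n] [DecidableEq n] (M V : Matrix n n ℂ)
    (hV : V * Vᴴ = 1) :
    (∑ i, ∑ j, ‖(M * V) i j‖ ^ 2 : ℝ) = ∑ i, ∑ j, ‖M i j‖ ^ 2 := by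
  have : ((∑ i, ∑ j, ‖(M * V) i j‖ ^ 2 : ℝ) : ℂ) = ((∑ i, ∑ j, ‖M i j‖ ^ 2 : ℝ) : ℂ) := by
    rw [fro_trace, fro_trace, conjTranspose_mul, Matrix.mul_assoc, Matrix.trace_mul_comm,
      ← Matrix.mul_assoc, Matrix.mul_assoc, hV, Matrix.mul_one]
  exact_mod_cast this

open Matrix in
theorem polar_approx {n : Type*} [Fintype n] [DecidableEq n] (A : Matrix n n ℂ)
    (hA : ∀ x : n → ℂ, ∑ i, ‖(A *ᵥ x) i‖ ^ 2 ≤ ∑ i, ‖x i‖ ^ 2) :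
    ∃ U ∈ Matrix.unitaryGroup n ℂ,
      ∑ i, ∑ j, ‖A i j - U i j‖ ^ 2 ≤ (Fintype.card n : ℝ) - ∑ i, ∑ j, ‖A i j‖ ^ 2 := by
  have hH : (Aᴴ * A).IsHermitian := Matrix.isHermitian_conjTranspose_mul_self A
  let V : Matrix n n ℂ := hH.eigenvectorUnitary
  have hVm : V ∈ Matrix.unitaryGroup n ℂ := hH.eigenvectorUnitary.2
  have hV1 := Matrix.mem_unitaryGroup_iff.1 hVm
  have hV2 := Matrix.mem_unitaryGroup_iff'.1 hVm
  rw [Matrix.star_eq_conjTranspose] at hV1 hV2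
  let d := hH.eigenvalues
  let C := A * V
  have hC : Cᴴ * C = diagonal fun j => (d j : ℂ) := by
    have := hH.conjStarAlgAut_star_eigenvectorUnitary
    rw [Unitary.conjStarAlgAut_apply] at this
    have e : Cᴴ * C = Vᴴ * (Aᴴ * A) * V := by simp only [C, conjTranspose_mul, Matrix.mul_assoc]
    rw [e]
    simpa [Matrix.star_eq_conjTranspose, Function.comp_def] using this
  have hCe : ∀ j j', ∑ i, conj (C i j) * C i j' = if j = j' then (d j : ℂ) else 0 := by
    intro j j'
    have := congrFun (congrFun hC j) j'
    rw [Matrix.mul_apply, Matrix.diagonal_apply] at this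
    exact this
  have hCd : ∀ j, ∑ i, ‖C i j‖ ^ 2 = d j := by
    intro j
    have := hCe j j
    simp only [Complex.conj_mul', if_true] at this
    exact_mod_cast this
  have hd0 : ∀ j, 0 ≤ d j := fun j => by rw [← hCd]; positivity
  have hd1 : ∀ j, d j ≤ 1 := by
    intro j
    rw [← hCd]
    refine (hA fun i => V i j).trans (le_of_eq ?_)
    have := congrFun (congrFun hV2 j) j
    rw [Matrix.mul_apply, Matrix.one_apply_eq] at this
    simp only [Matrix.conjTranspose_apply, RCLike.star_def, Complex.conj_mul'] at this
    exact_mod_cast this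
  let v : n → EuclideanSpace ℂ n := fun j => WithLp.toLp 2 fun i => ((√(d j))⁻¹ : ℝ) * C i j
  obtain ⟨B, hB⟩ := Orthonormal.exists_orthonormalBasis_extension_of_card_eq (𝕜 := ℂ)
    (E := EuclideanSpace ℂ n) (ι := n) (by simp) (v := v) (s := {j | d j ≠ 0}) (by
      rw [orthonormal_iff_ite]
      rintro ⟨i, hi⟩ ⟨j, hj⟩
      simp only [Set.domRestrict_apply, v]
      rw [PiLp.inner_apply]
      simp only [RCLike.inner_apply, map_mul, Complex.conj_ofReal]
      have : ∀ x, (((√(d j))⁻¹ : ℝ) : ℂ) * C x j * (((√(d i))⁻¹ : ℝ) * conj (C x i)) =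
        (((√(d j))⁻¹ : ℝ) : ℂ) * (((√(d i))⁻¹ : ℝ)) * (conj (C x i) * C x j) := fun x => by ring
      simp only [this]
      rw [← Finset.mul_sum, hCe]
      by_cases hij : i = j
      · subst hij
        simp only [if_true]
        norm_cast
        rw [← mul_inv, Real.mul_self_sqrt (hd0 i)]
        exact inv_mul_cancel₀ hi
      · simp [hij])
  let W : Matrix n n ℂ := Matrix.of fun i j => B j i
  have hW1 : ∀ j, ∑ i, ‖W i j‖ ^ 2 = 1 := by
    intro j
    have := B.orthonormal.1 j
    rw [EuclideanSpace.norm_eq] at this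
    simpa [W] using this
  have hW : W ∈ Matrix.unitaryGroup n ℂ := by
    rw [Matrix.mem_unitaryGroup_iff', Matrix.star_eq_conjTranspose]
    ext j j'
    rw [Matrix.mul_apply, Matrix.one_apply]
    have h1 := orthonormal_iff_ite.1 B.orthonormal j j'
    rw [PiLp.inner_apply] at h1
    simp only [RCLike.inner_apply] at h1
    rw [← h1]
    exact Finset.sum_congr rfl fun k _ => mul_comm _ _
  have hCW : ∀ i j, C i j = (√(d j) : ℝ) * W i j := by
    intro i j
    by_cases hj : d j = 0
    · have := hCd j
      rw [hj, Finset.sum_eq_zero_iff_of_nonneg (fun _ _ => by positivity)] at this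
      have h2 := this i (Finset.mem_univ i)
      simp only [hj, Real.sqrt_zero]
      simpa using h2
    · have h1 := hB j hj
      have h2 : W i j = ((√(d j))⁻¹ : ℝ) * C i j := by
        simp only [W, Matrix.of_apply, h1, v]
      rw [h2, ← mul_assoc, ← Complex.ofReal_mul, mul_inv_cancel₀, Complex.ofReal_one, one_mul]
      exact fun h => hj ((Real.sqrt_eq_zero (hd0 j)).1 h)
  refine ⟨W * Vᴴ, mul_mem hW (Unitary.star_mem hVm), ?_⟩
  have e1 : ∑ i, ∑ j, ‖A i j - (W * Vᴴ) i j‖ ^ 2 = ∑ i, ∑ j, ‖(C - W) i j‖ ^ 2 := by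
    have : (A - W * Vᴴ) * V = C - W := by
      rw [Matrix.sub_mul, Matrix.mul_assoc, hV2, Matrix.mul_one]
    rw [← this, fro_mul _ _ hV1]
    simp only [Matrix.sub_apply]
  have e2 : ∑ i, ∑ j, ‖A i j‖ ^ 2 = ∑ j, d j := by
    rw [← fro_mul A V hV1, Finset.sum_comm]
    exact Finset.sum_congr rfl fun j _ => hCd j
  rw [e1, e2, Finset.sum_comm]
  have : (Fintype.card n : ℝ) = ∑ j : n, (1 : ℝ) := by simp
  rw [this, ← Finset.sum_sub_distrib]
  refine Finset.sum_le_sum fun j _ => ?_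
  have e3 : ∀ i, ‖(C - W) i j‖ ^ 2 = (√(d j) - 1) ^ 2 * ‖W i j‖ ^ 2 := by
    intro i
    rw [Matrix.sub_apply, hCW]
    have : (√(d j) : ℝ) * W i j - W i j = ((√(d j) - 1 : ℝ) : ℂ) * W i j := by
      push_cast; ring
    rw [this, norm_mul, mul_pow, Complex.norm_real, Real.norm_eq_abs, sq_abs]
  simp only [e3]
  rw [← Finset.mul_sum, hW1, mul_one]
  have s1 := Real.sq_sqrt (hd0 j)
  have s2 : √(d j) ≤ 1 := Real.sqrt_le_one.2 (hd1 j)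
  have s3 := Real.sqrt_nonneg (d j)
  nlinarith

section approx
variable {I : Type*} [DecidableEq I]

theorem norm_sq_agree (F : Finset I) (x y : L2C I) (h : ∀ i, i ∉ F → x i = y i) :
    ‖x‖ ^ 2 - ∑ i ∈ F, ‖x i‖ ^ 2 = ‖y‖ ^ 2 - ∑ i ∈ F, ‖y i‖ ^ 2 := by
  have h1 := (norm_sq_hasSum x).sub (norm_sq_hasSum y)
  have h2 : HasSum (fun i => ‖x i‖ ^ 2 - ‖y i‖ ^ 2) (∑ i ∈ F, (‖x i‖ ^ 2 - ‖y i‖ ^ 2)) := by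
    refine hasSum_sum_of_ne_finset_zero fun i hi => ?_
    rw [h i hi, sub_self]
  have := h1.unique h2
  rw [Finset.sum_sub_distrib] at this
  linarith

theorem sum_le_norm_sq (F : Finset I) (x : L2C I) : ∑ i ∈ F, ‖x i‖ ^ 2 ≤ ‖x‖ ^ 2 :=
  sum_le_hasSum F (fun _ _ => by positivity) (norm_sq_hasSum x)

theorem norm_ee (i : I) : ‖(stdBasis i : L2C I)‖ = 1 := by
  unfold stdBasis
  rw [lp.norm_single (by norm_num)]; simp

theorem unitary_norm {u : L2C I →L[ℂ] L2C I} (hu : u ∈ unitary (L2C I →L[ℂ] L2C I)) (x : L2C I) :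
    ‖u x‖ = ‖x‖ :=
  ContinuousLinearMap.norm_map_of_mem_unitary hu x

theorem exists_big_finset (T : L2C I →L[ℂ] L2C I) (hT : IsHilbertSchmidtOp T) (δ : ℝ) (hδ : 0 < δ) :
    ∃ F : Finset I, (∑' i, ‖T (stdBasis i)‖ ^ 2) - δ <
      ∑ j ∈ F, ∑ i ∈ F, ‖T (stdBasis j) i‖ ^ 2 := by
  have h0 : ∀ j, HasSum (fun i => ‖T (stdBasis j) i‖ ^ 2) (‖T (stdBasis j)‖ ^ 2) :=
    fun j => norm_sq_hasSum _
  have hs : Summable fun p : I × I => ‖T (stdBasis p.1) p.2‖ ^ 2 := by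
    rw [summable_prod_of_nonneg (fun _ => by positivity)]
    refine ⟨fun j => (h0 j).summable, ?_⟩
    simp only [(h0 _).tsum_eq]
    exact hT
  have h1 : HasSum (fun p : I × I => ‖T (stdBasis p.1) p.2‖ ^ 2) (∑' i, ‖T (stdBasis i)‖ ^ 2) := by
    have := hs.hasSum
    have h2 := this.prod_fiberwise h0
    rw [h2.tsum_eq]; exact this
  have h3 := h1.eventually (lt_mem_nhds (sub_lt_self (∑' i, ‖T (stdBasis i)‖ ^ 2) hδ))
  obtain ⟨s, hs'⟩ := Filter.mem_atTop_sets.1 h3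
  refine ⟨s.image Prod.fst ∪ s.image Prod.snd, ?_⟩
  rw [← Finset.sum_product']
  refine hs' _ ?_
  intro p hp
  rw [Finset.mem_product]
  exact ⟨Finset.mem_union_left _ (Finset.mem_image_of_mem _ hp),
    Finset.mem_union_right _ (Finset.mem_image_of_mem _ hp)⟩

theorem approx (u : L2C I →L[ℂ] L2C I) (hu : memU2 u) (ε : ℝ) (hε : 0 < ε) :
    ∃ (F : Finset I) (U : Matrix F F ℂ), U ∈ Matrix.unitaryGroup F ℂ ∧
      hsNorm (u - ext (Subtype.val : F → I) U) < ε := by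
  obtain ⟨F, hF⟩ := exists_big_finset (u - 1) hu.2 (ε ^ 2 / 2) (by positivity)
  have hf : Function.Injective (Subtype.val : F → I) := Subtype.val_injective
  have hT : ∀ i j, (u - 1) (stdBasis j) i = u (stdBasis j) i - (stdBasis j : L2C I) i :=
    fun i j => rfl
  obtain ⟨U, hU, hUA⟩ := polar_approx (Matrix.of fun i j : F => u (stdBasis j.1) i.1) (by
    intro x
    let y : L2C I := ∑ j : F, x j • stdBasis j.1
    have hy : ‖y‖ ^ 2 = ∑ j, ‖x j‖ ^ 2 := by
      have hyc : ∀ i : F, y i.1 = x i := by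
        intro i
        rw [← inner_ee, inner_sum]
        simp [inner_smul_right, inner_ee, ee_orth hf]
      have hyo : ∀ i, i ∉ F → y i = 0 := by
        intro i hi
        rw [← inner_ee, inner_sum]
        refine Finset.sum_eq_zero fun j _ => ?_
        have : i ≠ j.1 := by rintro rfl; exact hi j.2
        simp [inner_smul_right, inner_ee, ee_apply, this]
      have := norm_sq_agree F y 0 (fun i hi => by rw [hyo i hi]; rfl)
      have h0 : ∑ i ∈ F, ‖(0 : L2C I) i‖ ^ 2 = 0 := by simp
      rw [h0] at this
      simp only [norm_zero] at this
      have h2 : ∑ i ∈ F, ‖y i‖ ^ 2 = ∑ j, ‖x j‖ ^ 2 := by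
        rw [← Finset.sum_coe_sort F]
        exact Finset.sum_congr rfl fun i _ => by rw [hyc]
      linarith
    rw [← hy, ← unitary_norm hu.1]
    refine le_trans (le_of_eq ?_) (sum_le_norm_sq F (u y))
    rw [← Finset.sum_coe_sort F]
    refine Finset.sum_congr rfl fun i _ => ?_
    rw [← inner_ee, map_sum, inner_sum]
    simp [Matrix.mulVec, dotProduct, inner_smul_right, inner_ee, mul_comm])
  refine ⟨F, U, hU, ?_⟩
  set E := ext (Subtype.val : F → I) U with hE
  set t : I → ℝ := fun j => ‖(u - 1) (stdBasis j)‖ ^ 2 with ht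
  have hEo : ∀ j, j ∉ F → (u - E) (stdBasis j) = (u - 1) (stdBasis j) := by
    intro j hj
    have : E (stdBasis j) = stdBasis j := by
      ext i
      by_cases hi : i ∈ F
      · have h1 := ext_coord hf U (stdBasis j) ⟨i, hi⟩
        rw [← hE] at h1
        refine h1.trans ?_
        rw [ee_apply, if_neg (by rintro rfl; exact hj hi)]
        refine Finset.sum_eq_zero fun b _ => ?_
        rw [ee_apply, if_neg (by rintro h; rw [← h] at hj; exact hj b.2), mul_zero]
      · exact ext_coord_out U _ i (by simpa using hi)
    show u _ - E _ = u _ - _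
    rw [this]; rfl
  have hEi : ∀ i j : F, (u - E) (stdBasis j.1) i.1 = u (stdBasis j.1) i.1 - U i j := by
    intro i j
    show u (stdBasis j.1) i.1 - E (stdBasis j.1) i.1 = _
    rw [hE, ext_coord hf U (stdBasis j.1) i]
    simp [ee_orth hf]
  have hEio : ∀ j, ∀ i, i ∉ F → (u - E) (stdBasis j) i = (u - 1) (stdBasis j) i := by
    intro j i hi
    show u (stdBasis j) i - E (stdBasis j) i = _
    rw [hE, ext_coord_out U _ i (by simpa using hi)]; rfl
  have k1 : ∀ j ∈ F, ‖(u - E) (stdBasis j)‖ ^ 2 - ∑ i ∈ F, ‖(u - E) (stdBasis j) i‖ ^ 2 =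
      t j - ∑ i ∈ F, ‖(u - 1) (stdBasis j) i‖ ^ 2 :=
    fun j _ => norm_sq_agree F _ _ (hEio j)
  have k2 : ∀ j ∈ F, 1 - ∑ i ∈ F, ‖u (stdBasis j) i‖ ^ 2 =
      t j - ∑ i ∈ F, ‖(u - 1) (stdBasis j) i‖ ^ 2 := by
    intro j hj
    have := norm_sq_agree F (u (stdBasis j)) ((u - 1) (stdBasis j)) (by
      intro i hi
      rw [hT, ee_apply, if_neg (by rintro rfl; exact hi hj), sub_zero])
    rw [unitary_norm hu.1, norm_ee, one_pow] at this
    exact this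
  have k3 : ∑ j ∈ F, ∑ i ∈ F, ‖(u - E) (stdBasis j) i‖ ^ 2 ≤
      ∑ j ∈ F, (1 - ∑ i ∈ F, ‖u (stdBasis j) i‖ ^ 2) := by
    rw [Finset.sum_sub_distrib]
    rw [Finset.sum_comm] at hUA
    rw [Finset.sum_comm (f := fun i j : F => ‖Matrix.of (fun i j : F => u (stdBasis j.1) i.1) i j‖ ^ 2)] at hUA
    have c1 : ∑ j ∈ F, ∑ i ∈ F, ‖(u - E) (stdBasis j) i‖ ^ 2 =
        ∑ j : F, ∑ i : F, ‖u (stdBasis j.1) i.1 - U i j‖ ^ 2 := by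
      rw [← Finset.sum_coe_sort F]
      refine Finset.sum_congr rfl fun j _ => ?_
      rw [← Finset.sum_coe_sort F]
      refine Finset.sum_congr rfl fun i _ => ?_
      rw [hEi]
    have c2 : ∑ j ∈ F, ∑ i ∈ F, ‖u (stdBasis j) i‖ ^ 2 =
        ∑ j : F, ∑ i : F, ‖u (stdBasis j.1) i.1‖ ^ 2 := by
      rw [← Finset.sum_coe_sort F]
      refine Finset.sum_congr rfl fun j _ => ?_
      rw [← Finset.sum_coe_sort F]
    rw [c1, c2]
    simpa using hUA
  have hsum : HasSum (fun j => ‖(u - E) (stdBasis j)‖ ^ 2)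
      ((∑' j, t j) + ∑ j ∈ F, (‖(u - E) (stdBasis j)‖ ^ 2 - t j)) := by
    have a1 : HasSum t (∑' j, t j) := Summable.hasSum hu.2
    have a2 : HasSum (fun j => ‖(u - E) (stdBasis j)‖ ^ 2 - t j)
        (∑ j ∈ F, (‖(u - E) (stdBasis j)‖ ^ 2 - t j)) :=
      hasSum_sum_of_ne_finset_zero fun j hj => by rw [hEo j hj, ht]; simp
    have := a1.add a2
    simpa using this
  have htF : ∑ j ∈ F, t j ≤ ∑' j, t j := Summable.sum_le_tsum F (fun _ _ => by positivity) hu.2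
  have k4 : ∑ j ∈ F, (‖(u - E) (stdBasis j)‖ ^ 2 - t j) =
      ∑ j ∈ F, ∑ i ∈ F, ‖(u - E) (stdBasis j) i‖ ^ 2 -
        ∑ j ∈ F, ∑ i ∈ F, ‖(u - 1) (stdBasis j) i‖ ^ 2 := by
    rw [← Finset.sum_sub_distrib]
    exact Finset.sum_congr rfl fun j hj => by have := k1 j hj; linarith
  have k5 : ∑ j ∈ F, (1 - ∑ i ∈ F, ‖u (stdBasis j) i‖ ^ 2) =
      ∑ j ∈ F, t j - ∑ j ∈ F, ∑ i ∈ F, ‖(u - 1) (stdBasis j) i‖ ^ 2 := by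
    rw [← Finset.sum_sub_distrib]
    exact Finset.sum_congr rfl k2
  unfold hsNorm
  rw [Real.sqrt_lt' hε, hsum.tsum_eq]
  have hF' : (∑' j, t j) - ε ^ 2 / 2 < ∑ j ∈ F, ∑ i ∈ F, ‖(u - 1) (stdBasis j) i‖ ^ 2 := hF
  linarith

end approx

end KBH

namespace KBH
open scoped ComplexConjugate
set_option linter.unusedSectionVars false

section easy
variable {I : Type*} [DecidableEq I]

theorem ext_block {n : Type*} [Fintype n] [DecidableEq n] {f : n → I} (hf : Function.Injective f)
    (M : Matrix n n ℂ) (S : Set I)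
    (hM : ∀ a b, f a ∉ S → f b ∈ S → M a b = 0) (x : L2C I) (hx : x ∈ closedBlock S) :
    ext f M x ∈ closedBlock S := by
  rw [mem_closedBlock] at hx ⊢
  intro i hi
  by_cases h : i ∈ Set.range f
  · obtain ⟨a, rfl⟩ := h
    rw [ext_coord hf]
    refine Finset.sum_eq_zero fun b _ => ?_
    by_cases hb : f b ∈ S
    · rw [hM a b hi hb, zero_mul]
    · rw [hx _ hb, mul_zero]
  · rw [ext_coord_out _ _ _ h, hx i hi]

theorem ext_real {n : Type*} [Fintype n] [DecidableEq n] {f : n → I} (hf : Function.Injective f)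
    (M : Matrix n n ℂ) (hM : ∀ a b, (M a b).im = 0) (x : L2C I) :
    star (ext f M (star x)) = ext f M x := by
  ext i
  rw [star_coord]
  by_cases h : i ∈ Set.range f
  · obtain ⟨a, rfl⟩ := h
    rw [ext_coord hf, ext_coord hf, map_sum]
    refine Finset.sum_congr rfl fun b _ => ?_
    rw [map_mul, star_coord, Complex.conj_conj, Complex.conj_eq_iff_im.2 (hM a b)]
  · rw [ext_coord_out _ _ _ h, ext_coord_out _ _ _ h, star_coord, Complex.conj_conj]

theorem card_sub_le {F : Finset I} (S : Set I) [DecidablePred (· ∈ S)] (h : Cardinal.mk S ≤ 2) :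
    Fintype.card {j : F // j.1 ∈ S} ≤ 2 := by
  have h1 : Cardinal.mk {j : F // j.1 ∈ S} ≤ Cardinal.mk S :=
    Cardinal.mk_le_of_injective (f := fun j => (⟨j.1.1, j.2⟩ : S)) (by
      intro a b hab
      have h3 : a.1.1 = b.1.1 := congrArg (fun z : S => z.1) hab
      exact Subtype.ext (Subtype.ext h3))
  have h2 := h1.trans h
  rw [Cardinal.mk_fintype] at h2
  exact_mod_cast h2

theorem mk_le_one {S : Set I} (h : Cardinal.mk S ≤ 1) (i j : I) (hi : i ∈ S) (hj : j ∈ S) :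
    i = j := by
  have := Cardinal.le_one_iff_subsingleton.1 h
  exact congrArg Subtype.val (Subsingleton.elim (⟨i, hi⟩ : S) ⟨j, hj⟩)

theorem easy (I1 I2 I3 J1 J2 : Set I)
    (hIcover : I1 ∪ I2 ∪ I3 = Set.univ)
    (hI12 : Disjoint I1 I2) (hI13 : Disjoint I1 I3) (hI23 : Disjoint I2 I3)
    (hJcover : J1 ∪ J2 = Set.univ) (hJ12 : Disjoint J1 J2)
    (hc : min (Cardinal.mk J1) (Cardinal.mk J2) ≤ 2 ∨
      min (Cardinal.mk I1) (min (Cardinal.mk I2) (Cardinal.mk I3)) ≤ 1)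
    (u : L2C I →L[ℂ] L2C I) (hu : memU2 u) (ε : ℝ) (hε : ε > 0) :
      ∃ k b h : L2C I →L[ℂ] L2C I,
        memU2 k ∧ memU2 b ∧ memU2 h ∧
        (∀ x ∈ closedBlock I1, k x ∈ closedBlock I1) ∧
        (∀ x ∈ closedBlock I2, k x ∈ closedBlock I2) ∧
        (∀ x ∈ closedBlock I3, k x ∈ closedBlock I3) ∧
        (∀ x : L2C I, star (b (star x)) = b x) ∧
        (∀ x ∈ closedBlock J1, h x ∈ closedBlock J1) ∧
        (∀ x ∈ closedBlock J2, h x ∈ closedBlock J2) ∧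
        hsNorm (u - k * b * h) < ε := by
  classical
  have hJ : ∀ i, i ∈ J2 ↔ i ∉ J1 := by
    intro i
    have h1 : i ∈ J1 ∪ J2 := by rw [hJcover]; trivial
    exact ⟨fun h h' => Set.disjoint_left.1 hJ12 h' h, fun h => h1.resolve_left h⟩
  have hI : ∀ i, i ∈ I3 ↔ i ∉ I1 ∧ i ∉ I2 := by
    intro i
    have h1 : i ∈ I1 ∪ I2 ∪ I3 := by rw [hIcover]; trivial
    refine ⟨fun h => ⟨fun h' => Set.disjoint_left.1 hI13 h' h,
      fun h' => Set.disjoint_left.1 hI23 h' h⟩, fun h => ?_⟩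
    rcases h1 with (h1 | h1) | h1
    · exact absurd h1 h.1
    · exact absurd h1 h.2
    · exact h1
  have hI2 : ∀ i, i ∈ I2 → i ∉ I1 := fun i h h' => Set.disjoint_left.1 hI12 h' h
  obtain ⟨F, U, hU, hUε⟩ := approx u hu ε hε
  have hf : Function.Injective (Subtype.val : F → I) := Subtype.val_injective
  let c : F → Fin 3 := fun i => if i.1 ∈ I1 then 0 else if i.1 ∈ I2 then 1 else 2
  have c0 : ∀ i, c i = 0 ↔ i.1 ∈ I1 := by
    intro i; simp only [c]; split_ifs <;> simp_all
  have c1 : ∀ i, c i = 1 ↔ i.1 ∈ I2 := by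
    intro i; simp only [c]; split_ifs with h1 h2
    · simp; exact fun h => hI2 _ h h1
    · simp [h2]
    · simp [h2]
  have c2 : ∀ i, c i = 2 ↔ i.1 ∈ I3 := by
    intro i; rw [hI]; simp only [c]; split_ifs <;> simp_all
  have key : ∃ k ∈ Matrix.unitaryGroup F ℂ, ∃ b ∈ Matrix.unitaryGroup F ℂ,
      ∃ h ∈ Matrix.unitaryGroup F ℂ,
      U = k * b * h ∧ (∀ i j, c i ≠ c j → k i j = 0) ∧ (∀ i j, (b i j).im = 0) ∧
      (∀ i j : F, ¬ (i.1 ∈ J1 ↔ j.1 ∈ J1) → h i j = 0) := by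
    rcases hc with hc | hc
    · rcases min_le_iff.1 hc with hc | hc
      · exact fd_half c (fun i => i.1 ∈ J1) U hU (Or.inl (card_sub_le J1 hc))
      · obtain ⟨k, hk, b, hb, h, hh, h1, h2, h3, h4⟩ :=
          fd_half c (fun i => i.1 ∈ J2) U hU (Or.inl (card_sub_le J2 hc))
        refine ⟨k, hk, b, hb, h, hh, h1, h2, h3, fun i j hij => h4 i j ?_⟩
        rw [hJ, hJ, not_iff_not]; exact hij
    · refine fd_half c (fun i => i.1 ∈ J1) U hU (Or.inr ?_)
      rcases min_le_iff.1 hc with hc | hc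
      · exact ⟨0, fun i j hi hj => Subtype.ext (mk_le_one hc _ _ ((c0 i).1 hi) ((c0 j).1 hj))⟩
      · rcases min_le_iff.1 hc with hc | hc
        · exact ⟨1, fun i j hi hj => Subtype.ext (mk_le_one hc _ _ ((c1 i).1 hi) ((c1 j).1 hj))⟩
        · exact ⟨2, fun i j hi hj => Subtype.ext (mk_le_one hc _ _ ((c2 i).1 hi) ((c2 j).1 hj))⟩
  obtain ⟨k, hk, b, hb, h, hh, hUe, hk0, hb0, hh0⟩ := key
  refine ⟨ext Subtype.val k, ext Subtype.val b, ext Subtype.val h, ext_memU2 hf k hk,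
    ext_memU2 hf b hb, ext_memU2 hf h hh, ?_, ?_, ?_, ext_real hf b hb0, ?_, ?_, ?_⟩
  · refine ext_block hf k I1 fun i j hi hj => hk0 i j fun hij => ?_
    exact hi ((c0 i).1 (hij.trans ((c0 j).2 hj)))
  · refine ext_block hf k I2 fun i j hi hj => hk0 i j fun hij => ?_
    exact hi ((c1 i).1 (hij.trans ((c1 j).2 hj)))
  · refine ext_block hf k I3 fun i j hi hj => hk0 i j fun hij => ?_
    exact hi ((c2 i).1 (hij.trans ((c2 j).2 hj)))
  · exact ext_block hf h J1 fun i j hi hj => hh0 i j fun hij => hi (hij.2 hj)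
  · refine ext_block hf h J2 fun i j hi hj => hh0 i j fun hij => ?_
    rw [hJ] at hi hj
    exact hi fun hi' => hj (hij.1 hi')
  · rw [ext_mul hf, ext_mul hf, ← hUe]
    exact hUε

end easy

end KBH

namespace KBH
open scoped ComplexConjugate
set_option linter.unusedSectionVars false

noncomputable section hard
variable {I : Type*} [DecidableEq I]

instance closedBlock_complete (S : Set I) : CompleteSpace (closedBlock S) :=
  (Submodule.isClosed_topologicalClosure _).completeSpace_coe

/-- coordinate projection onto `S` -/
def Pr (S : Set I) : L2C I →L[ℂ] L2C I := (closedBlock S).starProjection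

open Classical in
theorem Pr_ee (S : Set I) (j : I) : Pr S (stdBasis j) = if j ∈ S then stdBasis j else 0 := by
  unfold Pr
  split_ifs with h
  · rw [Submodule.starProjection_eq_self_iff, mem_closedBlock]
    intro i hi
    rw [ee_apply, if_neg (by rintro rfl; exact hi h)]
  · rw [Submodule.starProjection_apply_eq_zero_iff, Submodule.mem_orthogonal']
    intro x hx
    rw [inner_ee]
    exact mem_closedBlock.1 hx j h

theorem Pr_star (S : Set I) : star (Pr S) = Pr S :=
  (isSelfAdjoint_starProjection (closedBlock S)).star_eq

open Classical in
theorem Pr_coord (S : Set I) (x : L2C I) (i : I) : Pr S x i = if i ∈ S then x i else 0 := by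
  have h : inner ℂ (stdBasis i) (Pr S x) = inner ℂ (Pr S (stdBasis i)) x := by
    rw [← ContinuousLinearMap.adjoint_inner_left, ← ContinuousLinearMap.star_eq_adjoint, Pr_star]
  rw [← inner_ee, h, Pr_ee]
  split_ifs
  · rw [inner_ee]
  · simp

theorem Pr_real (S : Set I) (x : L2C I) : star (Pr S x) = Pr S (star x) := by
  classical
  ext i
  rw [star_coord, Pr_coord, Pr_coord, star_coord]
  split_ifs <;> simp

theorem Pr_comm (S : Set I) (T : L2C I →L[ℂ] L2C I)
    (h1 : ∀ j ∈ S, T (stdBasis j) ∈ closedBlock S)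
    (h2 : ∀ j ∉ S, ∀ i ∈ S, T (stdBasis j) i = 0) : Pr S * T = T * Pr S := by
  classical
  apply clm_ext
  intro j
  show Pr S (T (stdBasis j)) = T (Pr S (stdBasis j))
  ext i
  rw [Pr_coord, Pr_ee]
  by_cases hj : j ∈ S
  · rw [if_pos hj]
    split_ifs with hi
    · rfl
    · exact (mem_closedBlock.1 (h1 j hj) i hi).symm
  · rw [if_neg hj, map_zero]
    split_ifs with hi
    · rw [h2 j hj i hi]; rfl
    · rfl

theorem ee_mem {S : Set I} {j : I} (hj : j ∈ S) : (stdBasis j : L2C I) ∈ closedBlock S := by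
  rw [mem_closedBlock]
  intro i hi
  rw [ee_apply, if_neg (by rintro rfl; exact hi hj)]

theorem opNorm_le_hs (T : L2C I →L[ℂ] L2C I) (hT : IsHilbertSchmidtOp T) : ‖T‖ ≤ hsNorm T := by
  refine T.opNorm_le_bound (Real.sqrt_nonneg _) fun x => ?_
  have h1 := (hasSum_ee x).mapL T
  refine le_of_tendsto h1.norm (Filter.Eventually.of_forall fun F => ?_)
  calc ‖∑ i ∈ F, T (x i • stdBasis i)‖ ≤ ∑ i ∈ F, ‖x i‖ * ‖T (stdBasis i)‖ := by
        refine (norm_sum_le _ _).trans (le_of_eq ?_)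
        refine Finset.sum_congr rfl fun i _ => ?_
        rw [map_smul, norm_smul]
    _ ≤ √(∑ i ∈ F, ‖x i‖ ^ 2) * √(∑ i ∈ F, ‖T (stdBasis i)‖ ^ 2) :=
        Real.sum_mul_le_sqrt_mul_sqrt _ _ _
    _ ≤ ‖x‖ * hsNorm T := by
        refine mul_le_mul ?_ ?_ (Real.sqrt_nonneg _) (norm_nonneg _)
        · rw [Real.sqrt_le_left (norm_nonneg _)]
          exact sum_le_norm_sq F x
        · exact Real.sqrt_le_sqrt (Summable.sum_le_tsum F (fun _ _ => by positivity) hT)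
    _ = hsNorm T * ‖x‖ := mul_comm _ _

theorem hs_sub {S T : L2C I →L[ℂ] L2C I} (hS : IsHilbertSchmidtOp S) (hT : IsHilbertSchmidtOp T) :
    IsHilbertSchmidtOp (S - T) := by
  unfold IsHilbertSchmidtOp at *
  refine Summable.of_nonneg_of_le (fun _ => by positivity) (fun i => ?_)
    ((hS.mul_left 2).add (hT.mul_left 2))
  have h1 : ‖(S - T) (stdBasis i)‖ ≤ ‖S (stdBasis i)‖ + ‖T (stdBasis i)‖ := norm_sub_le _ _
  have h2 := norm_nonneg ((S - T) (stdBasis i))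
  nlinarith [sq_nonneg (‖S (stdBasis i)‖ - ‖T (stdBasis i)‖)]

/-- noncommutative polynomial used for the obstruction -/
def Dop (P1 Q : L2C I →L[ℂ] L2C I) : L2C I →L[ℂ] L2C I := P1 * Q * P1
/-- second block polynomial -/
def Hop (P1 P2 Q : L2C I →L[ℂ] L2C I) : L2C I →L[ℂ] L2C I := P1 * Q * P2 * Q * P1
/-- third block polynomial -/
def Eop (P1 P2 Q : L2C I →L[ℂ] L2C I) : L2C I →L[ℂ] L2C I := P1 * Q * P2 * Q * P2 * Q * P1

/-- commutator of the first two -/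
def Cop (P1 P2 Q : L2C I →L[ℂ] L2C I) : L2C I →L[ℂ] L2C I :=
  Dop P1 Q * Hop P1 P2 Q - Hop P1 P2 Q * Dop P1 Q

/-- the whole obstruction polynomial -/
def Phi (P1 P2 : L2C I →L[ℂ] L2C I) (s : ℂ) (Q : L2C I →L[ℂ] L2C I) : L2C I →L[ℂ] L2C I :=
  (Cop P1 P2 Q * (Eop P1 P2 Q - (68 : ℂ) • 1) + (Eop P1 P2 Q - (68 : ℂ) • 1) * Cop P1 P2 Q)
    * Hop P1 P2 Q + s • Hop P1 P2 Q

/-- intertwining relation by an antilinear map -/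
def Rel (θ : L2C I → L2C I) (T T' : L2C I →L[ℂ] L2C I) : Prop := ∀ x, θ (T x) = T' (θ x)

theorem Rel.mul {θ : L2C I → L2C I} {S S' T T' : L2C I →L[ℂ] L2C I} (h1 : Rel θ S S')
    (h2 : Rel θ T T') : Rel θ (S * T) (S' * T') := fun x => by
  show θ (S (T x)) = S' (T' (θ x))
  rw [h1, h2]

theorem Rel.add {θ : L2C I → L2C I} (hθ : ∀ x y, θ (x + y) = θ x + θ y)
    {S S' T T' : L2C I →L[ℂ] L2C I} (h1 : Rel θ S S')
    (h2 : Rel θ T T') : Rel θ (S + T) (S' + T') := fun x => by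
  show θ (S x + T x) = S' (θ x) + T' (θ x)
  rw [hθ, h1, h2]

theorem Rel.smul {θ : L2C I → L2C I} (hθ : ∀ (c : ℂ) x, θ (c • x) = conj c • θ x)
    {S S' : L2C I →L[ℂ] L2C I} (h1 : Rel θ S S') (c : ℂ) : Rel θ (c • S) (conj c • S') := fun x => by
  show θ (c • S x) = conj c • S' (θ x)
  rw [hθ, h1]

theorem Rel.sub {θ : L2C I → L2C I} (hθ : ∀ x y, θ (x + y) = θ x + θ y)
    (hθ' : ∀ (c : ℂ) x, θ (c • x) = conj c • θ x)
    {S S' T T' : L2C I →L[ℂ] L2C I} (h1 : Rel θ S S')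
    (h2 : Rel θ T T') : Rel θ (S - T) (S' - T') := by
  have := Rel.add hθ h1 (Rel.smul hθ' h2 (-1))
  simpa [sub_eq_add_neg] using this

theorem Rel.one {θ : L2C I → L2C I} : Rel θ (1 : L2C I →L[ℂ] L2C I) 1 := fun _ => rfl

theorem Phi_rel {θ : L2C I → L2C I} (hθ : ∀ x y, θ (x + y) = θ x + θ y)
    (hθ' : ∀ (c : ℂ) x, θ (c • x) = conj c • θ x) {P1 P2 Q : L2C I →L[ℂ] L2C I}
    (h1 : Rel θ P1 P1) (h2 : Rel θ P2 P2) (h : Rel θ Q Q) (s : ℂ) :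
    Rel θ (Phi P1 P2 s Q) (Phi P1 P2 (conj s) Q) := by
  have hD : Rel θ (Dop P1 Q) (Dop P1 Q) := (h1.mul h).mul h1
  have hH : Rel θ (Hop P1 P2 Q) (Hop P1 P2 Q) := (((h1.mul h).mul h2).mul h).mul h1
  have hE : Rel θ (Eop P1 P2 Q) (Eop P1 P2 Q) :=
    (((((h1.mul h).mul h2).mul h).mul h2).mul h).mul h1
  have hC : Rel θ (Cop P1 P2 Q) (Cop P1 P2 Q) := Rel.sub hθ hθ' (hD.mul hH) (hH.mul hD)
  have hE' : Rel θ (Eop P1 P2 Q - (68 : ℂ) • 1) (Eop P1 P2 Q - (68 : ℂ) • 1) := by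
    have h68 := Rel.smul hθ' (Rel.one (θ := θ)) 68
    have : conj (68 : ℂ) = 68 := Complex.conj_ofNat 68
    rw [this] at h68
    exact Rel.sub hθ hθ' hE h68
  exact Rel.add hθ ((Rel.add hθ (hC.mul hE') (hE'.mul hC)).mul hH) (Rel.smul hθ' hH s)

theorem norm_le_of_rel {θ : L2C I → L2C I} (hθ : ∀ x, ‖θ x‖ = ‖x‖) {S T : L2C I →L[ℂ] L2C I}
    (h : Rel θ S T) : ‖S‖ ≤ ‖T‖ := by
  refine S.opNorm_le_bound (norm_nonneg _) fun x => ?_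
  rw [← hθ (S x), h x, ← hθ x]
  exact T.le_opNorm _

theorem norm_star_l2 (x : L2C I) : ‖star x‖ = ‖x‖ := by
  have h1 := norm_sq_hasSum (star x)
  have h2 := norm_sq_hasSum x
  have : (fun i => ‖(star x) i‖ ^ 2) = fun i => ‖x i‖ ^ 2 := by
    ext i; rw [star_coord, Complex.norm_conj]
  rw [this] at h1
  have h3 := h1.unique h2
  exact (sq_eq_sq₀ (norm_nonneg _) (norm_nonneg _)).1 h3

theorem star_smul_l2 (c : ℂ) (x : L2C I) : star (c • x) = conj c • star x := by
  ext i
  rw [star_coord]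
  simp [star_coord]

theorem comm_star {u P : L2C I →L[ℂ] L2C I} (hP : star P = P) (h : P * u = u * P) :
    P * star u = star u * P := by
  have := congrArg star h
  rw [star_mul, star_mul, hP] at this
  exact this.symm

theorem kbh_norm (I1 I2 I3 J1 J2 : Set I)
    (hIcover : I1 ∪ I2 ∪ I3 = Set.univ)
    (hI12 : Disjoint I1 I2) (hI13 : Disjoint I1 I3) (hI23 : Disjoint I2 I3)
    (hJcover : J1 ∪ J2 = Set.univ) (hJ12 : Disjoint J1 J2)
    (k b h : L2C I →L[ℂ] L2C I) (hk : memU2 k) (hb : memU2 b) (hh : memU2 h)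
    (k1 : ∀ x ∈ closedBlock I1, k x ∈ closedBlock I1)
    (k2 : ∀ x ∈ closedBlock I2, k x ∈ closedBlock I2)
    (k3 : ∀ x ∈ closedBlock I3, k x ∈ closedBlock I3)
    (hbr : ∀ x : L2C I, star (b (star x)) = b x)
    (h1 : ∀ x ∈ closedBlock J1, h x ∈ closedBlock J1)
    (h2 : ∀ x ∈ closedBlock J2, h x ∈ closedBlock J2) (s : ℂ) :
    ‖Phi (Pr I1) (Pr I2) s ((12 : ℂ) • ((k * b * h) * Pr J1 * star (k * b * h)))‖ ≤
    ‖Phi (Pr I1) (Pr I2) (conj s) ((12 : ℂ) • ((k * b * h) * Pr J1 * star (k * b * h)))‖ := by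
  have ck : ∀ (T : L2C I →L[ℂ] L2C I) (S S' : Set I), Disjoint S S' →
      (∀ x ∈ closedBlock S', T x ∈ closedBlock S') → ∀ j ∈ S', ∀ i ∈ S, T (stdBasis j) i = 0 := by
    intro T S S' hd hT j hj i hi
    exact mem_closedBlock.1 (hT _ (ee_mem hj)) i (fun h => Set.disjoint_left.1 hd hi h)
  have cI1 : Pr I1 * k = k * Pr I1 := by
    refine Pr_comm I1 k (fun j hj => k1 _ (ee_mem hj)) fun j hj => ?_
    have hj' : j ∈ I1 ∪ I2 ∪ I3 := by rw [hIcover]; trivial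
    rcases hj' with (hj' | hj') | hj'
    · exact absurd hj' hj
    · exact ck k I1 I2 hI12 k2 j hj'
    · exact ck k I1 I3 hI13 k3 j hj'
  have cI2 : Pr I2 * k = k * Pr I2 := by
    refine Pr_comm I2 k (fun j hj => k2 _ (ee_mem hj)) fun j hj => ?_
    have hj' : j ∈ I1 ∪ I2 ∪ I3 := by rw [hIcover]; trivial
    rcases hj' with (hj' | hj') | hj'
    · exact ck k I2 I1 hI12.symm k1 j hj'
    · exact absurd hj' hj
    · exact ck k I2 I3 hI23 k3 j hj'
  have cJ1 : Pr J1 * h = h * Pr J1 := by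
    refine Pr_comm J1 h (fun j hj => h1 _ (ee_mem hj)) fun j hj => ?_
    have hj' : j ∈ J1 ∪ J2 := by rw [hJcover]; trivial
    rcases hj' with hj' | hj'
    · exact absurd hj' hj
    · exact ck h J1 J2 hJ12 h2 j hj'
  have hQ : (k * b * h) * Pr J1 * star (k * b * h) = k * (b * (Pr J1 * (star b * star k))) := by
    rw [star_mul, star_mul]
    have : h * Pr J1 * star h = Pr J1 := by
      rw [← cJ1, mul_assoc, (Unitary.mem_iff.1 hh.1).2, mul_one]
    calc k * b * h * Pr J1 * (star h * (star b * star k)) =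
        k * b * (h * Pr J1 * star h) * (star b * star k) := by simp only [mul_assoc]
      _ = _ := by rw [this]; simp only [mul_assoc]
  rw [hQ]
  have hkk : ∀ x, star k (k x) = x := fun x => by
    have := congrArg (fun T : L2C I →L[ℂ] L2C I => T x) (Unitary.mem_iff.1 hk.1).1
    exact this
  have hbb : ∀ x, star b (b x) = x := fun x => by
    have := congrArg (fun T : L2C I →L[ℂ] L2C I => T x) (Unitary.mem_iff.1 hb.1).1
    exact this
  have hbb' : ∀ x, b (star b x) = x := fun x => by
    have := congrArg (fun T : L2C I →L[ℂ] L2C I => T x) (Unitary.mem_iff.1 hb.1).2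
    exact this
  have hbr1 : ∀ x, star (b x) = b (star x) := fun x => by
    have := hbr (star x)
    rw [star_star] at this
    exact this
  have hbr2 : ∀ x, star (star b x) = star b (star x) := fun x => by
    rw [← hbb (star (star b x)), ← hbr1, hbb']
  let θ : L2C I → L2C I := fun x => k (star (star k x))
  have a1 : ∀ x y, θ (x + y) = θ x + θ y := fun x y => by simp [θ]
  have a2 : ∀ (c : ℂ) x, θ (c • x) = conj c • θ x := fun c x => by
    simp only [θ, map_smul, star_smul_l2]
  have a3 : ∀ x, ‖θ x‖ = ‖x‖ := fun x => by
    simp only [θ]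
    rw [unitary_norm hk.1, norm_star_l2, unitary_norm (Unitary.star_mem hk.1)]
  have rP : ∀ S : Set I, Pr S * k = k * Pr S → Rel θ (Pr S) (Pr S) := by
    intro S hS x
    have e1 : star k (Pr S x) = Pr S (star k x) :=
      (congrArg (fun T : L2C I →L[ℂ] L2C I => T x) (comm_star (Pr_star S) hS)).symm
    have e2 : ∀ y, k (Pr S y) = Pr S (k y) := fun y =>
      (congrArg (fun T : L2C I →L[ℂ] L2C I => T y) hS).symm
    simp only [θ]
    rw [e1, Pr_real, e2]
  have rQ : Rel θ (k * (b * (Pr J1 * (star b * star k)))) (k * (b * (Pr J1 * (star b * star k)))) := by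
    intro x
    show k (star (star k (k (b (Pr J1 (star b (star k x))))))) =
      k (b (Pr J1 (star b (star k (k (star (star k x)))))))
    rw [hkk, hkk, hbr1, Pr_real, hbr2]
  have rQ' := Rel.smul a2 rQ 12
  rw [Complex.conj_ofNat] at rQ'

  exact norm_le_of_rel a3 (Phi_rel a1 a2 (rP I1 cI1) (rP I2 cI2) rQ' s)

end hard

end KBH

namespace KBH
open scoped ComplexConjugate
set_option linter.unusedSectionVars false

section matrices
open Matrix

/-- twelve times a rank three projection -/
def Nmat : Matrix (Fin 6) (Fin 6) ℂ :=
  !![5, 2, 2 + 3 * Complex.I, 1, -2, -2 + 3 * Complex.I;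
    2, 8, 2, -2, 4, -2;
    2 + -3 * Complex.I, 2, 5, -2 + -3 * Complex.I, -2, 1;
    1, -2, -2 + 3 * Complex.I, 5, 2, 2 + 3 * Complex.I;
    -2, 4, -2, 2, 8, 2;
    -2 + -3 * Complex.I, -2, 1, 2 + -3 * Complex.I, 2, 5]

/-- three orthogonal vectors -/
def wvec : Fin 3 → Fin 6 → ℂ :=
  ![![0, 1, 0, 0, 1, 0], ![1, 1, 1, -1, -1, -1], ![1, 0, -Complex.I, 1, 0, -Complex.I]]

/-- their square norms -/
def wn : Fin 3 → ℝ := ![2, 6, 4]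

theorem wvec_orth (a b : Fin 3) : ∑ i, conj (wvec a i) * wvec b i = if a = b then (wn a : ℂ) else 0 := by
  fin_cases a <;> fin_cases b <;>
    simp [wvec, wn, Fin.sum_univ_six] <;> norm_num

theorem wvec_N (i j : Fin 6) :
    6 * (wvec 0 i * conj (wvec 0 j)) + 2 * (wvec 1 i * conj (wvec 1 j)) +
      3 * (wvec 2 i * conj (wvec 2 j)) = Nmat i j := by
  fin_cases i <;> fin_cases j <;> simp [wvec, Nmat] <;> norm_num

/-- the projection on the first three coordinates -/
def Pd : Matrix (Fin 6) (Fin 6) ℂ := diagonal fun c => if c < 3 then 1 else 0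

theorem exists_V : ∃ V ∈ Matrix.unitaryGroup (Fin 6) ℂ, (12 : ℂ) • (V * Pd * Vᴴ) = Nmat := by
  let e : Fin 6 → Fin 3 := ![0, 1, 2, 0, 0, 0]
  let v : Fin 6 → EuclideanSpace ℂ (Fin 6) := fun j =>
    WithLp.toLp 2 fun i => ((√(wn (e j)))⁻¹ : ℝ) * wvec (e j) i
  have hwn : ∀ a, 0 < wn a := by intro a; fin_cases a <;> simp [wn]
  obtain ⟨B, hB⟩ := Orthonormal.exists_orthonormalBasis_extension_of_card_eq (𝕜 := ℂ)
    (E := EuclideanSpace ℂ (Fin 6)) (ι := Fin 6) (by simp) (v := v) (s := {j | j < 3}) (by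
      rw [orthonormal_iff_ite]
      rintro ⟨i, hi⟩ ⟨j, hj⟩
      simp only [Set.domRestrict_apply, v]
      rw [PiLp.inner_apply]
      simp only [RCLike.inner_apply, map_mul, Complex.conj_ofReal]
      have : ∀ x, (((√(wn (e j)))⁻¹ : ℝ) : ℂ) * wvec (e j) x *
          (((√(wn (e i)))⁻¹ : ℝ) * conj (wvec (e i) x)) =
        (((√(wn (e j)))⁻¹ : ℝ) : ℂ) * (((√(wn (e i)))⁻¹ : ℝ)) *
          (conj (wvec (e i) x) * wvec (e j) x) := fun x => by ring
      simp only [this]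
      rw [← Finset.mul_sum, wvec_orth]
      have he : e i = e j ↔ i = j := by
        have : ∀ i j : Fin 6, i < 3 → j < 3 →
          ((![0, 1, 2, 0, 0, 0] : Fin 6 → Fin 3) i = (![0, 1, 2, 0, 0, 0] : Fin 6 → Fin 3) j ↔
            i = j) := by decide
        exact this i j hi hj
      by_cases hij : i = j
      · subst hij
        simp only [if_true]
        norm_cast
        rw [← mul_inv, Real.mul_self_sqrt (hwn _).le]
        exact inv_mul_cancel₀ (hwn _).ne'
      · simp [hij, he])
  refine ⟨Matrix.of fun i j => B j i, ?_, ?_⟩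
  · rw [Matrix.mem_unitaryGroup_iff', Matrix.star_eq_conjTranspose]
    ext j j'
    rw [Matrix.mul_apply, Matrix.one_apply]
    have h1 := orthonormal_iff_ite.1 B.orthonormal j j'
    rw [PiLp.inner_apply] at h1
    simp only [RCLike.inner_apply] at h1
    rw [← h1]
    exact Finset.sum_congr rfl fun k _ => mul_comm _ _
  · ext i j
    have hb : ∀ c : Fin 6, c < 3 → B c i * conj (B c j) =
        ((wn (e c))⁻¹ : ℝ) * (wvec (e c) i * conj (wvec (e c) j)) := by
      intro c hc
      rw [hB c hc]
      simp only [v, map_mul, Complex.conj_ofReal]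
      have : (wn (e c))⁻¹ = (√(wn (e c)))⁻¹ * (√(wn (e c)))⁻¹ := by
        rw [← mul_inv, Real.mul_self_sqrt (hwn _).le]
      rw [this]; push_cast; ring
    rw [← wvec_N, Matrix.smul_apply, Matrix.mul_apply]
    simp only [Pd, Matrix.mul_diagonal, Matrix.conjTranspose_apply, Matrix.of_apply,
      RCLike.star_def, smul_eq_mul]
    have h0 := hb 0 (by decide)
    have h1 := hb 1 (by decide)
    have h2 := hb 2 (by decide)
    have e0 : e 0 = 0 := rfl
    have e1 : e 1 = 1 := rfl
    have e2 : e 2 = 2 := rfl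
    rw [e0] at h0
    rw [e1] at h1
    rw [e2] at h2
    have n0 : wn 0 = 2 := rfl
    have n1 : wn 1 = 6 := rfl
    have n2 : wn 2 = 4 := rfl
    rw [n0] at h0
    rw [n1] at h1
    rw [n2] at h2
    push_cast at h0 h1 h2
    rw [Fin.sum_univ_six]
    rw [if_pos (by decide), if_pos (by decide), if_pos (by decide), if_neg (by decide),
      if_neg (by decide), if_neg (by decide)]
    simp only [mul_one, mul_zero, zero_mul, add_zero]
    rw [h0, h1, h2]
    ring

/-- block `D` -/
def Dm : Matrix (Fin 2) (Fin 2) ℂ := !![5, 2; 2, 8]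
/-- block `H` -/
def Hm : Matrix (Fin 2) (Fin 2) ℂ := !![14, 2 + 6 * Complex.I; 2 + -6 * Complex.I, 8]
/-- block `E` -/
def Em : Matrix (Fin 2) (Fin 2) ℂ := !![80, -4 + 60 * Complex.I; -4 + -60 * Complex.I, 56]

theorem Nmat11 : Nmat.submatrix ![0, 1] ![0, 1] = Dm := by
  ext i j; fin_cases i <;> fin_cases j <;> simp [Nmat, Dm]
theorem Nmat12 : Nmat.submatrix ![0, 1] ![2, 3] = !![2 + 3 * Complex.I, 1; 2, -2] := by
  ext i j; fin_cases i <;> fin_cases j <;> simp [Nmat]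
theorem Nmat21 : Nmat.submatrix ![2, 3] ![0, 1] = !![2 + -3 * Complex.I, 2; 1, -2] := by
  ext i j; fin_cases i <;> fin_cases j <;> simp [Nmat]
theorem Nmat22 : Nmat.submatrix ![2, 3] ![2, 3] =
    !![5, -2 + -3 * Complex.I; -2 + 3 * Complex.I, 5] := by
  ext i j; fin_cases i <;> fin_cases j <;> simp [Nmat]

theorem Hm_eq : Nmat.submatrix ![0, 1] ![2, 3] * Nmat.submatrix ![2, 3] ![0, 1] = Hm := by
  rw [Nmat12, Nmat21, Hm]
  have hI := Complex.I_mul_I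
  ext i j; fin_cases i <;> fin_cases j <;> simp [Matrix.mul_apply, Fin.sum_univ_two] <;>
    first | linear_combination (-9 : ℂ) * hI | ring

theorem Em_eq : Nmat.submatrix ![0, 1] ![2, 3] *
    (Nmat.submatrix ![2, 3] ![2, 3] * Nmat.submatrix ![2, 3] ![0, 1]) = Em := by
  rw [Nmat12, Nmat21, Nmat22, Em]
  ext i j; fin_cases i <;> fin_cases j <;> simp [Matrix.mul_apply, Fin.sum_univ_two] <;>
    ring_nf <;> simp [Complex.I_sq] <;> ring

theorem final_eq : ((Dm * Hm - Hm * Dm) * (Em - (68 : ℂ) • 1) +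
    (Em - (68 : ℂ) • 1) * (Dm * Hm - Hm * Dm)) = (1728 * Complex.I) • 1 := by
  have h1 : Em - (68 : ℂ) • 1 = !![12, -4 + 60 * Complex.I; -4 + -60 * Complex.I, -12] := by
    ext i j; fin_cases i <;> fin_cases j <;> simp [Em] <;> norm_num
  have h2 : Dm * Hm - Hm * Dm = !![-24 * Complex.I, -18 + -18 * Complex.I;
      18 + -18 * Complex.I, 24 * Complex.I] := by
    ext i j; fin_cases i <;> fin_cases j <;>
      simp [Dm, Hm, Matrix.mul_apply, Fin.sum_univ_two] <;> ring
  rw [h1, h2]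
  ext i j; fin_cases i <;> fin_cases j <;> simp [Matrix.mul_apply, Fin.sum_univ_two] <;>
    ring_nf

end matrices

end KBH

namespace KBH
open scoped ComplexConjugate
set_option linter.unusedSectionVars false

section counter
variable {I : Type*} [DecidableEq I]

/-- `T` maps basis vectors indexed by `g` into the span of those indexed by `f` -/
def Acts {m n : Type*} [Fintype m] (f : m → I) (g : n → I) (T : L2C I →L[ℂ] L2C I)
    (M : Matrix m n ℂ) : Prop := ∀ a, T (stdBasis (g a)) = ∑ b, M b a • stdBasis (f b)

theorem Acts.mul {l m n : Type*} [Fintype l] [Fintype m] {f : l → I} {g : m → I} {h : n → I}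
    {S T : L2C I →L[ℂ] L2C I} {M : Matrix l m ℂ} {N : Matrix m n ℂ}
    (hS : Acts f g S M) (hT : Acts g h T N) : Acts f h (S * T) (M * N) := by
  intro a
  show S (T (stdBasis (h a))) = _
  rw [hT a, map_sum]
  simp only [map_smul, hS _, Finset.smul_sum, Matrix.mul_apply, Finset.sum_smul, smul_smul]
  rw [Finset.sum_comm]
  refine Finset.sum_congr rfl fun i _ => Finset.sum_congr rfl fun j _ => ?_
  rw [mul_comm]

theorem Acts.add {m n : Type*} [Fintype m] {f : m → I} {g : n → I}
    {S T : L2C I →L[ℂ] L2C I} {M N : Matrix m n ℂ}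
    (hS : Acts f g S M) (hT : Acts f g T N) : Acts f g (S + T) (M + N) := by
  intro a
  show S _ + T _ = _
  rw [hS a, hT a, ← Finset.sum_add_distrib]
  simp only [Matrix.add_apply, add_smul]

theorem Acts.smul {m n : Type*} [Fintype m] {f : m → I} {g : n → I}
    {S : L2C I →L[ℂ] L2C I} {M : Matrix m n ℂ} (c : ℂ)
    (hS : Acts f g S M) : Acts f g (c • S) (c • M) := by
  intro a
  show c • S _ = _
  rw [hS a, Finset.smul_sum]
  simp only [Matrix.smul_apply, smul_smul, smul_eq_mul]

theorem Acts.sub {m n : Type*} [Fintype m] {f : m → I} {g : n → I}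
    {S T : L2C I →L[ℂ] L2C I} {M N : Matrix m n ℂ}
    (hS : Acts f g S M) (hT : Acts f g T N) : Acts f g (S - T) (M - N) := by
  intro a
  show S _ - T _ = _
  rw [hS a, hT a, ← Finset.sum_sub_distrib]
  simp only [Matrix.sub_apply, sub_smul]

theorem Acts.one {n : Type*} [Fintype n] [DecidableEq n] {f : n → I} : Acts f f 1 (1 : Matrix n n ℂ) := by
  intro a
  simp [Matrix.one_apply]

theorem acts_Pr_one {n : Type*} [Fintype n] [DecidableEq n] {f : n → I} {S : Set I}
    (h : ∀ a, f a ∈ S) : Acts f f (Pr S) (1 : Matrix n n ℂ) := by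
  classical
  intro a
  simp [Matrix.one_apply, Pr_ee, h]

theorem acts_ext {n : Type*} [Fintype n] [DecidableEq n] {f : n → I} (hf : Function.Injective f)
    (M : Matrix n n ℂ) : Acts f f (ext f M) M := by
  intro a
  show stdBasis (f a) + emb f (M - 1) (stdBasis (f a)) = _
  rw [emb_apply]
  simp [ee_orth hf, Matrix.one_apply, sub_smul, Finset.sum_sub_distrib]

theorem ext_ee_out {n : Type*} [Fintype n] [DecidableEq n] {f : n → I}
    (M : Matrix n n ℂ) (j : I) (hj : j ∉ Set.range f) : ext f M (stdBasis j) = stdBasis j := by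
  show stdBasis j + emb f (M - 1) (stdBasis j) = _
  rw [emb_apply]
  have : ∀ b, (stdBasis j : L2C I) (f b) = 0 := fun b => by
    rw [ee_apply, if_neg (fun h => hj ⟨b, h⟩)]
  simp [this]

theorem acts_block {f : Fin 6 → I} {S : Set I} {i : Fin 2 → Fin 6} {n : Type*} {g : n → I}
    {Q : L2C I →L[ℂ] L2C I} {N : Matrix (Fin 6) n ℂ} (hQ : Acts f g Q N)
    (hi : ∀ c, Pr S (stdBasis (f c)) = ∑ b, if i b = c then stdBasis (f c) else 0) :
    Acts (f ∘ i) g (Pr S * Q) (N.submatrix i id) := by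
  intro a
  show Pr S (Q _) = _
  rw [hQ a, map_sum]
  simp only [map_smul, hi, Finset.smul_sum, Function.comp, Matrix.submatrix_apply, id]
  rw [Finset.sum_comm]
  refine Finset.sum_congr rfl fun b _ => ?_
  rw [Finset.sum_eq_single (i b)]
  · simp
  · intro c _ hc; simp [hc.symm]
  · simp

theorem mulv (S T : L2C I →L[ℂ] L2C I) (x : L2C I) : (S * T) x = S (T x) := rfl
theorem addv (S T : L2C I →L[ℂ] L2C I) (x : L2C I) : (S + T) x = S x + T x := rfl
theorem smulv (c : ℂ) (T : L2C I →L[ℂ] L2C I) (x : L2C I) : (c • T) x = c • T x := rfl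

theorem exists_perm_op {f g : Fin 6 → I} (hf : Function.Injective f) (hg : Function.Injective g)
    (J1 : Set I) (hgJ : ∀ c, g c ∈ J1 ↔ c < 3) :
    ∃ (w : L2C I →L[ℂ] L2C I) (S : Set I), memU2 w ∧ w * Pr J1 * star w = Pr S ∧
      ∀ c, f c ∈ S ↔ c < 3 := by
  classical
  obtain ⟨F, hfF, hgF⟩ : ∃ F : Finset I, (∀ c, f c ∈ F) ∧ ∀ c, g c ∈ F :=
    ⟨Finset.univ.image f ∪ Finset.univ.image g,
      fun c => Finset.mem_union_left _ (Finset.mem_image_of_mem _ (Finset.mem_univ c)),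
      fun c => Finset.mem_union_right _ (Finset.mem_image_of_mem _ (Finset.mem_univ c))⟩
  obtain ⟨σ, hσ⟩ := Equiv.Perm.exists_extending_pair (β := F) (fun c => ⟨g c, hgF c⟩)
    (fun c => ⟨f c, hfF c⟩) (fun a b h => hg (congrArg Subtype.val h))
    (fun a b h => hf (congrArg Subtype.val h))
  have hv : Function.Injective (Subtype.val : F → I) := Subtype.val_injective
  let M : Matrix F F ℂ := Matrix.of fun a b => if a = σ b then 1 else 0
  have hMs : M.conjTranspose = Matrix.of fun a b => if σ a = b then 1 else 0 := by
    ext a b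
    simp only [M, Matrix.conjTranspose_apply, Matrix.of_apply]
    by_cases h : σ a = b
    · simp [h]
    · simp [h, Ne.symm h]
  have hM : M ∈ Matrix.unitaryGroup F ℂ := by
    rw [Matrix.mem_unitaryGroup_iff', Matrix.star_eq_conjTranspose, hMs]
    ext a b
    simp [M, Matrix.mul_apply, Matrix.one_apply]
  have m1 : ∀ a : F, ext Subtype.val M (stdBasis a.1) = stdBasis (σ a).1 := by
    intro a
    rw [acts_ext hv M a]
    simp [M]
  have m2 : ∀ a : F, ext Subtype.val M.conjTranspose (stdBasis (σ a).1) = stdBasis a.1 := by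
    intro a
    rw [acts_ext hv M.conjTranspose (σ a), hMs]
    simp
  have hMm := ext_memU2 hv M hM
  clear_value M
  obtain ⟨S, hS1, hS2⟩ : ∃ S : Set I, (∀ a : F, (σ a).1 ∈ S ↔ a.1 ∈ J1) ∧
      ∀ i, i ∉ F → (i ∈ S ↔ i ∈ J1) := by
    refine ⟨{i | if h : i ∈ F then (σ.symm ⟨i, h⟩).1 ∈ J1 else i ∈ J1}, fun a => ?_,
      fun i hi => ?_⟩
    · rw [Set.mem_setOf_eq, dif_pos (σ a).2]
      simp
    · rw [Set.mem_setOf_eq, dif_neg hi]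
  refine ⟨ext Subtype.val M, S, hMm, ?_, ?_⟩
  · rw [ext_star]
    apply clm_ext
    intro i
    rw [mulv, mulv, Pr_ee S]
    by_cases hi : i ∈ F
    · obtain ⟨a, ha⟩ := σ.surjective ⟨i, hi⟩
      obtain rfl : (σ a).1 = i := by rw [ha]
      simp only [hS1]
      rw [m2, Pr_ee]
      split_ifs
      · rw [m1]
      · simp
    · have hr : i ∉ Set.range (Subtype.val : F → I) := by simpa using hi
      simp only [hS2 i hi]
      rw [ext_ee_out _ _ hr, Pr_ee]
      split_ifs
      · rw [ext_ee_out _ _ hr]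
      · simp
  · intro c
    have := hS1 ⟨g c, hgF c⟩
    rw [hσ c] at this
    exact this.trans (hgJ c)

theorem counter_core {f : Fin 6 → I} (hf : Function.Injective f)
    (I1 I2 : Set I) (hI12 : Disjoint I1 I2)
    (hf1 : ∀ c, f c ∈ I1 ↔ c < 2) (hf2 : ∀ c, f c ∈ I2 ↔ (c = 2 ∨ c = 3))
    (Q : L2C I →L[ℂ] L2C I) (aQ : Acts f f Q Nmat)
    (q1 : ∀ j, j ∉ Set.range f → ∃ c : ℂ, Q (stdBasis j) = c • stdBasis j) :
      Phi (Pr I1) (Pr I2) (-(1728 * Complex.I)) Q = 0 ∧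
      Hop (Pr I1) (Pr I2) Q ≠ 0 := by
  classical
  have b1 : ∀ c, Pr I1 (stdBasis (f c)) =
      ∑ b, if (![0, 1] : Fin 2 → Fin 6) b = c then (stdBasis (f c) : L2C I) else 0 := by
    intro c
    rw [Pr_ee]
    simp only [hf1, Fin.sum_univ_two]
    fin_cases c <;> simp
  have b2 : ∀ c, Pr I2 (stdBasis (f c)) =
      ∑ b, if (![2, 3] : Fin 2 → Fin 6) b = c then (stdBasis (f c) : L2C I) else 0 := by
    intro c
    rw [Pr_ee]
    simp only [hf2, Fin.sum_univ_two]
    fin_cases c <;> simp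
  have aQ' : ∀ i : Fin 2 → Fin 6, Acts f (f ∘ i) Q (Nmat.submatrix id i) := fun i a => aQ (i a)
  have p1 := fun i => acts_block (aQ' i) b1
  have p2 := fun i => acts_block (aQ' i) b2
  have p3 : Acts (f ∘ ![0, 1]) (f ∘ ![0, 1]) (Pr I1) 1 := acts_Pr_one (by
    intro a; simp only [Function.comp, hf1]; fin_cases a <;> simp)
  have aD : Acts (f ∘ ![0, 1]) (f ∘ ![0, 1]) (Dop (Pr I1) Q) Dm := by
    have := (p1 ![0, 1]).mul p3
    rw [mul_one] at this
    rw [← Nmat11]; exact this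
  have aH : Acts (f ∘ ![0, 1]) (f ∘ ![0, 1]) (Hop (Pr I1) (Pr I2) Q) Hm := by
    have := (p1 ![2, 3]).mul ((p2 ![0, 1]).mul p3)
    rw [mul_one] at this
    rw [← Hm_eq]
    convert this using 1
    · simp only [Hop, mul_assoc]
    · rfl
  have aE : Acts (f ∘ ![0, 1]) (f ∘ ![0, 1]) (Eop (Pr I1) (Pr I2) Q) Em := by
    have := (p1 ![2, 3]).mul ((p2 ![2, 3]).mul ((p2 ![0, 1]).mul p3))
    rw [mul_one] at this
    rw [← Em_eq]
    convert this using 1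
    · simp only [Eop, mul_assoc]
    · rfl
  have aC := (aD.mul aH).sub (aH.mul aD)
  have aE' := aE.sub (Acts.one.smul 68)
  have aPhi : Acts (f ∘ ![0, 1]) (f ∘ ![0, 1]) (Phi (Pr I1) (Pr I2) (-(1728 * Complex.I)) Q) 0 := by
    have := ((((aC.mul aE').add (aE'.mul aC)).mul aH).add (aH.smul (-(1728 * Complex.I))))
    rw [final_eq] at this
    have h0 : ((1728 * Complex.I) • (1 : Matrix (Fin 2) (Fin 2) ℂ)) * Hm +
        (-(1728 * Complex.I)) • Hm = 0 := by
      rw [smul_mul_assoc, one_mul, ← add_smul, add_neg_cancel, zero_smul]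
    rw [h0] at this
    exact this
  have hP1 : ∀ j, j ∉ I1 → Pr I1 (stdBasis j) = 0 := fun j hj => by rw [Pr_ee, if_neg hj]
  have hH0 : ∀ j, j ∉ Set.range f → Hop (Pr I1) (Pr I2) Q (stdBasis j) = 0 := by
    intro j hj
    obtain ⟨c, hc⟩ := q1 j hj
    simp only [Hop, mulv]
    by_cases hj1 : j ∈ I1
    · have hj2 : j ∉ I2 := fun h => Set.disjoint_left.1 hI12 hj1 h
      rw [Pr_ee, if_pos hj1, hc, map_smul, Pr_ee, if_neg hj2]
      simp
    · rw [hP1 j hj1]; simp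
  have hPhi : ∀ s j, Hop (Pr I1) (Pr I2) Q (stdBasis j) = 0 →
      Phi (Pr I1) (Pr I2) s Q (stdBasis j) = 0 := by
    intro s j hj
    rw [Phi, addv, mulv, smulv, hj, map_zero, smul_zero, add_zero]
  constructor
  · apply clm_ext
    intro j
    show _ = (0 : L2C I)
    by_cases hj : j ∈ Set.range f
    · obtain ⟨c, rfl⟩ := hj
      by_cases hc : c < 2
      · have hc' : ∃ a : Fin 2, (![0, 1] : Fin 2 → Fin 6) a = c := by
          revert c; decide
        obtain ⟨a, rfl⟩ := hc'
        rw [show f (![0, 1] a) = (f ∘ ![0, 1]) a from rfl, aPhi a]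
        simp
      · apply hPhi
        simp only [Hop, mulv]
        rw [hP1 _ (fun h => hc ((hf1 c).1 h))]
        simp
    · exact hPhi _ _ (hH0 j hj)
  · intro h0
    have h1 := aH 0
    rw [h0] at h1
    have h2 := congrArg (fun x : L2C I => x (f 0)) h1
    simp only [Fin.sum_univ_two, Function.comp] at h2
    have h3 : (0 : L2C I) (f 0) = Hm 0 0 * (stdBasis (f 0) : L2C I) (f 0) +
      Hm 1 0 * (stdBasis (f 1) : L2C I) (f 0) := h2
    rw [ee_orth hf, ee_orth hf] at h3
    have h4 : (0 : L2C I) (f 0) = 0 := rfl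
    rw [h4] at h3
    simp [Hm] at h3

theorem exists_counter {f g : Fin 6 → I} (hf : Function.Injective f) (hg : Function.Injective g)
    (I1 I2 J1 : Set I) (hI12 : Disjoint I1 I2) (hgJ : ∀ c, g c ∈ J1 ↔ c < 3)
    (hf1 : ∀ c, f c ∈ I1 ↔ c < 2) (hf2 : ∀ c, f c ∈ I2 ↔ (c = 2 ∨ c = 3)) :
    ∃ u : L2C I →L[ℂ] L2C I, memU2 u ∧
      Phi (Pr I1) (Pr I2) (-(1728 * Complex.I)) ((12 : ℂ) • (u * Pr J1 * star u)) = 0 ∧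
      Hop (Pr I1) (Pr I2) ((12 : ℂ) • (u * Pr J1 * star u)) ≠ 0 := by
  classical
  obtain ⟨w, S, hw, hwS, hfS⟩ := exists_perm_op hf hg J1 hgJ
  obtain ⟨V, hV, hVN⟩ := exists_V
  refine ⟨ext f V * w, memU2_mul (ext_memU2 hf V hV) hw, ?_⟩
  have hQ : (12 : ℂ) • (ext f V * w * Pr J1 * star (ext f V * w)) =
      (12 : ℂ) • (ext f V * Pr S * ext f V.conjTranspose) := by
    rw [star_mul, ext_star, ← hwS]; simp only [mul_assoc]
  rw [hQ]
  have aS : Acts f f (Pr S) Pd := by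
    intro c
    rw [Pr_ee]
    simp only [hfS, Pd, Matrix.diagonal_apply, ite_smul, zero_smul]
    simp
  have aQ : Acts f f ((12 : ℂ) • (ext f V * Pr S * ext f V.conjTranspose)) Nmat := by
    rw [← hVN]
    exact (((acts_ext hf V).mul aS).mul (acts_ext hf _)).smul 12
  refine counter_core hf I1 I2 hI12 hf1 hf2 _ aQ fun j hj => ⟨if j ∈ S then 12 else 0, ?_⟩
  rw [smulv, mulv, mulv, ext_ee_out _ _ hj, Pr_ee]
  split_ifs
  · rw [ext_ee_out _ _ hj]
  · simp

end counter

end KBH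

namespace KBH
open scoped ComplexConjugate
set_option linter.unusedSectionVars false

section final
set_option linter.unusedSectionVars false
variable {I : Type*} [DecidableEq I]

theorem gen_cont {R : Type*} [NormedRing R] [NormedAlgebra ℂ R] (a b : R) (s : ℂ) :
    Continuous fun q : R =>
      ((a * q * a * (a * q * b * q * a) - a * q * b * q * a * (a * q * a)) *
          (a * q * b * q * b * q * a - (68 : ℂ) • (1 : R)) +
        (a * q * b * q * b * q * a - (68 : ℂ) • (1 : R)) *
          (a * q * a * (a * q * b * q * a) - a * q * b * q * a * (a * q * a))) *
        (a * q * b * q * a) + s • (a * q * b * q * a) := by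
  fun_prop

theorem Phi_cont (P1 P2 : L2C I →L[ℂ] L2C I) (s : ℂ) : Continuous fun Q => Phi P1 P2 s Q := by
  unfold Phi Cop Eop Dop Hop
  exact gen_cont P1 P2 s

theorem conj_cont (P : L2C I →L[ℂ] L2C I) :
    Continuous fun v : L2C I →L[ℂ] L2C I => (12 : ℂ) • (v * P * star v) :=
  ((continuous_id.mul continuous_const).mul continuous_star).const_smul (12 : ℂ)

theorem dense_norm (I1 I2 I3 J1 J2 : Set I)
    (hIcover : I1 ∪ I2 ∪ I3 = Set.univ)
    (hI12 : Disjoint I1 I2) (hI13 : Disjoint I1 I3) (hI23 : Disjoint I2 I3)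
    (hJcover : J1 ∪ J2 = Set.univ) (hJ12 : Disjoint J1 J2)
    (hd : ∀ u : L2C I →L[ℂ] L2C I, memU2 u → ∀ ε > (0 : ℝ),
      ∃ k b h : L2C I →L[ℂ] L2C I,
        memU2 k ∧ memU2 b ∧ memU2 h ∧
        (∀ x ∈ closedBlock I1, k x ∈ closedBlock I1) ∧
        (∀ x ∈ closedBlock I2, k x ∈ closedBlock I2) ∧
        (∀ x ∈ closedBlock I3, k x ∈ closedBlock I3) ∧
        (∀ x : L2C I, star (b (star x)) = b x) ∧
        (∀ x ∈ closedBlock J1, h x ∈ closedBlock J1) ∧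
        (∀ x ∈ closedBlock J2, h x ∈ closedBlock J2) ∧
        hsNorm (u - k * b * h) < ε)
    (u : L2C I →L[ℂ] L2C I) (hu : memU2 u) (s : ℂ) :
    ‖Phi (Pr I1) (Pr I2) s ((12 : ℂ) • (u * Pr J1 * star u))‖ ≤
    ‖Phi (Pr I1) (Pr I2) (conj s) ((12 : ℂ) • (u * Pr J1 * star u))‖ := by
  have hc : ∀ s, Continuous fun v : L2C I →L[ℂ] L2C I =>
      Phi (Pr I1) (Pr I2) s ((12 : ℂ) • (v * Pr J1 * star v)) := by
    intro s
    have h1 := Phi_cont (Pr I1) (Pr I2) s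
    have h2 := conj_cont (Pr J1)
    have h3 := h1.comp h2
    unfold Function.comp at h3
    exact h3
  have hA := isClosed_le (hc s).norm (hc (conj s)).norm
  have : u ∈ closure {v : L2C I →L[ℂ] L2C I |
    ‖Phi (Pr I1) (Pr I2) s ((12 : ℂ) • (v * Pr J1 * star v))‖ ≤
    ‖Phi (Pr I1) (Pr I2) (conj s) ((12 : ℂ) • (v * Pr J1 * star v))‖} := by
    rw [Metric.mem_closure_iff]
    intro ε hε
    obtain ⟨k, b, h, hk, hb, hh, k1, k2, k3, hbr, h1, h2, hlt⟩ := hd u hu ε hε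
    refine ⟨k * b * h, kbh_norm I1 I2 I3 J1 J2 hIcover hI12 hI13 hI23 hJcover hJ12 k b h hk hb hh
      k1 k2 k3 hbr h1 h2 s, ?_⟩
    rw [dist_eq_norm]
    refine lt_of_le_of_lt (opNorm_le_hs _ ?_) hlt
    have e : u - k * b * h = (u - 1) - (k * b * h - 1) := by abel
    rw [e]
    exact hs_sub hu.2 (memU2_mul (memU2_mul hk hb) hh).2
  rw [hA.closure_eq] at this
  exact this

theorem exists_emb (S : Set I) (n : ℕ) (h : (n : Cardinal) < Cardinal.mk S) :
    Nonempty (Fin (n + 1) ↪ S) := by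
  rw [← Cardinal.lift_mk_le']
  simp only [Cardinal.mk_fin, Cardinal.lift_natCast]
  by_contra hlt
  rw [not_le] at hlt
  have h2 : Cardinal.mk S < ((n + 1 : ℕ) : Cardinal) := by
    have h3 : Cardinal.lift.{0} (Cardinal.mk S) = Cardinal.mk S := Cardinal.lift_uzero _
    rw [h3] at hlt; exact hlt
  obtain ⟨m, hm⟩ := Cardinal.lt_aleph0.1 (h2.trans (Cardinal.natCast_lt_aleph0))
  rw [hm] at h h2
  have a1 : n < m := by exact_mod_cast h
  have a2 : m < n + 1 := by exact_mod_cast h2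
  omega

theorem inj6 (v0 v1 v2 v3 v4 v5 : I)
    (h01 : v0 ≠ v1) (h02 : v0 ≠ v2) (h03 : v0 ≠ v3) (h04 : v0 ≠ v4) (h05 : v0 ≠ v5) (h12 : v1 ≠ v2) (h13 : v1 ≠ v3) (h14 : v1 ≠ v4) (h15 : v1 ≠ v5) (h23 : v2 ≠ v3) (h24 : v2 ≠ v4) (h25 : v2 ≠ v5) (h34 : v3 ≠ v4) (h35 : v3 ≠ v5) (h45 : v4 ≠ v5) :
    Function.Injective ![v0, v1, v2, v3, v4, v5] := by
  intro i j h
  fin_cases i <;> fin_cases j <;> simp_all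

theorem exists_g (J1 J2 : Set I) (hJ12 : Disjoint J1 J2) (p : Fin 3 ↪ J1) (q : Fin 3 ↪ J2) :
    ∃ g : Fin 6 → I, Function.Injective g ∧ ∀ i, g i ∈ J1 ↔ i < 3 := by
  have inj : ∀ {m : ℕ} {S : Set I} (e : Fin m ↪ S) (i j : Fin m), i ≠ j → (e i : I) ≠ e j :=
    fun e i j hij h => hij (e.injective (Subtype.ext h))
  have hne : ∀ {S T : Set I}, Disjoint S T → ∀ (x : S) (y : T), (x : I) ≠ y :=
    fun hST x y h => Set.disjoint_left.1 hST x.2 (h ▸ y.2)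
  have nJ : ∀ x : J2, (x : I) ∉ J1 := fun x h => Set.disjoint_left.1 hJ12 h x.2
  refine ⟨![p 0, p 1, p 2, q 0, q 1, q 2], ?_, ?_⟩
  · apply inj6 <;>
      first
      | exact hne hJ12 _ _
      | exact inj p _ _ (by decide)
      | exact inj q _ _ (by decide)
  · intro i
    fin_cases i
    · exact iff_of_true (p 0).2 (by decide)
    · exact iff_of_true (p 1).2 (by decide)
    · exact iff_of_true (p 2).2 (by decide)
    · exact iff_of_false (nJ (q 0)) (by decide)
    · exact iff_of_false (nJ (q 1)) (by decide)
    · exact iff_of_false (nJ (q 2)) (by decide)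

theorem exists_f (I1 I2 I3 : Set I)
    (hI12 : Disjoint I1 I2) (hI13 : Disjoint I1 I3) (hI23 : Disjoint I2 I3)
    (a : Fin 2 ↪ I1) (b : Fin 2 ↪ I2) (c : Fin 2 ↪ I3) :
    ∃ f : Fin 6 → I, Function.Injective f ∧ (∀ i, f i ∈ I1 ↔ i < 2) ∧
      ∀ i, f i ∈ I2 ↔ (i = 2 ∨ i = 3) := by
  have inj : ∀ {m : ℕ} {S : Set I} (e : Fin m ↪ S) (i j : Fin m), i ≠ j → (e i : I) ≠ e j :=
    fun e i j hij h => hij (e.injective (Subtype.ext h))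
  have hne : ∀ {S T : Set I}, Disjoint S T → ∀ (x : S) (y : T), (x : I) ≠ y :=
    fun hST x y h => Set.disjoint_left.1 hST x.2 (h ▸ y.2)
  have n12 : ∀ x : I2, (x : I) ∉ I1 := fun x h => Set.disjoint_left.1 hI12 h x.2
  have n13 : ∀ x : I3, (x : I) ∉ I1 := fun x h => Set.disjoint_left.1 hI13 h x.2
  have n21 : ∀ x : I1, (x : I) ∉ I2 := fun x h => Set.disjoint_left.1 hI12 x.2 h
  have n23 : ∀ x : I3, (x : I) ∉ I2 := fun x h => Set.disjoint_left.1 hI23 h x.2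
  refine ⟨![a 0, a 1, b 0, b 1, c 0, c 1], ?_, ?_, ?_⟩
  · apply inj6 <;>
      first
      | exact hne hI12 _ _
      | exact hne hI13 _ _
      | exact hne hI23 _ _
      | exact inj a _ _ (by decide)
      | exact inj b _ _ (by decide)
      | exact inj c _ _ (by decide)
  · intro i
    fin_cases i
    · exact iff_of_true (a 0).2 (by decide)
    · exact iff_of_true (a 1).2 (by decide)
    · exact iff_of_false (n12 (b 0)) (by decide)
    · exact iff_of_false (n12 (b 1)) (by decide)
    · exact iff_of_false (n13 (c 0)) (by decide)
    · exact iff_of_false (n13 (c 1)) (by decide)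
  · intro i
    fin_cases i
    · exact iff_of_false (n21 (a 0)) (by decide)
    · exact iff_of_false (n21 (a 1)) (by decide)
    · exact iff_of_true (b 0).2 (by decide)
    · exact iff_of_true (b 1).2 (by decide)
    · exact iff_of_false (n23 (c 0)) (by decide)
    · exact iff_of_false (n23 (c 1)) (by decide)

theorem hard (I1 I2 I3 J1 J2 : Set I)
    (hIcover : I1 ∪ I2 ∪ I3 = Set.univ)
    (hI12 : Disjoint I1 I2) (hI13 : Disjoint I1 I3) (hI23 : Disjoint I2 I3)
    (hJcover : J1 ∪ J2 = Set.univ) (hJ12 : Disjoint J1 J2)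
    (hd : ∀ u : L2C I →L[ℂ] L2C I, memU2 u → ∀ ε > (0 : ℝ),
      ∃ k b h : L2C I →L[ℂ] L2C I,
        memU2 k ∧ memU2 b ∧ memU2 h ∧
        (∀ x ∈ closedBlock I1, k x ∈ closedBlock I1) ∧
        (∀ x ∈ closedBlock I2, k x ∈ closedBlock I2) ∧
        (∀ x ∈ closedBlock I3, k x ∈ closedBlock I3) ∧
        (∀ x : L2C I, star (b (star x)) = b x) ∧
        (∀ x ∈ closedBlock J1, h x ∈ closedBlock J1) ∧
        (∀ x ∈ closedBlock J2, h x ∈ closedBlock J2) ∧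
        hsNorm (u - k * b * h) < ε) :
    (min (Cardinal.mk J1) (Cardinal.mk J2) ≤ 2 ∨
      min (Cardinal.mk I1) (min (Cardinal.mk I2) (Cardinal.mk I3)) ≤ 1) := by
  by_contra hcon
  rw [not_or, not_le, not_le, lt_min_iff, lt_min_iff, lt_min_iff] at hcon
  obtain ⟨⟨cJ1, cJ2⟩, cI1, cI2, cI3⟩ := hcon
  obtain ⟨p⟩ := exists_emb J1 2 (by exact_mod_cast cJ1)
  obtain ⟨q⟩ := exists_emb J2 2 (by exact_mod_cast cJ2)
  obtain ⟨a⟩ := exists_emb I1 1 (by exact_mod_cast cI1)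
  obtain ⟨b⟩ := exists_emb I2 1 (by exact_mod_cast cI2)
  obtain ⟨c⟩ := exists_emb I3 1 (by exact_mod_cast cI3)
  obtain ⟨f, hf, hf1, hf2⟩ := exists_f I1 I2 I3 hI12 hI13 hI23 a b c
  obtain ⟨g, hg, hgJ⟩ := exists_g J1 J2 hJ12 p q
  obtain ⟨u, hu, h0, hH⟩ := exists_counter hf hg I1 I2 J1 hI12 hgJ hf1 hf2
  have h1 := dense_norm I1 I2 I3 J1 J2 hIcover hI12 hI13 hI23 hJcover hJ12 hd u hu
    (1728 * Complex.I)
  have hs : conj (1728 * Complex.I) = -(1728 * Complex.I) := by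
    rw [map_mul, Complex.conj_I, Complex.conj_ofNat, mul_neg]
  rw [hs, h0, norm_zero] at h1
  have h2 := norm_le_zero_iff.1 h1
  apply hH
  generalize (12 : ℂ) • (u * Pr J1 * star u) = Q at *
  have h3 : (2 * (1728 * Complex.I)) • Hop (Pr I1) (Pr I2) Q =
      Phi (Pr I1) (Pr I2) (1728 * Complex.I) Q - Phi (Pr I1) (Pr I2) (-(1728 * Complex.I)) Q := by
    unfold Phi
    rw [add_sub_add_left_eq_sub, ← sub_smul]
    congr 1; ring
  rw [h2, h0, sub_zero] at h3
  exact (smul_eq_zero.1 h3).resolve_left (by simp)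

end final

end KBH

/-- **(Approximate triunity for Hilbert–Schmidt unitary groups.)**
Let `I = I₁ ∪ I₂ ∪ I₃ = J₁ ∪ J₂` be partitions of a countably infinite index set, and in
`G = U₂(ℓ²(I,ℂ))` (with the Hilbert–Schmidt metric) consider the subgroups `K` (operators
preserving each `H_{I_k}`), `H'` (operators preserving each `H_{J_l}`), and
`B = G^σ` with `σ(u) = JuJ` for the canonical conjugation `J = star`. Then `K B H'` is
dense in `G` iff `min(|J₁|, |J₂|) ≤ 2` or `min(|I₁|, |I₂|, |I₃|) ≤ 1`. -/
theorem dense_KBH_in_U2_iff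
    {I : Type*} [DecidableEq I] [Countable I] [Infinite I]
    (I1 I2 I3 J1 J2 : Set I)
    (hIcover : I1 ∪ I2 ∪ I3 = Set.univ)
    (hI12 : Disjoint I1 I2) (hI13 : Disjoint I1 I3) (hI23 : Disjoint I2 I3)
    (hJcover : J1 ∪ J2 = Set.univ) (hJ12 : Disjoint J1 J2) :
    (∀ u : L2C I →L[ℂ] L2C I, memU2 u → ∀ ε > 0,
      ∃ k b h : L2C I →L[ℂ] L2C I,
        memU2 k ∧ memU2 b ∧ memU2 h ∧
        (∀ x ∈ closedBlock I1, k x ∈ closedBlock I1) ∧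
        (∀ x ∈ closedBlock I2, k x ∈ closedBlock I2) ∧
        (∀ x ∈ closedBlock I3, k x ∈ closedBlock I3) ∧
        (∀ x : L2C I, star (b (star x)) = b x) ∧
        (∀ x ∈ closedBlock J1, h x ∈ closedBlock J1) ∧
        (∀ x ∈ closedBlock J2, h x ∈ closedBlock J2) ∧
        hsNorm (u - k * b * h) < ε) ↔
    (min (Cardinal.mk J1) (Cardinal.mk J2) ≤ 2 ∨
      min (Cardinal.mk I1) (min (Cardinal.mk I2) (Cardinal.mk I3)) ≤ 1) := by
  constructor
  · intro hd
    exact KBH.hard I1 I2 I3 J1 J2 hIcover hI12 hI13 hI23 hJcover hJ12 hd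
  · intro hc u hu ε hε
    exact KBH.easy I1 I2 I3 J1 J2 hIcover hI12 hI13 hI23 hJcover hJ12 hc u hu ε hε

end
end

section
/- Let H be a complex Hilbert space with a Hilbert basis (e_j)_{j∈I}, and let S be the set of all invertible bounded operators s on H such that for every j ∈ I one has s e_j = λ_j e_j for some real λ_j > 0. Then the set {u s v : u, v unitary operators on H, s ∈ S} is dense, with respect to the operator norm, in the group GL(H) of invertible bounded linear operators on H; that is, for every invertible bounded operator g on H and every ε > 0 there exist unitaries u, v on H and s ∈ S with ‖g − u s v‖ < ε. -/
set_option linter.unusedSectionVars false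

section Aux
variable {H : Type*} [NormedAddCommGroup H] [InnerProductSpace ℂ H] [CompleteSpace H]

/-- Positive part of `p - t`. -/
noncomputable def auxPP (p : H →L[ℂ] H) (t : ℝ) : H →L[ℂ] H := cfc (fun x : ℝ => max (x - t) 0) p

/-- Negative part of `p - t`. -/
noncomputable def auxPM (p : H →L[ℂ] H) (t : ℝ) : H →L[ℂ] H := cfc (fun x : ℝ => max (t - x) 0) p

/-- Spectral subspace of `p` for `(-∞, t]`. -/
noncomputable def auxK (p : H →L[ℂ] H) (t : ℝ) : Submodule ℂ H := LinearMap.ker (auxPP p t : H →ₗ[ℂ] H)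

lemma mem_auxK {p : H →L[ℂ] H} {t : ℝ} {x : H} : x ∈ auxK p t ↔ auxPP p t x = 0 := Iff.rfl

lemma sa_inner {a : H →L[ℂ] H} (ha : IsSelfAdjoint a) (x y : H) :
    inner ℂ (a x) y = inner ℂ x (a y) := by
  rw [← ContinuousLinearMap.adjoint_inner_right, ← ContinuousLinearMap.star_eq_adjoint, ha.star_eq]

lemma sa_norm_sq {a : H →L[ℂ] H} (ha : IsSelfAdjoint a) (x : H) :
    ‖a x‖ ^ 2 = (inner ℂ ((a * a) x) x).re := by
  rw [mul_apply_eq_comp, sa_inner ha, ← inner_self_eq_norm_sq (𝕜 := ℂ)]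
  rfl

lemma le_inner {a b : H →L[ℂ] H} (h : a ≤ b) (x : H) :
    (inner ℂ (a x) x).re ≤ (inner ℂ (b x) x).re := by
  have := (ContinuousLinearMap.le_def a b).1 h
  have := this.re_inner_nonneg_left x
  simp only [_root_.sub_apply, inner_sub_left, map_sub] at this
  change 0 ≤ (inner ℂ (b x) x).re - (inner ℂ (a x) x).re at this
  linarith

instance auxK_complete (p : H →L[ℂ] H) (t : ℝ) : CompleteSpace (auxK p t) :=
  (ContinuousLinearMap.isClosed_ker (auxPP p t)).completeSpace_coe

lemma auxK_mono (p : H →L[ℂ] H) {t s : ℝ} (h : t ≤ s) : auxK p t ≤ auxK p s := by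
  intro x hx
  rw [mem_auxK] at *
  have h1 : auxPP p s * auxPP p s ≤ auxPP p s * auxPP p t := by
    unfold auxPP
    rw [← cfc_mul _ _ p, ← cfc_mul _ _ p]
    refine cfc_mono ?_ (by fun_prop) (by fun_prop)
    intro x _
    have : max (x - s) 0 ≤ max (x - t) 0 := max_le_max (by linarith) le_rfl
    exact mul_le_mul_of_nonneg_left this (le_max_right _ _)
  have h2 := le_inner h1 x
  rw [← sa_norm_sq (IsSelfAdjoint.cfc), mul_apply_eq_comp, hx] at h2
  simpa using h2

lemma auxPP_comm (p : H →L[ℂ] H) (hp : IsSelfAdjoint p) (t : ℝ) :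
    p * auxPP p t = auxPP p t * p := by
  have := cfc_commute_cfc (id : ℝ → ℝ) (fun x : ℝ => max (x - t) 0) p
  rw [cfc_id ℝ p] at this
  exact this

lemma auxK_inv (p : H →L[ℂ] H) (hp : IsSelfAdjoint p) (t : ℝ) {x : H} (hx : x ∈ auxK p t) :
    p x ∈ auxK p t := by
  rw [mem_auxK] at *
  rw [← mul_apply_eq_comp, ← auxPP_comm p hp, mul_apply_eq_comp, hx, map_zero]

lemma auxKo_inv (p : H →L[ℂ] H) (hp : IsSelfAdjoint p) (t : ℝ) {x : H} (hx : x ∈ (auxK p t)ᗮ) :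
    p x ∈ (auxK p t)ᗮ := by
  rw [Submodule.mem_orthogonal] at *
  intro u hu
  rw [← sa_inner hp]
  exact hx _ (auxK_inv p hp t hu)

lemma auxPM_of_orth (p : H →L[ℂ] H) (t : ℝ) {x : H} (hx : x ∈ (auxK p t)ᗮ) :
    auxPM p t x = 0 := by
  rw [Submodule.mem_orthogonal] at hx
  have h0 : auxPP p t * auxPM p t = 0 := by
    unfold auxPP auxPM
    rw [← cfc_mul _ _ p, ← cfc_zero ℝ p]
    apply cfc_congr
    intro x _
    rcases le_total x t with h | h
    · simp [max_eq_right (sub_nonpos.2 h)]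
    · simp [max_eq_right (sub_nonpos.2 h)]
  have h1 : auxPM p t (auxPM p t x) ∈ auxK p t := by
    rw [mem_auxK, ← mul_apply_eq_comp, h0]; rfl
  have h2 := hx _ h1
  rw [sa_inner (IsSelfAdjoint.cfc)] at h2
  exact inner_self_eq_zero.1 h2

lemma aux_bound (p : H →L[ℂ] H) (hp : IsSelfAdjoint p) (t d : ℝ) {x : H}
    (hx : x ∈ (auxK p t)ᗮ) (hx' : x ∈ auxK p (t + d)) :
    ‖p x - ((t + d : ℝ) : ℂ) • x‖ ^ 2 ≤ 2 * d ^ 2 * ‖x‖ ^ 2 := by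
  have h1 := auxPM_of_orth p t hx
  rw [mem_auxK] at hx'
  set a : H →L[ℂ] H := cfc (fun y : ℝ => y - (t + d)) p with ha
  have hax : a x = p x - ((t + d : ℝ) : ℂ) • x := by
    rw [ha, cfc_sub _ _ p, cfc_id' ℝ p, cfc_const _ p]
    simp only [Algebra.algebraMap_eq_smul_one, _root_.sub_apply,
      _root_.smul_apply, one_apply_eq_self]
    congr 1
  have hle : a * a ≤ algebraMap ℝ (H →L[ℂ] H) (2 * d ^ 2) + auxPP p (t + d) * auxPP p (t + d)
      + (algebraMap ℝ (H →L[ℂ] H) 2) * (auxPM p t * auxPM p t) := by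
    rw [ha]
    unfold auxPP auxPM
    rw [← cfc_const _ p, ← cfc_const _ p, ← cfc_mul _ _ p, ← cfc_mul _ _ p, ← cfc_mul _ _ p,
      ← cfc_mul _ _ p, ← cfc_add p _ _, ← cfc_add p _ _]
    refine cfc_mono ?_ (by fun_prop) (by fun_prop)
    intro y _
    rcases le_total y t with h | h <;> rcases le_total y (t + d) with h' | h' <;>
    simp [max_eq_right (sub_nonpos.2 h), max_eq_left (sub_nonneg.2 h), max_eq_right (sub_nonpos.2 h'), max_eq_left (sub_nonneg.2 h')] <;> nlinarith [sq_nonneg (d - (t - y)), mul_nonneg (sub_nonneg.2 h) (sub_nonneg.2 h')]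
  have h3 := le_inner hle x
  rw [← sa_norm_sq (IsSelfAdjoint.cfc), hax] at h3
  refine h3.trans (le_of_eq ?_)
  simp only [_root_.add_apply, mul_apply_eq_comp, hx', h1, map_zero, add_zero,
    Algebra.algebraMap_eq_smul_one]
  rw [_root_.smul_apply, one_apply_eq_self, inner_smul_left_eq_smul]
  rw [Complex.real_smul, Complex.re_ofReal_mul]
  congr 1
  exact inner_self_eq_norm_sq (𝕜 := ℂ) x

/-- finite spectral partition -/
lemma aux_partition (p : H →L[ℂ] H) (hp : 0 ≤ p) (hu : IsUnit p) (d : ℝ) (hd : 0 < d) :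
    ∃ (N : ℕ) (V : Fin N → Submodule ℂ H) (c : Fin N → ℝ),
      (∀ k, IsClosed (V k : Set H)) ∧
      OrthogonalFamily ℂ (fun k => V k) (fun k => (V k).subtypeₗᵢ) ∧
      (⨆ k, V k) = ⊤ ∧ (∀ k, 0 < c k) ∧ (∀ k, ∀ x ∈ V k, p x ∈ V k) ∧
      ∀ k, ∀ x ∈ V k, ‖p x - (c k : ℂ) • x‖ ^ 2 ≤ 2 * d ^ 2 * ‖x‖ ^ 2 := by
  have hsa : IsSelfAdjoint p := IsSelfAdjoint.of_nonneg hp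
  obtain ⟨N, hN⟩ := exists_nat_ge (‖p‖ / d)
  have hN' : ‖p‖ ≤ N * d := by rwa [div_le_iff₀ hd] at hN
  set K : ℕ → Submodule ℂ H := fun k => auxK p (k * d) with hK
  have hmono : Monotone K := fun i j hij => auxK_mono p (by gcongr)
  have hK0 : K 0 = ⊥ := by
    have : auxPP p 0 = p := by
      unfold auxPP
      conv_rhs => rw [← cfc_id ℝ p]
      apply cfc_congr
      intro x hx
      have := spectrum_nonneg_of_nonneg hp hx
      simp [this]
    rw [eq_bot_iff]
    intro x hx
    have hx : auxPP p (((0 : ℕ) : ℝ) * d) x = 0 := hx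
    simp only [Nat.cast_zero, zero_mul, this] at hx
    obtain ⟨u, rfl⟩ := hu
    have : ((u⁻¹ : (H →L[ℂ] H)ˣ) * u : H →L[ℂ] H) x = x := by simp
    rw [mul_apply_eq_comp, hx, map_zero] at this
    simp [← this]
  have hKN : K N = ⊤ := by
    have : auxPP p (N * d) = 0 := by
      unfold auxPP
      rw [← cfc_zero ℝ p]
      apply cfc_congr
      intro x hx
      have h1 : ‖x‖ ≤ ‖p‖ := by
        have := spectrum.norm_le_norm_mul_of_mem hx
        refine this.trans ?_
        exact mul_le_of_le_one_right (norm_nonneg _) (ContinuousLinearMap.norm_id_le)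
      have := (le_abs_self x).trans h1
      simp; linarith
    rw [eq_top_iff]
    intro x _
    change auxPP p _ x = 0
    simp [this]
  refine ⟨N, fun k => (K k)ᗮ ⊓ K (k + 1), fun k => k * d + d, ?_, ?_, ?_, ?_, ?_, ?_⟩
  · intro k
    exact (Submodule.isClosed_orthogonal _).inter (ContinuousLinearMap.isClosed_ker (auxPP p _))
  · apply OrthogonalFamily.of_pairwise
    have key : ∀ i j : ℕ, i < j → ((K i)ᗮ ⊓ K (i + 1)) ⟂ ((K j)ᗮ ⊓ K (j + 1)) := by
      intro i j hij
      have h1 : (K j) ⟂ (K j)ᗮ := Submodule.isOrtho_orthogonal_right _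
      exact h1.mono (inf_le_right.trans (hmono hij)) inf_le_left
    intro i j hij
    rcases lt_or_gt_of_ne (fun h => hij (Fin.ext h)) with h | h
    · exact key _ _ h
    · exact (key _ _ h).symm
  · have : ∀ n, n ≤ N → K n ≤ ⨆ k : Fin N, (K k)ᗮ ⊓ K (k + 1) := by
      intro n
      induction n with
      | zero => intro _; simp [hK0]
      | succ n ih =>
        intro hn
        have : (K n).HasOrthogonalProjection := by
          have : CompleteSpace (K n) := auxK_complete p _
          infer_instance
        rw [← Submodule.sup_orthogonal_inf_of_hasOrthogonalProjection (hmono (Nat.le_succ n))]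
        refine sup_le (ih (by omega)) ?_
        exact le_iSup (fun k : Fin N => (K k)ᗮ ⊓ K (k + 1)) ⟨n, hn⟩
    rw [eq_top_iff, ← hKN]
    exact this N le_rfl
  · intro k; positivity
  · intro k x hx
    exact ⟨auxKo_inv p hsa _ hx.1, auxK_inv p hsa _ hx.2⟩
  · intro k x hx
    apply aux_bound p hsa _ _ hx.1
    have := hx.2
    simp only [hK, Nat.cast_add, Nat.cast_one, add_mul, one_mul] at this
    exact this

/-- diagonalizable approximation -/
lemma aux_diag.{u} {H : Type u} [NormedAddCommGroup H] [InnerProductSpace ℂ H] [CompleteSpace H]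
    (p : H →L[ℂ] H) (hp : 0 ≤ p) (hu : IsUnit p) (d : ℝ) (hd : 0 < d) :
    ∃ (κ : Type u) (b : HilbertBasis κ ℂ H) (q : H →L[ℂ] H), IsUnit q ∧
      (∀ j, ∃ lam : ℝ, 0 < lam ∧ q (b j) = (lam : ℂ) • b j) ∧ ‖p - q‖ ≤ 2 * d := by
  obtain ⟨N, V, c, hcl, ho, htop, hc, hinv, hb⟩ := aux_partition p hp hu d hd
  have : ∀ k, CompleteSpace (V k) := fun k => (hcl k).completeSpace_coe
  have hdec : ∀ x : H, ∃ y : ∀ k, V k, x = ∑ k, (y k : H) := by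
    intro x
    have : x ∈ ⨆ k, V k := by rw [htop]; trivial
    have h2 : x ∈ ⨆ k ∈ (Finset.univ : Finset (Fin N)), V k := by simpa using this
    obtain ⟨μ, hμ⟩ := (Submodule.mem_iSup_finset_iff_exists_sum V x).1 h2
    exact ⟨μ, hμ.symm⟩
  let Q : (Fin N → ℂ) → (H →L[ℂ] H) := fun a => ∑ k, a k • (V k).starProjection
  have hQ : ∀ a k x, x ∈ V k → Q a x = a k • x := by
    intro a k x hx
    simp only [Q, _root_.sum_apply, _root_.smul_apply]
    rw [Finset.sum_eq_single k]
    · rw [Submodule.starProjection_eq_self_iff.2 hx]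
    · intro j _ hj
      rw [(Submodule.starProjection_apply_eq_zero_iff (V j)).2, smul_zero]
      exact (ho.isOrtho hj.symm) hx
    · simp
  have hQQ : ∀ a a' : Fin N → ℂ, (∀ k, a k * a' k = 1) → Q a * Q a' = 1 := by
    intro a a' h
    ext x
    obtain ⟨y, rfl⟩ := hdec x
    simp only [map_sum]
    refine Finset.sum_congr rfl fun k _ => ?_
    rw [mul_apply_eq_comp, hQ a' k _ (y k).2, map_smul, hQ a k _ (y k).2, smul_smul,
      mul_comm, h, one_smul, one_apply_eq_self]
  have hcne : ∀ k, (c k : ℂ) ≠ 0 := fun k => by exact_mod_cast (hc k).ne'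
  choose w bw hbw using fun k => exists_hilbertBasis ℂ (V k)
  have hon := ho.orthonormal_sigma_orthonormal (fun k => (bw k).orthonormal)
  have hsp : ⊤ ≤ (Submodule.span ℂ (Set.range
      fun a : Σ k, w k => (V a.1).subtypeₗᵢ (bw a.1 a.2))).topologicalClosure := by
    rw [← htop]
    refine iSup_le fun k x hx => ?_
    have h1 : (⟨x, hx⟩ : V k) ∈ (Submodule.span ℂ (Set.range (bw k))).topologicalClosure := by
      rw [(bw k).dense_span]; trivial
    have h2 := image_closure_subset_closure_image (V k).subtypeL.continuous
      (Set.mem_image_of_mem _ h1)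
    refine closure_mono ?_ h2
    rintro _ ⟨z, hz, rfl⟩
    have h3 := Submodule.mem_map_of_mem (f := (V k).subtype) hz
    rw [Submodule.map_span] at h3
    refine Submodule.span_mono ?_ h3
    rintro _ ⟨_, ⟨i, rfl⟩, rfl⟩
    exact ⟨⟨k, i⟩, rfl⟩
  refine ⟨Σ k, (w k : Type _), HilbertBasis.mk hon hsp, Q (fun k => c k), ?_, ?_, ?_⟩
  · exact ⟨⟨Q (fun k => c k), Q (fun k => (c k : ℂ)⁻¹), hQQ _ _ fun k => mul_inv_cancel₀ (hcne k),
      hQQ _ _ fun k => inv_mul_cancel₀ (hcne k)⟩, rfl⟩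
  · rintro ⟨k, i⟩
    refine ⟨c k, hc k, ?_⟩
    rw [HilbertBasis.coe_mk]
    exact hQ _ k _ (bw k i).2
  · refine ContinuousLinearMap.opNorm_le_bound _ (by positivity) fun x => ?_
    obtain ⟨y, rfl⟩ := hdec x
    have hz : ∀ k, p (y k) - (c k : ℂ) • (y k : H) ∈ V k := fun k =>
      Submodule.sub_mem _ (hinv k _ (y k).2) (Submodule.smul_mem _ _ (y k).2)
    have e1 : (p - Q (fun k => c k)) (∑ k, (y k : H)) =
        ∑ k, (V k).subtypeₗᵢ (⟨_, hz k⟩ : V k) := by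
      rw [map_sum]
      refine Finset.sum_congr rfl fun k _ => ?_
      rw [_root_.sub_apply, hQ _ k _ (y k).2]
      rfl
    have e2 := ho.norm_sum (fun k => (⟨_, hz k⟩ : V k)) Finset.univ
    have e3 : ‖∑ k, (y k : H)‖ ^ 2 = ∑ k, ‖y k‖ ^ 2 := ho.norm_sum y Finset.univ
    rw [e1]
    refine abs_le_of_sq_le_sq' ?_ (by positivity) |>.2
    rw [e2, mul_pow, e3, Finset.mul_sum]
    refine Finset.sum_le_sum fun k _ => ?_
    refine (hb k _ (y k).2).trans ?_
    change 2 * d ^ 2 * ‖y k‖ ^ 2 ≤ _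
    nlinarith [mul_nonneg (sq_nonneg d) (sq_nonneg ‖y k‖)]

end Aux

section Card
universe u1 u2 u3
variable {H : Type u3} [NormedAddCommGroup H] [InnerProductSpace ℂ H] [CompleteSpace H]

lemma hb_support_countable {κ : Type*} (b : HilbertBasis κ ℂ H) (x : H) :
    {i | inner ℂ (b i) x ≠ 0}.Countable := by
  have h := b.summable_inner_mul_inner x x
  refine h.countable_support.mono fun i hi => ?_
  have hi : inner ℂ (b i) x ≠ 0 := hi
  have : inner ℂ x (b i) ≠ 0 := by
    rw [← inner_conj_symm]
    exact fun h => hi ((map_eq_zero _).1 h)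
  exact mul_ne_zero this hi

lemma hb_exists_ne {κ : Type*} (b : HilbertBasis κ ℂ H) (x : H) (hx : x ≠ 0) :
    ∃ i, inner ℂ x (b i) ≠ 0 := by
  by_contra! h
  apply hx
  have := b.tsum_inner_mul_inner x x
  simp only [h, zero_mul, tsum_zero] at this
  exact inner_self_eq_zero.1 this.symm

lemma hb_card_le {κ : Type u1} {ι : Type u2} (b : HilbertBasis κ ℂ H) (e : HilbertBasis ι ℂ H)
    [Infinite ι] : Cardinal.lift.{u2} (Cardinal.mk κ) ≤ Cardinal.lift.{u1} (Cardinal.mk ι) := by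
  have hne : ∀ i, b i ≠ 0 := fun i => b.orthonormal.ne_zero i
  choose f hf using fun i => hb_exists_ne e (b i) (hne i)
  have hc : ∀ j, ∃ g : κ → ℕ, Set.InjOn g {i | inner ℂ (b i) (e j) ≠ 0} := fun j =>
    Set.countable_iff_exists_injOn.1 (hb_support_countable b (e j))
  choose g hg using hc
  have hinj : Function.Injective (fun i => (f i, g (f i) i)) := by
    intro i i' h
    simp only [Prod.mk.injEq] at h
    obtain ⟨h1, h2⟩ := h
    refine hg (f i) (hf i) ?_ ?_
    · have := hf i'; rw [← h1] at this; exact this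
    · rw [h2, h1]
  have := Cardinal.mk_le_of_injective (α := ULift.{u2} κ) (β := ULift.{u1} (ι × ℕ))
    (f := fun i => ⟨(f i.down, g (f i.down) i.down)⟩) (by
      rintro ⟨a⟩ ⟨b⟩ h
      simp only [ULift.up.injEq] at h
      exact congrArg _ (hinj h))
  simp only [Cardinal.mk_uLift] at this
  simpa [Cardinal.mul_aleph0_eq (Cardinal.aleph0_le_mk ι)] using this

lemma hb_infinite {κ : Type u1} {ι : Type u2} (b : HilbertBasis κ ℂ H) (e : HilbertBasis ι ℂ H)
    [Finite ι] : Finite κ := by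
  cases nonempty_fintype ι
  have : FiniteDimensional ℂ H := e.toOrthonormalBasis.toBasis.finiteDimensional_of_finite
  exact b.orthonormal.linearIndependent.finite

lemma hb_equiv {κ : Type u1} {ι : Type u2} (b : HilbertBasis κ ℂ H) (e : HilbertBasis ι ℂ H) :
    Nonempty (ι ≃ κ) := by
  rcases finite_or_infinite ι with h | h
  · have := hb_infinite b e
    cases nonempty_fintype ι
    cases nonempty_fintype κ
    exact ⟨e.toOrthonormalBasis.toBasis.indexEquiv b.toOrthonormalBasis.toBasis⟩
  · have : Infinite κ := by
      by_contra hk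
      rw [not_infinite_iff_finite] at hk
      exact (hb_infinite e b).not_infinite h
    exact Cardinal.lift_mk_eq'.1 (le_antisymm (hb_card_le e b) (hb_card_le b e))

lemma hb_map {κ : Type u1} {ι : Type u2} (b : HilbertBasis κ ℂ H) (e : HilbertBasis ι ℂ H) :
    ∃ (σ : ι ≃ κ) (U : H ≃ₗᵢ[ℂ] H), ∀ j, U (b (σ j)) = e j := by
  classical
  obtain ⟨σ⟩ := hb_equiv b e
  have hon : Orthonormal ℂ (b ∘ σ) := b.orthonormal.comp σ σ.injective
  have hsp : ⊤ ≤ (Submodule.span ℂ (Set.range (b ∘ σ))).topologicalClosure := by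
    rw [σ.surjective.range_comp, b.dense_span]
  let b' := HilbertBasis.mk hon hsp
  have hb' : ⇑b' = b ∘ σ := HilbertBasis.coe_mk hon hsp
  refine ⟨σ, b'.repr.trans e.repr.symm, fun j => ?_⟩
  have : b (σ j) = b' j := by rw [hb']; rfl
  rw [this, LinearIsometryEquiv.trans_apply, b'.repr_self, e.repr_symm_single]

end Card

lemma aux_polar {H : Type*} [NormedAddCommGroup H] [InnerProductSpace ℂ H] [CompleteSpace H]
    (g : H →L[ℂ] H) (hg : IsUnit g) : ∃ w p : H →L[ℂ] H,
      w ∈ unitary (H →L[ℂ] H) ∧ 0 ≤ p ∧ IsUnit p ∧ g = w * p := by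
  have hpp := CFC.abs_mul_abs g
  have hp0 := CFC.abs_nonneg g
  set p := CFC.abs g
  have hpu : IsUnit p := by
    have : IsUnit (p * p) := by rw [hpp]; exact hg.star.mul hg
    exact ((Commute.refl p).isUnit_mul_iff.1 this).1
  obtain ⟨P, hP⟩ := hpu
  obtain ⟨G, rfl⟩ := hg
  have hsa : star p = p := (IsSelfAdjoint.of_nonneg hp0).star_eq
  have hPs : star P = P := Units.ext (by rw [Units.coe_star, hP, hsa])
  have hGP : star G * G = P * P := Units.ext (by push_cast; rw [hP, hpp]; rfl)
  have hw : star (G * P⁻¹) * (G * P⁻¹) = 1 := by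
    rw [star_mul, star_inv, hPs, mul_assoc, ← mul_assoc (star G), hGP]; group
  have hw' : (G * P⁻¹) * star (G * P⁻¹) = 1 := mul_eq_one_comm.1 hw
  refine ⟨((G * P⁻¹ : (H →L[ℂ] H)ˣ) : H →L[ℂ] H), p, ?_, hp0, ⟨P, hP⟩, ?_⟩
  · rw [Unitary.mem_iff]
    exact ⟨congrArg Units.val hw, congrArg Units.val hw'⟩
  · rw [← hP, ← Units.val_mul]; simp

/-- **(Approximate Cartan decomposition for `GL(H)`.)** Let `H` be a complex Hilbert
space with a Hilbert basis `(e_j)_{j ∈ I}` and let `S` be the set of invertible bounded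
operators that are diagonal with positive real eigenvalues in this basis. Then
`U(H) · S · U(H)` is dense in `GL(H)` for the operator norm. -/
theorem dense_unitary_posDiag_unitary
    {ι : Type*} {H : Type*} [NormedAddCommGroup H] [InnerProductSpace ℂ H]
    [CompleteSpace H] (e : HilbertBasis ι ℂ H) :
    ∀ g : H →L[ℂ] H, IsUnit g → ∀ ε > 0,
      ∃ u v s : H →L[ℂ] H,
        u ∈ unitary (H →L[ℂ] H) ∧ v ∈ unitary (H →L[ℂ] H) ∧
        IsUnit s ∧ (∀ j : ι, ∃ lam : ℝ, 0 < lam ∧ s (e j) = (lam : ℂ) • e j) ∧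
        ‖g - u * s * v‖ < ε := by
  intro g hg ε hε
  obtain ⟨w, p, hw, hp, hpu, rfl⟩ := aux_polar g hg
  obtain ⟨κ, b, q, hq, hqb, hpq⟩ := aux_diag p hp hpu (ε / 4) (by positivity)
  obtain ⟨σ, U, hU⟩ := hb_map b e
  have hv := (Unitary.linearIsometryEquiv.symm U).2
  have hvU : ∀ x, (Unitary.linearIsometryEquiv.symm U : H →L[ℂ] H) x = U x := fun x => rfl
  set v : H →L[ℂ] H := (Unitary.linearIsometryEquiv.symm U : H →L[ℂ] H)
  have h1 : star v * v = 1 := (Unitary.mem_iff.1 hv).1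
  have h2 : v * star v = 1 := (Unitary.mem_iff.1 hv).2
  have hvu : IsUnit v := ⟨⟨v, star v, h2, h1⟩, rfl⟩
  refine ⟨w * star v, v, v * q * star v, mul_mem hw (Unitary.star_mem hv), hv,
    (hvu.mul hq).mul hvu.star, fun j => ?_, ?_⟩
  · obtain ⟨lam, hl, h⟩ := hqb (σ j)
    refine ⟨lam, hl, ?_⟩
    have h3 : star v (e j) = b (σ j) := by
      rw [← hU j, ← hvU, ← mul_apply_eq_comp, h1]; rfl
    rw [mul_apply_eq_comp, mul_apply_eq_comp, h3, h, map_smul, hvU, hU]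
  · have : w * star v * (v * q * star v) * v = w * q := by
      calc _ = w * (star v * v) * q * (star v * v) := by noncomm_ring
        _ = w * q := by rw [h1]; simp
    rw [this, ← mul_sub, CStarRing.norm_mem_unitary_mul _ hw]
    linarith
end

section
/- Let H be a complex Hilbert space with a Hilbert basis (e_i)_{i∈I}. Call a bounded operator T on H Hilbert–Schmidt if ∑_{i∈I} ‖T e_i‖² < ∞, with Hilbert–Schmidt norm ‖T‖₂ = (∑_{i∈I} ‖T e_i‖²)^{1/2}. Let U₂(H) be the group of unitary operators u on H with u − 1 Hilbert–Schmidt, and let A_ℝ be the set of Hilbert–Schmidt operators a on H such that a e_i ∈ ℝ·e_i for every i ∈ I. Then for every Hilbert–Schmidt operator x on H and every ε > 0 there exist u, v ∈ U₂(H) and a ∈ A_ℝ with ‖x − u a v‖₂ < ε; that is, the set U₂(H) · A_ℝ · U₂(H) is dense in the space of Hilbert–Schmidt operators with respect to the Hilbert–Schmidt norm. -/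
noncomputable section

/-- A bounded operator `T` on a complex Hilbert space with Hilbert basis `(e_i)` is
Hilbert–Schmidt if `∑ᵢ ‖T eᵢ‖² < ∞`. -/
def IsHilbertSchmidtWrt {ι : Type*} {H : Type*} [NormedAddCommGroup H]
    [InnerProductSpace ℂ H] [CompleteSpace H] (e : HilbertBasis ι ℂ H)
    (T : H →L[ℂ] H) : Prop :=
  Summable fun i : ι => ‖T (e i)‖ ^ 2

/-- The Hilbert–Schmidt norm `‖T‖₂ = (∑ᵢ ‖T eᵢ‖²)^{1/2}` with respect to a Hilbert
basis `(e_i)`. -/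
def hsNormWrt {ι : Type*} {H : Type*} [NormedAddCommGroup H]
    [InnerProductSpace ℂ H] [CompleteSpace H] (e : HilbertBasis ι ℂ H)
    (T : H →L[ℂ] H) : ℝ :=
  Real.sqrt (∑' i : ι, ‖T (e i)‖ ^ 2)

open ContinuousLinearMap Filter Topology in
lemma aux_svd {κ : Type*} [Fintype κ] [DecidableEq κ]
    (T : EuclideanSpace ℂ κ →L[ℂ] EuclideanSpace ℂ κ) :
    ∃ (b c : OrthonormalBasis κ ℂ (EuclideanSpace ℂ κ)) (s : κ → ℝ),
      ∀ j, T (c j) = (s j : ℂ) • b j := by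
  have hS : ((adjoint T ∘L T : EuclideanSpace ℂ κ →L[ℂ] EuclideanSpace ℂ κ) :
      EuclideanSpace ℂ κ →ₗ[ℂ] EuclideanSpace ℂ κ).IsSymmetric := by
    intro x y
    simp [adjoint_inner_left, adjoint_inner_right]
  have hn : Module.finrank ℂ (EuclideanSpace ℂ κ) = Fintype.card κ := by simp
  let c := (hS.eigenvectorBasis hn).reindex (Fintype.equivFin κ).symm
  let μ : κ → ℝ := fun j => hS.eigenvalues hn (Fintype.equivFin κ j)
  have hc : ∀ j, adjoint T (T (c j)) = (μ j : ℂ) • c j := by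
    intro j
    have := hS.apply_eigenvectorBasis hn (Fintype.equivFin κ j)
    simp only [c, μ, OrthonormalBasis.reindex_apply, Equiv.symm_symm]
    exact this
  have hinner : ∀ i j, i ≠ j → inner ℂ (T (c i)) (T (c j)) = 0 := by
    intro i j hij
    rw [← adjoint_inner_right, hc, inner_smul_right, c.inner_eq_zero hij, mul_zero]
  let s : κ → ℝ := fun j => ‖T (c j)‖
  let w : κ → EuclideanSpace ℂ κ := fun j => ((s j : ℂ)⁻¹) • T (c j)
  have hw : Orthonormal ℂ (Set.domRestrict {j | s j ≠ 0} w) := by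
    constructor
    · rintro ⟨j, hj⟩
      have hj' : ‖T (c j)‖ ≠ 0 := hj
      simp only [Set.domRestrict_apply, w, norm_smul, s, norm_inv, Complex.norm_real, norm_norm]
      exact inv_mul_cancel₀ hj'
    · rintro ⟨i, hi⟩ ⟨j, hj⟩ hij
      have : i ≠ j := fun h => hij (Subtype.ext h)
      simp [w, inner_smul_left, inner_smul_right, hinner i j this]
  obtain ⟨b, hb⟩ := hw.exists_orthonormalBasis_extension_of_card_eq hn
  refine ⟨b, c, s, fun j => ?_⟩
  by_cases hj : s j = 0
  · have : T (c j) = 0 := norm_eq_zero.mp hj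
    simp [this, hj]
  · rw [hb j hj]
    have : (s j : ℂ) ≠ 0 := by exact_mod_cast hj
    simp only [w]
    rw [smul_smul, mul_inv_cancel₀ this, one_smul]

open ContinuousLinearMap in
lemma aux_svd' {κ : Type*} [Fintype κ] [DecidableEq κ]
    (T : EuclideanSpace ℂ κ →L[ℂ] EuclideanSpace ℂ κ) :
    ∃ U D V : EuclideanSpace ℂ κ →L[ℂ] EuclideanSpace ℂ κ,
      (adjoint U ∘L U = 1 ∧ U ∘L adjoint U = 1) ∧ (adjoint V ∘L V = 1 ∧ V ∘L adjoint V = 1) ∧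
      (∀ j, ∃ r : ℝ, D (EuclideanSpace.basisFun κ ℂ j) = (r : ℂ) • EuclideanSpace.basisFun κ ℂ j) ∧
      T = U ∘L D ∘L V := by
  obtain ⟨b, c, s, h⟩ := aux_svd T
  have key : ∀ W : EuclideanSpace ℂ κ ≃ₗᵢ[ℂ] EuclideanSpace ℂ κ,
      adjoint (W : EuclideanSpace ℂ κ →L[ℂ] EuclideanSpace ℂ κ) ∘L
        (W : EuclideanSpace ℂ κ →L[ℂ] EuclideanSpace ℂ κ) = 1 ∧
      (W : EuclideanSpace ℂ κ →L[ℂ] EuclideanSpace ℂ κ) ∘L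
        adjoint (W : EuclideanSpace ℂ κ →L[ℂ] EuclideanSpace ℂ κ) = 1 := by
    intro W
    have := W.adjoint_eq_symm
    rw [this]
    constructor <;> ext1 x <;> simp
  let D : EuclideanSpace ℂ κ →L[ℂ] EuclideanSpace ℂ κ := LinearMap.toContinuousLinearMap
    ((EuclideanSpace.basisFun κ ℂ).toBasis.constr ℂ
      (fun j => (s j : ℂ) • EuclideanSpace.basisFun κ ℂ j))
  have hD : ∀ j, D (EuclideanSpace.basisFun κ ℂ j)
      = (s j : ℂ) • EuclideanSpace.basisFun κ ℂ j := by
    intro j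
    have := (EuclideanSpace.basisFun κ ℂ).toBasis.constr_basis ℂ
      (fun j => (s j : ℂ) • EuclideanSpace.basisFun κ ℂ j) j
    rw [OrthonormalBasis.coe_toBasis] at this
    exact this
  refine ⟨(b.repr.symm : _ ≃ₗᵢ[ℂ] _), D, (c.repr : _ ≃ₗᵢ[ℂ] _), key _, key _,
    fun j => ⟨s j, hD j⟩, ?_⟩
  have : (T : EuclideanSpace ℂ κ →ₗ[ℂ] EuclideanSpace ℂ κ) =
    (((b.repr.symm : EuclideanSpace ℂ κ →L[ℂ] EuclideanSpace ℂ κ) ∘L D ∘L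
      (c.repr : EuclideanSpace ℂ κ →L[ℂ] EuclideanSpace ℂ κ) :
        EuclideanSpace ℂ κ →L[ℂ] EuclideanSpace ℂ κ) :
        EuclideanSpace ℂ κ →ₗ[ℂ] EuclideanSpace ℂ κ) := by
    refine c.toBasis.ext fun j => ?_
    have h2 := hD j
    rw [EuclideanSpace.basisFun_apply] at h2
    simp [-Complex.coe_smul, -Complex.real_smul, h, h2]
  exact ContinuousLinearMap.coe_injective this

section
open ContinuousLinearMap Filter Topology
variable {ι : Type*} {H : Type*} [NormedAddCommGroup H] [InnerProductSpace ℂ H]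
    [CompleteSpace H]

lemma aux_J (e : HilbertBasis ι ℂ H) (F : Finset ι) :
    ∃ J : EuclideanSpace ℂ F →L[ℂ] H, adjoint J ∘L J = 1 ∧
      (∀ j : F, J (EuclideanSpace.basisFun F ℂ j) = e j) ∧
      (∀ j : F, adjoint J (e j) = EuclideanSpace.basisFun F ℂ j) ∧
      (∀ i, i ∉ F → adjoint J (e i) = 0) ∧
      (∀ y, J (adjoint J y) = ∑ i ∈ F, e.repr y i • e i) ∧
      (∀ y, ‖J (adjoint J y)‖ ≤ ‖y‖) := by
  classical
  let B := EuclideanSpace.basisFun F ℂ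
  let f : EuclideanSpace ℂ F →ₗ[ℂ] H := B.toBasis.constr ℂ (fun j => e j)
  have hf : ∀ j, f (B j) = e j := by
    intro j
    have := B.toBasis.constr_basis ℂ (fun j : F => e j) j
    rw [OrthonormalBasis.coe_toBasis] at this
    exact this
  have hB : Orthonormal ℂ B.toBasis := by simpa using B.orthonormal
  have hfo : Orthonormal ℂ (f ∘ B.toBasis) := by
    have : (f ∘ B.toBasis) = e ∘ ((↑) : F → ι) := by
      ext j; simp [hf]
    rw [this]
    exact e.orthonormal.comp _ Subtype.val_injective
  let g := f.isometryOfOrthonormal hB hfo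
  let J : EuclideanSpace ℂ F →L[ℂ] H := g.toContinuousLinearMap
  have hJn : ∀ z, ‖J z‖ = ‖z‖ := g.norm_map
  have hJJ : adjoint J ∘L J = 1 := (norm_map_iff_adjoint_comp_self J).mp hJn
  have hJ : ∀ j, J (B j) = e j := hf
  have hJa : ∀ j : F, adjoint J (e j) = B j := by
    intro j
    rw [← hJ j]
    exact congrArg (fun A => A (B j)) hJJ
  refine ⟨J, hJJ, hJ, hJa, ?_, ?_, ?_⟩
  · intro i hi
    rw [← B.sum_repr' (adjoint J (e i))]
    refine Finset.sum_eq_zero fun j _ => ?_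
    rw [adjoint_inner_right, hJ, e.orthonormal.inner_eq_zero, zero_smul]
    rintro rfl
    exact hi j.2
  · intro y
    rw [← B.sum_repr' (adjoint J y), map_sum, ← Finset.sum_coe_sort F]
    refine Finset.sum_congr rfl fun j _ => ?_
    rw [map_smul, adjoint_inner_right, hJ, e.repr_apply_apply]
  · intro y
    rw [hJn]
    have h1 : ‖J‖ ≤ 1 := J.opNorm_le_bound zero_le_one (fun z => by rw [hJn, one_mul])
    calc ‖adjoint J y‖ ≤ ‖adjoint J‖ * ‖y‖ := le_opNorm _ _
      _ = ‖J‖ * ‖y‖ := by rw [LinearIsometryEquiv.norm_map]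
      _ ≤ 1 * ‖y‖ := by gcongr
      _ = ‖y‖ := one_mul _

lemma aux_ext {W : Type*} [NormedAddCommGroup W] [InnerProductSpace ℂ W] [CompleteSpace W]
    (J : W →L[ℂ] H) (hJ : adjoint J ∘L J = 1) (U : W →L[ℂ] W)
    (hU : adjoint U ∘L U = 1 ∧ U ∘L adjoint U = 1) :
    (1 + J ∘L (U - 1) ∘L adjoint J) ∈ unitary (H →L[ℂ] H) := by
  have j1 : ∀ z, adjoint J (J z) = z := fun z => congrArg (fun A => A z) hJ
  have u1 : ∀ z, adjoint U (U z) = z := fun z => congrArg (fun A => A z) hU.1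
  have u2 : ∀ z, U (adjoint U z) = z := fun z => congrArg (fun A => A z) hU.2
  have hs : star (1 + J ∘L (U - 1) ∘L adjoint J) = 1 + J ∘L (adjoint U - 1) ∘L adjoint J := by
    rw [star_add, star_one]
    congr 1
    rw [star_eq_adjoint, adjoint_comp, adjoint_comp, adjoint_adjoint, map_sub]
    have : adjoint (1 : W →L[ℂ] W) = 1 := by rw [← star_eq_adjoint, star_one]
    rw [this]
    rfl
  rw [Unitary.mem_iff, hs]
  constructor <;> ext y <;> simp [j1, u1, u2] <;> abel

lemma aux_fin (e : HilbertBasis ι ℂ H) (F : Finset ι) (T : H →L[ℂ] H)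
    (h : ∀ i, i ∉ F → T (e i) = 0) : IsHilbertSchmidtWrt e T := by
  unfold IsHilbertSchmidtWrt
  exact summable_of_ne_finset_zero (s := F) fun i hi => by simp [h i hi]

end

/-- **(Approximate Cartan decomposition for Hilbert–Schmidt operators.)** Let `H` be a
complex Hilbert space with a Hilbert basis `(e_i)_{i ∈ ι}`, let `U₂(H)` be the unitaries
`u` with `u − 1` Hilbert–Schmidt, and let `A_ℝ` be the Hilbert–Schmidt operators that are
diagonal with real entries in this basis. Then `U₂(H) · A_ℝ · U₂(H)` is dense in the
Hilbert–Schmidt operators for the Hilbert–Schmidt norm. -/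
theorem dense_U2_realDiag_U2_in_hilbertSchmidt
    {ι : Type*} {H : Type*} [NormedAddCommGroup H] [InnerProductSpace ℂ H]
    [CompleteSpace H] (e : HilbertBasis ι ℂ H) :
    ∀ x : H →L[ℂ] H, IsHilbertSchmidtWrt e x → ∀ ε > 0,
      ∃ u v a : H →L[ℂ] H,
        (u ∈ unitary (H →L[ℂ] H) ∧ IsHilbertSchmidtWrt e (u - 1)) ∧
        (v ∈ unitary (H →L[ℂ] H) ∧ IsHilbertSchmidtWrt e (v - 1)) ∧
        IsHilbertSchmidtWrt e a ∧
        (∀ i : ι, ∃ r : ℝ, a (e i) = (r : ℂ) • e i) ∧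
        hsNormWrt e (x - u * a * v) < ε := by
  intro x hx ε hε
  open ContinuousLinearMap Filter Topology in
  classical
  choose J hJJ hJ hJa hJ0 hQ hQn using aux_J e
  have hlim : Tendsto (fun F : Finset ι => ∑' i, ‖x (e i) - J F (adjoint (J F)
      (x (J F (adjoint (J F) (e i)))))‖ ^ 2) atTop (𝓝 (∑' _ : ι, (0 : ℝ))) := by
    refine tendsto_tsum_of_dominated_convergence (bound := fun i => (2 * ‖x (e i)‖) ^ 2) ?_ ?_ ?_
    · simp_rw [mul_pow]
      exact Summable.mul_left _ hx
    · intro i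
      have h1 : Tendsto (fun F : Finset ι => J F (adjoint (J F) (x (e i)))) atTop
          (𝓝 (x (e i))) := by
        simp_rw [hQ]
        exact e.hasSum_repr (x (e i))
      have h2 : Tendsto (fun F : Finset ι => ‖x (e i) - J F (adjoint (J F) (x (e i)))‖ ^ 2) atTop
          (𝓝 0) := by
        have := ((tendsto_const_nhds (x := x (e i))).sub h1).norm.pow 2
        simpa using this
      refine h2.congr' ?_
      filter_upwards [eventually_ge_atTop {i}] with F hF
      have hi : i ∈ F := hF (Finset.mem_singleton_self i)
      rw [hJa F ⟨i, hi⟩, hJ F ⟨i, hi⟩]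
    · refine Eventually.of_forall fun F i => ?_
      rw [Real.norm_of_nonneg (by positivity)]
      refine pow_le_pow_left₀ (norm_nonneg _) ?_ 2
      refine (norm_sub_le _ _).trans ?_
      rw [two_mul]
      gcongr
      refine (hQn F _).trans ?_
      by_cases hi : i ∈ F
      · rw [hJa F ⟨i, hi⟩, hJ F ⟨i, hi⟩]
      · rw [hJ0 F i hi]; simp
  rw [tsum_zero] at hlim
  obtain ⟨F, hF⟩ := (hlim.eventually (gt_mem_nhds (show (0 : ℝ) < ε ^ 2 by positivity))).exists
  obtain ⟨U, D, V, hU, hV, hD, hT⟩ := aux_svd' (adjoint (J F) ∘L x ∘L J F)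
  have j1 : ∀ z, adjoint (J F) (J F z) = z := fun z => congrArg (fun A => A z) (hJJ F)
  refine ⟨1 + J F ∘L (U - 1) ∘L adjoint (J F), 1 + J F ∘L (V - 1) ∘L adjoint (J F),
    J F ∘L D ∘L adjoint (J F), ⟨aux_ext _ (hJJ F) U hU, ?_⟩, ⟨aux_ext _ (hJJ F) V hV, ?_⟩,
    ?_, ?_, ?_⟩
  · refine aux_fin e F _ fun i hi => ?_
    simp [hJ0 F i hi]
  · refine aux_fin e F _ fun i hi => ?_
    simp [hJ0 F i hi]
  · refine aux_fin e F _ fun i hi => ?_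
    simp [hJ0 F i hi]
  · intro i
    by_cases hi : i ∈ F
    · obtain ⟨r, hr⟩ := hD ⟨i, hi⟩
      refine ⟨r, ?_⟩
      simp only [ContinuousLinearMap.comp_apply]
      rw [hJa F ⟨i, hi⟩, hr, map_smul, hJ F ⟨i, hi⟩]
    · exact ⟨0, by simp [hJ0 F i hi]⟩
  · unfold hsNormWrt
    rw [Real.sqrt_lt' hε]
    refine lt_of_eq_of_lt ?_ hF
    refine tsum_congr fun i => ?_
    have hT' : ∀ z, adjoint (J F) (x (J F z)) = U (D (V z)) :=
      fun z => congrArg (fun A => A z) hT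
    congr 2
    rw [hT']
    simp [j1]

end
end
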